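/- Let n ≥ 3 and 0 < λ ≤ Λ, and set ñ = (λ/Λ)(n−1) + 1. Let p > 1 and assume either ñ > 2 and p ≤ ñ/(ñ−2), or ñ ≤ 2. If u is continuous on the closed half space, nonnegative in ℝⁿ₊, equal to 0 on the boundary ∂ℝⁿ₊ = {xₙ = 0}, and is a viscosity solution of M⁺_{λ,Λ}(D²u) + u^p = 0 in ℝⁿ₊ (no boundedness assumption on u), then u is identically zero. -/

import Mathlib

open scoped BigOperators

/-- The Pucci maximal operator `M⁺_{λ,Λ}`: for a symmetric matrix it equals
`Λ · (sum of positive eigenvalues) + λ · (sum of negative eigenvalues)`. -/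
noncomputable def pucciMax (lam Lam : ℝ) {n : ℕ} (M : Matrix (Fin n) (Fin n) ℝ) : ℝ :=
  if h : M.IsHermitian then
    ∑ i, (Lam * max (h.eigenvalues i) 0 + lam * min (h.eigenvalues i) 0)
  else 0

/-- The Hessian matrix of `φ` at `x`. -/
noncomputable def hess {n : ℕ} (φ : EuclideanSpace ℝ (Fin n) → ℝ)
    (x : EuclideanSpace ℝ (Fin n)) : Matrix (Fin n) (Fin n) ℝ :=
  fun i j => iteratedFDeriv ℝ 2 φ x ![EuclideanSpace.single i 1, EuclideanSpace.single j 1]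

/-- `u` is a viscosity supersolution of `M⁺_{λ,Λ}(D²u) + g = 0` in `Ω`. -/
def PucciSupersol (lam Lam : ℝ) {n : ℕ} (Ω : Set (EuclideanSpace ℝ (Fin n)))
    (u g : EuclideanSpace ℝ (Fin n) → ℝ) : Prop :=
  ∀ x₀ ∈ Ω, ∀ φ : EuclideanSpace ℝ (Fin n) → ℝ, ContDiff ℝ 2 φ →
    IsLocalMin (fun x => u x - φ x) x₀ → pucciMax lam Lam (hess φ x₀) + g x₀ ≤ 0

/-- `u` is a viscosity subsolution of `M⁺_{λ,Λ}(D²u) + g = 0` in `Ω`. -/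
def PucciSubsol (lam Lam : ℝ) {n : ℕ} (Ω : Set (EuclideanSpace ℝ (Fin n)))
    (u g : EuclideanSpace ℝ (Fin n) → ℝ) : Prop :=
  ∀ x₀ ∈ Ω, ∀ φ : EuclideanSpace ℝ (Fin n) → ℝ, ContDiff ℝ 2 φ →
    IsLocalMax (fun x => u x - φ x) x₀ → 0 ≤ pucciMax lam Lam (hess φ x₀) + g x₀

section

open Set Filter Topology Metric
open scoped RealInnerProductSpace

/-- `ℝⁿ` with its Euclidean norm. -/
abbrev Eucl (n : ℕ) := EuclideanSpace ℝ (Fin n)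

section SecondDerivative

variable {E : Type*} [NormedAddCommGroup E] [NormedSpace ℝ E]

/-- The second derivative of `φ` at `x` along the line through `x` in direction `v`. -/
noncomputable def lineDeriv₂ (φ : E → ℝ) (x v : E) : ℝ :=
  deriv (deriv fun t : ℝ => φ (x + t • v)) 0

lemma lineDeriv₂_eq_of_hasDerivAt {φ : E → ℝ} {x v : E} {g : ℝ → ℝ} {c : ℝ}
    (h₁ : ∀ᶠ t in 𝓝 (0 : ℝ), HasDerivAt (fun t : ℝ => φ (x + t • v)) (g t) t)
    (h₂ : HasDerivAt g c 0) : lineDeriv₂ φ x v = c := by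
  have : deriv (fun t : ℝ => φ (x + t • v)) =ᶠ[𝓝 0] g := h₁.mono fun t ht => ht.deriv
  rw [lineDeriv₂, this.deriv_eq, h₂.deriv]

lemma lineDeriv₂_congr {φ ψ : E → ℝ} {x : E} (h : φ =ᶠ[𝓝 x] ψ) (v : E) :
    lineDeriv₂ φ x v = lineDeriv₂ ψ x v := by
  have hc : Tendsto (fun t : ℝ => x + t • v) (𝓝 0) (𝓝 x) := by
    have : Continuous fun t : ℝ => x + t • v := by fun_prop
    simpa using this.tendsto 0
  have h1 : (fun t : ℝ => φ (x + t • v)) =ᶠ[𝓝 0] fun t : ℝ => ψ (x + t • v) := hc.eventually h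
  exact h1.deriv.deriv_eq

lemma hasDerivAt_line (x v : E) (t : ℝ) : HasDerivAt (fun t : ℝ => x + t • v) v t := by
  simpa using ((hasDerivAt_id t).smul_const v).const_add x

lemma tendsto_line (x v : E) : Tendsto (fun t : ℝ => x + t • v) (𝓝 0) (𝓝 x) := by
  have : Continuous fun t : ℝ => x + t • v := by fun_prop
  simpa using this.tendsto 0

lemma ContDiffAt.hasDerivAt_line {φ : E → ℝ} {x : E} (h : ContDiffAt ℝ 2 φ x) (v : E) :
    (∀ᶠ t in 𝓝 (0 : ℝ), HasDerivAt (fun t : ℝ => φ (x + t • v)) (fderiv ℝ φ (x + t • v) v) t) ∧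
    HasDerivAt (fun t : ℝ => fderiv ℝ φ (x + t • v) v) (fderiv ℝ (fderiv ℝ φ) x v v) 0 := by
  constructor
  · have h1 : ∀ᶠ y in 𝓝 x, ContDiffAt ℝ 2 φ y := h.eventually (by simp)
    refine ((tendsto_line x v).eventually h1).mono fun t ht => ?_
    exact (ht.differentiableAt (by norm_num)).hasFDerivAt.comp_hasDerivAt t (_root_.hasDerivAt_line x v t)
  · have h2 : ContDiffAt ℝ 1 (fderiv ℝ φ) x := h.fderiv_right (by norm_num)
    have h3 := (h2.differentiableAt (by norm_num)).hasFDerivAt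
    have h4 : HasDerivAt (fun t : ℝ => fderiv ℝ φ (x + t • v)) (fderiv ℝ (fderiv ℝ φ) x v) 0 := by
      have h3' : HasFDerivAt (fderiv ℝ φ) (fderiv ℝ (fderiv ℝ φ) x) (x + (0 : ℝ) • v) := by
        simpa using h3
      exact h3'.comp_hasDerivAt (0 : ℝ) (_root_.hasDerivAt_line x v 0)
    simpa using h4.clm_apply (hasDerivAt_const (0 : ℝ) v)

lemma lineDeriv₂_eq_fderiv {φ : E → ℝ} {x : E} (h : ContDiffAt ℝ 2 φ x) (v : E) :
    lineDeriv₂ φ x v = fderiv ℝ (fderiv ℝ φ) x v v :=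
  lineDeriv₂_eq_of_hasDerivAt (h.hasDerivAt_line v).1 (h.hasDerivAt_line v).2

lemma lineDeriv₂_add {φ ψ : E → ℝ} {x : E} (h : ContDiffAt ℝ 2 φ x) (h' : ContDiffAt ℝ 2 ψ x)
    (v : E) : lineDeriv₂ (fun z => φ z + ψ z) x v = lineDeriv₂ φ x v + lineDeriv₂ ψ x v := by
  rw [lineDeriv₂_eq_fderiv h, lineDeriv₂_eq_fderiv h']
  exact lineDeriv₂_eq_of_hasDerivAt
    ((h.hasDerivAt_line v).1.and (h'.hasDerivAt_line v).1 |>.mono fun t ht => ht.1.add ht.2)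
    ((h.hasDerivAt_line v).2.add (h'.hasDerivAt_line v).2)

lemma lineDeriv₂_const_mul (k : ℝ) (φ : E → ℝ) (x v : E) :
    lineDeriv₂ (fun z => k * φ z) x v = k * lineDeriv₂ φ x v := by
  simp only [lineDeriv₂]
  have : deriv (fun t : ℝ => k * φ (x + t • v)) = fun t => k * deriv (fun t : ℝ => φ (x + t • v)) t := by
    ext t; simp
  rw [this]; simp

lemma lineDeriv₂_const (c : ℝ) (x v : E) : lineDeriv₂ (fun _ => c) x v = 0 := by
  simp [lineDeriv₂]

lemma lineDeriv₂_nonpos_of_isLocalMax {φ : E → ℝ} {x : E} (h : ContDiffAt ℝ 2 φ x)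
    (hm : IsLocalMax φ x) (v : E) : lineDeriv₂ φ x v ≤ 0 := by
  by_contra! hpos
  set g : ℝ → ℝ := fun t => φ (x + t • v) with hg
  have hmax : IsLocalMax g 0 := by
    have := (tendsto_line x v).eventually hm
    simpa [IsLocalMax, IsMaxFilter, hg] using this
  have hcont : ContinuousAt g 0 := (h.hasDerivAt_line v).1.self_of_nhds.continuousAt
  have hmin : IsLocalMin g 0 := isLocalMin_of_deriv_deriv_pos hpos hmax.deriv_eq_zero hcont
  have hc : g =ᶠ[𝓝 0] fun _ => g 0 := by
    filter_upwards [hmax, hmin] with t h1 h2 using le_antisymm h1 h2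
  have : deriv (deriv g) 0 = 0 := by
    rw [hc.deriv.deriv_eq]; simp
  exact absurd hpos (by simp [lineDeriv₂, ← hg, this])

lemma lineDeriv₂_comp_affine {F : Type*} [NormedAddCommGroup F] [NormedSpace ℝ F] (φ : F → ℝ)
    (y : F) (s : ℝ) (R : E →ₗ[ℝ] F) (x v : E) :
    lineDeriv₂ (fun z => φ (y + s • R z)) x v = s ^ 2 * lineDeriv₂ φ (y + s • R x) (R v) := by
  simp only [lineDeriv₂]
  set g : ℝ → ℝ := fun t => φ (y + s • R x + t • R v) with hg
  have h1 : (fun t : ℝ => φ (y + s • R (x + t • v))) = fun t => g (s * t) := by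
    ext t; simp only [hg, map_add, map_smul, smul_add, smul_smul, add_assoc]
  have h2 : deriv (fun t : ℝ => g (s * t)) = fun t => s * deriv g (s * t) := by
    ext t; simpa using deriv_comp_mul_left s g t
  rw [h1, h2, deriv_const_mul_field']
  have := deriv_comp_mul_left s (deriv g) 0
  simp only [mul_zero, smul_eq_mul] at this
  change s * deriv (fun t => deriv g (s * t)) 0 = _
  rw [this]; ring

lemma continuous_fderiv_fderiv {φ : E → ℝ} (h : ContDiff ℝ 2 φ) :
    Continuous (fderiv ℝ (fderiv ℝ φ)) :=
  (h.fderiv_right (m := 1) (by norm_num)).continuous_fderiv (by norm_num)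

end SecondDerivative

section LocalTest

variable {E : Type*} [NormedAddCommGroup E] [InnerProductSpace ℝ E] [FiniteDimensional ℝ E]

lemma ContDiffAt.exists_contDiff_eventuallyEq {φ : E → ℝ} {x₀ : E} (h : ContDiffAt ℝ 2 φ x₀) :
    ∃ ψ : E → ℝ, ContDiff ℝ 2 ψ ∧ ψ =ᶠ[𝓝 x₀] φ := by
  have h1 : ∀ᶠ y in 𝓝 x₀, ContDiffAt ℝ 2 φ y := h.eventually (by simp)
  obtain ⟨r, hr, hr'⟩ := Metric.eventually_nhds_iff_ball.1 h1
  let f : ContDiffBump x₀ := ⟨r / 3, r / 2, by positivity, by linarith⟩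
  refine ⟨fun x => f x * φ x, ?_, ?_⟩
  · rw [contDiff_iff_contDiffAt]
    intro x
    by_cases hx : x ∈ ball x₀ r
    · exact f.contDiff.contDiffAt.mul (hr' x hx)
    · have hx' : x ∈ (closedBall x₀ (r / 2))ᶜ := by
        simp only [mem_ball, not_lt, mem_compl_iff, mem_closedBall, not_le] at hx ⊢
        linarith
      have h0 : (fun x => f x * φ x) =ᶠ[𝓝 x] fun _ => 0 := by
        filter_upwards [isClosed_closedBall.isOpen_compl.mem_nhds hx'] with y hy
        have : f y = 0 := f.zero_of_le_dist (by
          simp only [mem_compl_iff, mem_closedBall, not_le] at hy; exact hy.le)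
        simp [this]
      exact (contDiffAt_const (c := (0 : ℝ))).congr_of_eventuallyEq h0
  · filter_upwards [closedBall_mem_nhds x₀ f.rIn_pos] with y hy
    simp [f.one_of_mem_closedBall hy]

end LocalTest

/-- The data of a constant-coefficient elliptic operator: an orthonormal frame and the
weights of the second derivatives along its directions. -/
abbrev Coeff (n : ℕ) := OrthonormalBasis (Fin n) ℝ (Eucl n) × (Fin n → ℝ)

/-- The constant-coefficient second order operator `∑ aᵢ ∂²/∂eᵢ²`. -/
noncomputable def ellip {n : ℕ} (c : Coeff n) (φ : Eucl n → ℝ) (x : Eucl n) : ℝ :=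
  ∑ i, c.2 i * lineDeriv₂ φ x (c.1 i)

/-- The operators with ellipticity constants `lam ≤ Lam`. -/
def admissible (n : ℕ) (lam Lam : ℝ) : Set (Coeff n) := {c | ∀ i, c.2 i ∈ Icc lam Lam}

/-- `v` is a viscosity subsolution of `sup_{c ∈ 𝒜} ellip c v + f = 0`. -/
def IsSub {n : ℕ} (𝒜 : Set (Coeff n)) (Ω : Set (Eucl n)) (v f : Eucl n → ℝ) : Prop :=
  ∀ x₀ ∈ Ω, ∀ φ : Eucl n → ℝ, ContDiffAt ℝ 2 φ x₀ → IsLocalMax (fun x => v x - φ x) x₀ →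
    ∀ ε > 0, ∃ c ∈ 𝒜, -ε ≤ ellip c φ x₀ + f x₀

/-- `w` is a viscosity supersolution of `sup_{c ∈ 𝒜} ellip c w + g = 0`. -/
def IsSuper {n : ℕ} (𝒜 : Set (Coeff n)) (Ω : Set (Eucl n)) (w g : Eucl n → ℝ) : Prop :=
  ∀ x₀ ∈ Ω, ∀ φ : Eucl n → ℝ, ContDiffAt ℝ 2 φ x₀ → IsLocalMin (fun x => w x - φ x) x₀ →
    ∀ c ∈ 𝒜, ellip c φ x₀ + g x₀ ≤ 0

variable {n : ℕ}

lemma ellip_congr (c : Coeff n) {φ ψ : Eucl n → ℝ} {x : Eucl n} (h : φ =ᶠ[𝓝 x] ψ) :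
    ellip c φ x = ellip c ψ x := by
  simp only [ellip, lineDeriv₂_congr h]

lemma ellip_add (c : Coeff n) {φ ψ : Eucl n → ℝ} {x : Eucl n} (h : ContDiffAt ℝ 2 φ x)
    (h' : ContDiffAt ℝ 2 ψ x) : ellip c (fun z => φ z + ψ z) x = ellip c φ x + ellip c ψ x := by
  simp only [ellip, lineDeriv₂_add h h', mul_add, Finset.sum_add_distrib]

lemma ellip_const_mul (c : Coeff n) (k : ℝ) (φ : Eucl n → ℝ) (x : Eucl n) :
    ellip c (fun z => k * φ z) x = k * ellip c φ x := by
  simp only [ellip, lineDeriv₂_const_mul, Finset.mul_sum]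
  exact Finset.sum_congr rfl fun i _ => by ring

lemma ellip_neg (c : Coeff n) (φ : Eucl n → ℝ) (x : Eucl n) :
    ellip c (fun z => - φ z) x = - ellip c φ x := by
  simpa using ellip_const_mul c (-1) φ x

lemma ellip_const (c : Coeff n) (k : ℝ) (x : Eucl n) : ellip c (fun _ => k) x = 0 := by
  simp [ellip, lineDeriv₂_const]

lemma isSuper_iff_forall_isSub {𝒜 : Set (Coeff n)} {Ω : Set (Eucl n)} {w g : Eucl n → ℝ} :
    IsSuper 𝒜 Ω w g ↔ ∀ c ∈ 𝒜, IsSub {c} Ω (fun x => - w x) (fun x => - g x) := by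
  constructor
  · intro h c hc x₀ hx₀ φ hφ hm ε hε
    refine ⟨c, rfl, ?_⟩
    have := h x₀ hx₀ (fun z => - φ z) hφ.neg
      (hm.neg.congr (Eventually.of_forall fun y => by ring)) c hc
    rw [ellip_neg] at this
    linarith
  · intro h x₀ hx₀ φ hφ hm c hc
    have := h c hc x₀ hx₀ (fun z => - φ z) hφ.neg
      (hm.neg.congr (Eventually.of_forall fun y => by ring))
    refine le_of_forall_pos_le_add fun ε hε => ?_
    obtain ⟨c', rfl, h'⟩ := this ε hε
    rw [ellip_neg] at h'
    linarith

lemma IsSub.mono {𝒜 : Set (Coeff n)} {Ω Ω' : Set (Eucl n)} {v f : Eucl n → ℝ}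
    (h : IsSub 𝒜 Ω v f) (hs : Ω' ⊆ Ω) : IsSub 𝒜 Ω' v f := fun x hx => h x (hs hx)

lemma IsSuper.mono {𝒜 : Set (Coeff n)} {Ω Ω' : Set (Eucl n)} {v f : Eucl n → ℝ}
    (h : IsSuper 𝒜 Ω v f) (hs : Ω' ⊆ Ω) : IsSuper 𝒜 Ω' v f := fun x hx => h x (hs hx)

section Pucci

lemma hess_isHermitian {φ : Eucl n → ℝ} (h : ContDiff ℝ 2 φ) (x : Eucl n) :
    (hess φ x).IsHermitian := by
  have hs := (h.contDiffAt (x := x)).isSymmSndFDerivAt (by simp)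
  ext i j
  simp only [hess, Matrix.conjTranspose_apply, iteratedFDeriv_two_apply, star_trivial]
  exact hs _ _

lemma lineDeriv₂_eq_sum_eigenvalues {φ : Eucl n → ℝ} (h : ContDiff ℝ 2 φ) (x v : Eucl n) :
    lineDeriv₂ φ x v = ∑ j, (hess_isHermitian h x).eigenvalues j *
      ⟪(hess_isHermitian h x).eigenvectorBasis j, v⟫ ^ 2 := by
  set hM := hess_isHermitian h x
  set B := fderiv ℝ (fderiv ℝ φ) x with hB
  have hsingle : ∀ w : Eucl n, w = ∑ i, w i • EuclideanSpace.single i (1 : ℝ) := by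
    intro w
    simpa using ((EuclideanSpace.basisFun (Fin n) ℝ).sum_repr w).symm
  have key : ∀ u w : Eucl n, B u w = ∑ i, u i * (hess φ x).mulVec w i := by
    intro u w
    conv_lhs => rw [hsingle u, hsingle w]
    simp only [map_sum, map_smul, FunLike.coe_sum, FunLike.coe_smul,
      Finset.sum_apply, Pi.smul_apply, smul_eq_mul, Matrix.mulVec, dotProduct, hess,
      iteratedFDeriv_two_apply, Finset.mul_sum]
    rw [Finset.sum_comm]
    refine Finset.sum_congr rfl fun i _ => Finset.sum_congr rfl fun j _ => ?_
    simp [hB]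
    ring
  have key2 : ∀ u j, B u (hM.eigenvectorBasis j) = hM.eigenvalues j * ⟪hM.eigenvectorBasis j, u⟫ := by
    intro u j
    rw [key, hM.mulVec_eigenvectorBasis j, PiLp.inner_apply, Finset.mul_sum]
    refine Finset.sum_congr rfl fun i _ => ?_
    simp
    ring
  rw [lineDeriv₂_eq_fderiv h.contDiffAt]
  conv_lhs => rw [← hM.eigenvectorBasis.sum_repr' v]
  rw [map_sum]
  simp only [map_smul, smul_eq_mul]
  rw [← hB, hM.eigenvectorBasis.sum_repr' v]
  refine Finset.sum_congr rfl fun j _ => ?_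
  rw [key2]; ring

lemma ellip_le_pucciMax {lam Lam : ℝ} {φ : Eucl n → ℝ} (h : ContDiff ℝ 2 φ)
    (x : Eucl n) {c : Coeff n} (hc : c ∈ admissible n lam Lam) :
    ellip c φ x ≤ pucciMax lam Lam (hess φ x) := by
  have hM := hess_isHermitian h x
  rw [pucciMax, dif_pos hM, ellip]
  simp only [lineDeriv₂_eq_sum_eigenvalues h, Finset.mul_sum]
  rw [Finset.sum_comm]
  refine Finset.sum_le_sum fun j _ => ?_
  set μ := hM.eigenvalues j
  set f := hM.eigenvectorBasis j
  have h1 : ∑ i, ⟪f, c.1 i⟫ ^ 2 = 1 := by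
    have := c.1.sum_sq_inner_left f
    rw [this, hM.eigenvectorBasis.norm_eq_one, one_pow]
  have h2 : ∑ i, c.2 i * (μ * ⟪f, c.1 i⟫ ^ 2) = μ * ∑ i, c.2 i * ⟪f, c.1 i⟫ ^ 2 := by
    rw [Finset.mul_sum]; exact Finset.sum_congr rfl fun i _ => by ring
  have h3 : ∑ i, c.2 i * ⟪f, c.1 i⟫ ^ 2 ≤ Lam := by
    calc _ ≤ ∑ i, Lam * ⟪f, c.1 i⟫ ^ 2 :=
          Finset.sum_le_sum fun i _ => mul_le_mul_of_nonneg_right (hc i).2 (sq_nonneg _)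
      _ = Lam := by rw [← Finset.mul_sum, h1, mul_one]
  have h4 : lam ≤ ∑ i, c.2 i * ⟪f, c.1 i⟫ ^ 2 := by
    calc lam = ∑ i, lam * ⟪f, c.1 i⟫ ^ 2 := by rw [← Finset.mul_sum, h1, mul_one]
      _ ≤ _ := Finset.sum_le_sum fun i _ => mul_le_mul_of_nonneg_right (hc i).1 (sq_nonneg _)
  rw [h2]
  rcases le_total 0 μ with hμ | hμ
  · rw [max_eq_left hμ, min_eq_right hμ]; nlinarith
  · rw [max_eq_right hμ, min_eq_left hμ]; nlinarith

lemma exists_ellip_eq_pucciMax {lam Lam : ℝ} (hl : lam ≤ Lam) {φ : Eucl n → ℝ}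
    (h : ContDiff ℝ 2 φ) (x : Eucl n) :
    ∃ c ∈ admissible n lam Lam, ellip c φ x = pucciMax lam Lam (hess φ x) := by
  have hM := hess_isHermitian h x
  refine ⟨(hM.eigenvectorBasis, fun j => if 0 ≤ hM.eigenvalues j then Lam else lam), ?_, ?_⟩
  · intro i
    dsimp only
    split_ifs <;> simp [hl]
  · rw [pucciMax, dif_pos hM, ellip]
    refine Finset.sum_congr rfl fun j _ => ?_
    have : lineDeriv₂ φ x (hM.eigenvectorBasis j) = hM.eigenvalues j := by
      rw [lineDeriv₂_eq_sum_eigenvalues h, Finset.sum_eq_single j]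
      · simp
      · intro i _ hij
        rw [hM.eigenvectorBasis.inner_eq_zero hij]; simp
      · simp
    simp only [this]
    split_ifs with hj
    · rw [max_eq_left hj, min_eq_right hj]; ring
    · push Not at hj
      rw [max_eq_right hj.le, min_eq_left hj.le]; ring

lemma PucciSubsol.isSub {lam Lam : ℝ} (hl : lam ≤ Lam) {Ω : Set (Eucl n)} {u g : Eucl n → ℝ}
    (h : PucciSubsol lam Lam Ω u g) : IsSub (admissible n lam Lam) Ω u g := by
  intro x₀ hx₀ φ hφ hm ε hε
  obtain ⟨ψ, hψ, he⟩ := hφ.exists_contDiff_eventuallyEq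
  obtain ⟨c, hc, hc'⟩ := exists_ellip_eq_pucciMax hl hψ x₀
  refine ⟨c, hc, ?_⟩
  rw [← ellip_congr c he, hc']
  have := h x₀ hx₀ ψ hψ (hm.congr (by filter_upwards [he] with y hy; rw [hy]))
  linarith

lemma PucciSupersol.isSuper {lam Lam : ℝ} {Ω : Set (Eucl n)} {u g : Eucl n → ℝ}
    (h : PucciSupersol lam Lam Ω u g) : IsSuper (admissible n lam Lam) Ω u g := by
  intro x₀ hx₀ φ hφ hm c hc
  obtain ⟨ψ, hψ, he⟩ := hφ.exists_contDiff_eventuallyEq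
  rw [← ellip_congr c he]
  have := h x₀ hx₀ ψ hψ (hm.congr (by filter_upwards [he] with y hy; rw [hy]))
  linarith [ellip_le_pucciMax hψ x₀ hc]

end Pucci

section Polynomial

variable {n : ℕ}

/-- The polynomial function with coordinates taken with respect to an orthonormal basis. -/
noncomputable def polyFun (b : OrthonormalBasis (Fin n) ℝ (Eucl n)) (P : MvPolynomial (Fin n) ℝ)
    (x : Eucl n) : ℝ := MvPolynomial.eval (fun i => ⟪b i, x⟫) P

lemma polyFun_mul (b : OrthonormalBasis (Fin n) ℝ (Eucl n)) (P Q : MvPolynomial (Fin n) ℝ)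
    (x : Eucl n) : polyFun b (P * Q) x = polyFun b P x * polyFun b Q x := by simp [polyFun]

lemma polyFun_add (b : OrthonormalBasis (Fin n) ℝ (Eucl n)) (P Q : MvPolynomial (Fin n) ℝ)
    (x : Eucl n) : polyFun b (P + Q) x = polyFun b P x + polyFun b Q x := by simp [polyFun]

lemma polyFun_C (b : OrthonormalBasis (Fin n) ℝ (Eucl n)) (a : ℝ)
    (x : Eucl n) : polyFun b (MvPolynomial.C a) x = a := by simp [polyFun]

lemma polyFun_X (b : OrthonormalBasis (Fin n) ℝ (Eucl n)) (i : Fin n)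
    (x : Eucl n) : polyFun b (MvPolynomial.X i) x = ⟪b i, x⟫ := by simp [polyFun]

lemma contDiff_polyFun (b : OrthonormalBasis (Fin n) ℝ (Eucl n)) (P : MvPolynomial (Fin n) ℝ) :
    ContDiff ℝ 2 (polyFun b P) := by
  induction P using MvPolynomial.induction_on with
  | C a => simpa only [funext (polyFun_C b a)] using! contDiff_const
  | add p q hp hq => simpa only [funext (polyFun_add b p q)] using! hp.add hq
  | mul_X p i hp =>
    have h : ContDiff ℝ 2 fun x : Eucl n => ⟪b i, x⟫ := contDiff_const.inner ℝ contDiff_id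
    simpa only [funext (polyFun_mul b p _), polyFun_X] using! hp.mul h

lemma hasDerivAt_polyFun (b : OrthonormalBasis (Fin n) ℝ (Eucl n)) (P : MvPolynomial (Fin n) ℝ)
    (x : Eucl n) (i : Fin n) (t : ℝ) :
    HasDerivAt (fun t : ℝ => polyFun b P (x + t • b i))
      (polyFun b (MvPolynomial.pderiv i P) (x + t • b i)) t := by
  induction P using MvPolynomial.induction_on with
  | C a => simpa [polyFun] using hasDerivAt_const t a
  | add p q hp hq => simpa only [polyFun_add, map_add] using hp.fun_add hq
  | mul_X p j hp =>
    have h : HasDerivAt (fun t : ℝ => ⟪b j, x + t • b i⟫) ⟪b j, b i⟫ t := by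
      simpa using (hasDerivAt_const t (b j)).inner ℝ (hasDerivAt_line x (b i) t)
    have h2 := hp.fun_mul h
    have h3 : (MvPolynomial.pderiv i (p * MvPolynomial.X j)) =
        MvPolynomial.pderiv i p * MvPolynomial.X j + p * MvPolynomial.C ⟪b j, b i⟫ := by
      rw [Derivation.leibniz, MvPolynomial.pderiv_X]
      by_cases hij : j = i
      · subst hij; simp; ring
      · simp [b.inner_eq_zero hij, Ne.symm hij]; ring
    rw [h3]
    simpa only [polyFun_add, polyFun_mul, polyFun_X, polyFun_C] using h2

/-- The polynomial version of `ellip`. -/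
noncomputable def polyEllip (a : Fin n → ℝ) :
    MvPolynomial (Fin n) ℝ →ₗ[ℝ] MvPolynomial (Fin n) ℝ :=
  ∑ i, a i • ((MvPolynomial.pderiv i).toLinearMap ∘ₗ (MvPolynomial.pderiv i).toLinearMap)

lemma ellip_polyFun (c : Coeff n) (P : MvPolynomial (Fin n) ℝ) (x : Eucl n) :
    ellip c (polyFun c.1 P) x = polyFun c.1 (polyEllip c.2 P) x := by
  have h : ∀ i, lineDeriv₂ (polyFun c.1 P) x (c.1 i) =
      polyFun c.1 (MvPolynomial.pderiv i (MvPolynomial.pderiv i P)) x := fun i =>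
    lineDeriv₂_eq_of_hasDerivAt (Eventually.of_forall fun t => hasDerivAt_polyFun c.1 P x i t)
      (by simpa using hasDerivAt_polyFun c.1 (MvPolynomial.pderiv i P) x i 0)
  simp only [ellip, h]
  simp [polyFun, polyEllip, MvPolynomial.smul_eval]

lemma totalDegree_pderiv_le (i : Fin n) (P : MvPolynomial (Fin n) ℝ) :
    (MvPolynomial.pderiv i P).totalDegree ≤ P.totalDegree - 1 := by
  refine Finset.sup_le fun m hm => ?_
  rw [MvPolynomial.mem_support_iff, MvPolynomial.coeff_pderiv] at hm
  have h1 : m + Finsupp.single i 1 ∈ P.support := by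
    rw [MvPolynomial.mem_support_iff]
    exact left_ne_zero_of_mul hm
  have h2 := MvPolynomial.le_totalDegree h1
  rw [Finsupp.sum_add_index' (by simp) (by simp)] at h2
  simp at h2
  omega

lemma totalDegree_polyEllip_le (a : Fin n → ℝ) (P : MvPolynomial (Fin n) ℝ) :
    (polyEllip a P).totalDegree ≤ P.totalDegree - 2 := by
  have h0 : polyEllip a P = ∑ i, a i • MvPolynomial.pderiv i (MvPolynomial.pderiv i P) := by
    simp [polyEllip]
  rw [h0]
  refine (MvPolynomial.totalDegree_finsetSum _ _).trans (Finset.sup_le fun i _ => ?_)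
  refine (MvPolynomial.totalDegree_smul_le _ _).trans ?_
  have h1 := totalDegree_pderiv_le i (MvPolynomial.pderiv i P)
  have h2 := totalDegree_pderiv_le i P
  omega

/-- The polynomial `s² - |X|²`. -/
noncomputable def spherePoly (n : ℕ) (s : ℝ) : MvPolynomial (Fin n) ℝ :=
  MvPolynomial.C (s ^ 2) - ∑ i, MvPolynomial.X i ^ 2

lemma totalDegree_spherePoly_le (n : ℕ) (s : ℝ) : (spherePoly n s).totalDegree ≤ 2 := by
  refine (MvPolynomial.totalDegree_sub _ _).trans (max_le (by rw [MvPolynomial.totalDegree_C]; omega) ?_)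
  exact (MvPolynomial.totalDegree_finsetSum _ _).trans (Finset.sup_le fun i _ => by
    exact (MvPolynomial.totalDegree_pow _ _).trans (by simp))

lemma polyFun_spherePoly (b : OrthonormalBasis (Fin n) ℝ (Eucl n)) (s : ℝ) (x : Eucl n) :
    polyFun b (spherePoly n s) x = s ^ 2 - ‖x‖ ^ 2 := by
  simp [polyFun, spherePoly, b.sum_sq_inner_right]

lemma spherePoly_ne_zero {s : ℝ} (hs : 0 < s) : spherePoly n s ≠ 0 := by
  intro h
  have := congrArg (MvPolynomial.eval (fun _ => (0 : ℝ))) h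
  simp [spherePoly, hs.ne'] at this

lemma polyFun_eq_zero_of_ball {b : OrthonormalBasis (Fin n) ℝ (Eucl n)} {s : ℝ} (hs : 0 < s)
    {P : MvPolynomial (Fin n) ℝ} (h : ∀ x ∈ ball (0 : Eucl n) s, polyFun b P x = 0) : P = 0 := by
  refine MvPolynomial.funext_set (fun _ => Ioo (0 : ℝ) (s / (n + 1)))
    (fun _ => Ioo_infinite (by positivity)) fun x hx => ?_
  have hy : ∀ i, ⟪b i, ∑ j, x j • b j⟫ = x i := fun i => by
    rw [inner_sum, Finset.sum_eq_single i]
    · simp [inner_smul_right]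
    · intro j _ hj; simp [inner_smul_right, b.inner_eq_zero hj.symm]
    · simp
  have := h (∑ j, x j • b j) (by
    rw [mem_ball_zero_iff]
    calc ‖∑ j, x j • b j‖ ≤ ∑ j : Fin n, ‖x j • b j‖ := norm_sum_le _ _
      _ ≤ ∑ j : Fin n, s / (n + 1) := Finset.sum_le_sum fun j _ => by
          have := hx j (mem_univ _)
          simp only [mem_Ioo] at this
          rw [norm_smul, b.norm_eq_one, mul_one, Real.norm_eq_abs, abs_of_pos this.1]
          exact this.2.le
      _ < s := by
          simp only [Finset.sum_const, Finset.card_univ, Fintype.card_fin, nsmul_eq_mul]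
          rw [mul_div_assoc', div_lt_iff₀ (by positivity)]
          nlinarith)
  simpa [polyFun, hy] using this

end Polynomial

section Dirichlet

variable {n : ℕ}

lemma lineDeriv₂_norm_sub_sq (y x v : Eucl n) :
    lineDeriv₂ (fun z => ‖z - y‖ ^ 2) x v = 2 * ‖v‖ ^ 2 := by
  refine lineDeriv₂_eq_of_hasDerivAt (g := fun t => 2 * ⟪x - y, v⟫ + 2 * t * ‖v‖ ^ 2)
    (Eventually.of_forall fun t => ?_) ?_
  · have h : (fun t : ℝ => ‖x + t • v - y‖ ^ 2) =
        fun t => ‖x - y‖ ^ 2 + 2 * ⟪x - y, v⟫ * t + ‖v‖ ^ 2 * t ^ 2 := by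
      ext t
      rw [show x + t • v - y = (x - y) + t • v by abel, norm_add_sq_real, inner_smul_right,
        norm_smul, mul_pow, Real.norm_eq_abs, sq_abs]
      ring
    rw [h]
    have := ((((hasDerivAt_id t).const_mul (2 * ⟪x - y, v⟫)).const_add (‖x - y‖ ^ 2))).fun_add
      (((hasDerivAt_id t).fun_pow 2).const_mul (‖v‖ ^ 2))
    exact this.congr_deriv (by simp; ring)
  · simpa using ((((hasDerivAt_id (0 : ℝ)).const_mul 2).mul_const (‖v‖ ^ 2)).const_add
      (2 * ⟪x - y, v⟫))

lemma contDiff_norm_sub_sq (y : Eucl n) : ContDiff ℝ 2 fun z : Eucl n => ‖z - y‖ ^ 2 :=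
  (contDiff_id.sub contDiff_const).norm_sq ℝ

lemma ellip_norm_sub_sq (c : Coeff n) (y x : Eucl n) :
    ellip c (fun z => ‖z - y‖ ^ 2) x = 2 * ∑ i, c.2 i := by
  simp only [ellip, lineDeriv₂_norm_sub_sq, c.1.norm_eq_one, Finset.mul_sum]
  exact Finset.sum_congr rfl fun i _ => by ring

lemma ellip_nonpos_of_isLocalMax {c : Coeff n} (hc : ∀ i, 0 ≤ c.2 i) {φ : Eucl n → ℝ}
    {x : Eucl n} (h : ContDiffAt ℝ 2 φ x) (hm : IsLocalMax φ x) : ellip c φ x ≤ 0 :=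
  Finset.sum_nonpos fun i _ =>
    mul_nonpos_of_nonneg_of_nonpos (hc i) (lineDeriv₂_nonpos_of_isLocalMax h hm _)

/-- A supersolution lies above any strict smooth subsolution lying below it on the sphere. -/
lemma IsSuper.le_of_le_sphere {c : Coeff n} {s : ℝ} {w g ψ : Eucl n → ℝ}
    (hs : 0 < s) (hw : ContinuousOn w (closedBall 0 s)) (hS : IsSuper {c} (ball 0 s) w g)
    (hψ : ContDiff ℝ 2 ψ) (hLψ : ∀ x ∈ ball (0 : Eucl n) s, 0 < ellip c ψ x + g x)
    (hb : ∀ x ∈ sphere (0 : Eucl n) s, ψ x ≤ w x) : ∀ x ∈ closedBall (0 : Eucl n) s, ψ x ≤ w x := by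
  obtain ⟨q, hq, hmin⟩ := (isCompact_closedBall (0 : Eucl n) s).exists_isMinOn
    ⟨0, mem_closedBall_self hs.le⟩ (hw.sub hψ.continuous.continuousOn)
  have hqs : ψ q ≤ w q := by
    by_cases h : q ∈ sphere (0 : Eucl n) s
    · exact hb q h
    · have hq' : q ∈ ball (0 : Eucl n) s := by
        rw [mem_ball]; exact lt_of_le_of_ne hq h
      have := hS q hq' ψ hψ.contDiffAt
        (hmin.isLocalMin (mem_of_superset (isOpen_ball.mem_nhds hq') ball_subset_closedBall)) c rfl
      linarith [hLψ q hq']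
  intro x hx
  have := isMinOn_iff.1 hmin x hx
  simp only [Pi.sub_apply] at this
  linarith

lemma isSuper_of_contDiff {c : Coeff n} (hc : ∀ i, 0 ≤ c.2 i) {Ω : Set (Eucl n)}
    {w g : Eucl n → ℝ} (hw : ContDiff ℝ 2 w) (h : ∀ x ∈ Ω, ellip c w x + g x ≤ 0) :
    IsSuper {c} Ω w g := by
  intro x hx φ hφ hm c' hc'
  obtain rfl : c' = c := hc'
  have h1 := ellip_nonpos_of_isLocalMax hc (hφ.add (hw.contDiffAt.neg))
    (hm.neg.congr (Eventually.of_forall fun y => by simp; ring))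
  have h2 := ellip_add c' hφ (hw.contDiffAt (x := x)).neg
  rw [ellip_neg] at h2
  have h3 : ellip c' (φ + -w) x = ellip c' φ x + -ellip c' w x := h2
  linarith [h x hx]

lemma contDiff_zero_of_sphere {c : Coeff n} (hc : ∀ i, 0 ≤ c.2 i) (hc' : 0 < ∑ i, c.2 i)
    {s B : ℝ} (hs : 0 < s) {F : Eucl n → ℝ} (hF : ContDiff ℝ 2 F)
    (h : ∀ x ∈ ball (0 : Eucl n) s, ellip c F x = 0)
    (hb : ∀ x ∈ sphere (0 : Eucl n) s, F x ≤ B) : ∀ x ∈ closedBall (0 : Eucl n) s, F x ≤ B := by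
  have key : ∀ ε > 0, ∀ x ∈ closedBall (0 : Eucl n) s, F x + ε * ‖x - 0‖ ^ 2 ≤ B + ε * s ^ 2 := by
    intro ε hε
    refine IsSuper.le_of_le_sphere hs continuousOn_const (w := fun _ => B + ε * s ^ 2)
      (g := fun _ => 0) (c := c)
      (isSuper_of_contDiff hc contDiff_const fun x _ => by simp [ellip_const])
      (hF.add (contDiff_const.mul (contDiff_norm_sub_sq 0))) (fun x hx => ?_) (fun x hx => ?_)
    · rw [ellip_add c hF.contDiffAt
        (contDiff_const.mul (contDiff_norm_sub_sq 0)).contDiffAt, ellip_const_mul,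
        ellip_norm_sub_sq, h x hx]
      positivity
    · have := hb x hx
      rw [mem_sphere_zero_iff_norm] at hx
      rw [sub_zero, hx]; linarith
  intro x hx
  refine le_of_forall_pos_le_add fun ε hε => ?_
  have := key (ε / s ^ 2) (by positivity) x hx
  have h2 : ε / s ^ 2 * s ^ 2 = ε := by field_simp
  nlinarith [show 0 ≤ ε / s ^ 2 * ‖x - 0‖ ^ 2 by positivity]

lemma exists_harmonic_eq_on_sphere {c : Coeff n} (hc : ∀ i, 0 ≤ c.2 i) (hc' : 0 < ∑ i, c.2 i)
    {s : ℝ} (hs : 0 < s) (P : MvPolynomial (Fin n) ℝ) :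
    ∃ H : MvPolynomial (Fin n) ℝ, polyEllip c.2 H = 0 ∧
      ∀ x ∈ sphere (0 : Eucl n) s, polyFun c.1 H x = polyFun c.1 P x := by
  let d := P.totalDegree
  let V := MvPolynomial.restrictTotalDegree (Fin n) ℝ d
  let Φ : V →ₗ[ℝ] V := LinearMap.restrict
    (polyEllip c.2 ∘ₗ LinearMap.mulLeft ℝ (spherePoly n s)) (by
      intro q hq
      rw [MvPolynomial.mem_restrictTotalDegree] at hq ⊢
      refine (totalDegree_polyEllip_le _ _).trans ?_
      have h1 := MvPolynomial.totalDegree_mul (spherePoly n s) q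
      have h2 := totalDegree_spherePoly_le n s
      simp only [LinearMap.mulLeft_apply]
      omega)
  have hinj : Function.Injective Φ := by
    rw [injective_iff_map_eq_zero]
    intro q hq
    have h1 : polyEllip c.2 (spherePoly n s * q) = 0 := congrArg Subtype.val hq
    set F := polyFun c.1 (spherePoly n s * (q : MvPolynomial (Fin n) ℝ)) with hF
    have hFs : ∀ x ∈ sphere (0 : Eucl n) s, F x = 0 := by
      intro x hx
      rw [mem_sphere_zero_iff_norm] at hx
      rw [hF, polyFun_mul, polyFun_spherePoly, hx, sub_self, zero_mul]
    have hFL : ∀ x, ellip c F x = 0 := fun x => by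
      rw [hF, ellip_polyFun, h1]; simp [polyFun]
    have hup := contDiff_zero_of_sphere hc hc' hs (contDiff_polyFun c.1 _)
      (fun x _ => hFL x) (fun x hx => (hFs x hx).le)
    have hlow := contDiff_zero_of_sphere hc hc' hs (contDiff_polyFun c.1 _).neg
      (B := 0) (F := fun x => - F x) (fun x _ => by rw [ellip_neg, hFL, neg_zero])
      (fun x hx => by rw [hFs x hx, neg_zero])
    have h0 := polyFun_eq_zero_of_ball (b := c.1) hs
      (P := spherePoly n s * (q : MvPolynomial (Fin n) ℝ)) fun x hx => by
        have h2 := hup x (ball_subset_closedBall hx)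
        have h3 := hlow x (ball_subset_closedBall hx)
        linarith
    rcases mul_eq_zero.1 h0 with h | h
    · exact absurd h (spherePoly_ne_zero hs)
    · exact Subtype.ext h
  have hsurj := LinearMap.injective_iff_surjective.1 hinj
  obtain ⟨q, hq⟩ := hsurj ⟨polyEllip c.2 P, by
    rw [MvPolynomial.mem_restrictTotalDegree]
    exact (totalDegree_polyEllip_le _ _).trans (Nat.sub_le _ _)⟩
  have hq' : polyEllip c.2 (spherePoly n s * q) = polyEllip c.2 P := congrArg Subtype.val hq
  refine ⟨P - spherePoly n s * q, by rw [map_sub, hq', sub_self], fun x hx => ?_⟩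
  rw [mem_sphere_zero_iff_norm] at hx
  have := polyFun_add c.1 (P - spherePoly n s * q) (spherePoly n s * q) x
  rw [sub_add_cancel, polyFun_mul, polyFun_spherePoly, hx] at this
  linarith

/-- Restriction of polynomial functions to the sphere. -/
noncomputable def polySphere (b : OrthonormalBasis (Fin n) ℝ (Eucl n)) (s : ℝ) :
    MvPolynomial (Fin n) ℝ →ₐ[ℝ] C(sphere (0 : Eucl n) s, ℝ) :=
  MvPolynomial.aeval fun i => ⟨fun x => ⟪b i, (x : Eucl n)⟫, by fun_prop⟩

lemma polySphere_apply (b : OrthonormalBasis (Fin n) ℝ (Eucl n)) (s : ℝ)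
    (P : MvPolynomial (Fin n) ℝ) (x : sphere (0 : Eucl n) s) :
    polySphere b s P x = polyFun b P x := by
  induction P using MvPolynomial.induction_on with
  | C a => simp [polySphere, polyFun]
  | add p q hp hq => rw [map_add, polyFun_add, ContinuousMap.add_apply, hp, hq]
  | mul_X p i hp =>
    rw [map_mul, polyFun_mul, ContinuousMap.mul_apply, hp, polyFun_X]
    simp [polySphere]

lemma exists_sphere_functional {c : Coeff n} (hc : ∀ i, 0 ≤ c.2 i) (hc' : 0 < ∑ i, c.2 i)
    {s : ℝ} (hs : 0 < s) :
    ∃ T : C(sphere (0 : Eucl n) s, ℝ) →L[ℝ] ℝ, ∀ F : C(sphere (0 : Eucl n) s, ℝ), ∀ ε > 0,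
      ∃ H : Eucl n → ℝ, ContDiff ℝ 2 H ∧ (∀ x, ellip c H x = 0) ∧
        (∀ x : sphere (0 : Eucl n) s, |H x - F x| ≤ ε) ∧ |H 0 - T F| ≤ ε := by
  let V : Submodule ℝ (MvPolynomial (Fin n) ℝ) := LinearMap.ker (polyEllip c.2)
  let e : V →ₗ[ℝ] C(sphere (0 : Eucl n) s, ℝ) := (polySphere c.1 s).toLinearMap ∘ₗ V.subtype
  let f : V →ₗ[ℝ] ℝ := (MvPolynomial.aeval (R := ℝ)
    (fun i => ⟪c.1 i, (0 : Eucl n)⟫)).toLinearMap ∘ₗ V.subtype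
  have hf : ∀ H : V, f H = polyFun c.1 H 0 := fun H => by
    simp [f, polyFun, MvPolynomial.aeval_eq_eval]
  have he : ∀ (H : V) x, e H x = polyFun c.1 H x := fun H x => polySphere_apply _ _ _ _
  have hL : ∀ (H : V) x, ellip c (polyFun c.1 H) x = 0 := fun H x => by
    rw [ellip_polyFun, LinearMap.mem_ker.1 H.2]; simp [polyFun]
  have hnorm : ∀ H, ‖f H‖ ≤ 1 * ‖e H‖ := by
    intro H
    rw [hf, one_mul, Real.norm_eq_abs, abs_le']
    have h0 : (0 : Eucl n) ∈ closedBall (0 : Eucl n) s := mem_closedBall_self hs.le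
    have hb : ∀ x (hx : x ∈ sphere (0 : Eucl n) s), |polyFun c.1 H x| ≤ ‖e H‖ := fun x hx => by
      rw [← he H ⟨x, hx⟩]; exact (e H).norm_coe_le_norm ⟨x, hx⟩
    constructor
    · exact contDiff_zero_of_sphere hc hc' hs (contDiff_polyFun c.1 _) (fun x _ => hL H x)
        (fun x hx => (le_abs_self _).trans (hb x hx)) 0 h0
    · exact contDiff_zero_of_sphere hc hc' hs (contDiff_polyFun c.1 _).neg
        (F := fun x => - polyFun c.1 H x) (fun x _ => by rw [ellip_neg, hL, neg_zero])
        (fun x hx => (neg_le_abs _).trans (hb x hx)) 0 h0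
  have hpd : Dense (range (polySphere c.1 s)) := by
    have hsep : (polySphere c.1 s).range.SeparatesPoints := by
      intro x y hxy
      have : ∃ i, ⟪c.1 i, (x : Eucl n)⟫ ≠ ⟪c.1 i, (y : Eucl n)⟫ := by
        by_contra! h
        apply hxy
        apply Subtype.ext
        rw [← c.1.sum_repr' x, ← c.1.sum_repr' y]
        simp [h]
      obtain ⟨i, hi⟩ := this
      refine ⟨_, ⟨polySphere c.1 s (MvPolynomial.X i), ⟨MvPolynomial.X i, rfl⟩, rfl⟩, ?_⟩
      simpa [polySphere_apply, polyFun_X] using hi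
    have := ContinuousMap.subalgebra_topologicalClosure_eq_top_of_separatesPoints _ hsep
    intro F
    have h2 : F ∈ (polySphere c.1 s).range.topologicalClosure := by rw [this]; trivial
    rw [← SetLike.mem_coe, Subalgebra.topologicalClosure_coe] at h2
    simpa using h2
  have hrange : range (polySphere c.1 s) ⊆ range e := by
    rintro _ ⟨P, rfl⟩
    obtain ⟨H, hH, hH'⟩ := exists_harmonic_eq_on_sphere hc hc' hs P
    refine ⟨⟨H, LinearMap.mem_ker.2 hH⟩, ?_⟩
    ext x
    rw [he, polySphere_apply]
    exact hH' x x.2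
  have hdense : DenseRange e := hpd.mono hrange
  refine ⟨f.extendOfNorm e, fun F ε hε => ?_⟩
  obtain ⟨_, hH, ⟨H, rfl⟩⟩ := Metric.dense_iff.1 hdense F ε hε
  rw [mem_ball, dist_eq_norm] at hH
  refine ⟨polyFun c.1 H, contDiff_polyFun c.1 _, hL H, fun x => ?_, ?_⟩
  · rw [← he]
    exact ((e H - F).norm_coe_le_norm x).trans hH.le
  · rw [← hf, ← LinearMap.extendOfNorm_eq hdense ⟨1, hnorm⟩ H, ← map_sub]
    have := LinearMap.norm_extendOfNorm_apply_le hdense 1 hnorm (e H - F)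
    rw [one_mul] at this
    exact this.trans hH.le

/-- A continuous linear functional on the sphere which lies below the value at the centre, minus
the explicit correction, of every supersolution, and symmetrically for smooth functions. -/
lemma exists_sphere_functional_le {c : Coeff n} (hc : ∀ i, 0 ≤ c.2 i) (hc' : 0 < ∑ i, c.2 i)
    {s : ℝ} (hs : 0 < s) :
    ∃ T : C(sphere (0 : Eucl n) s, ℝ) →L[ℝ] ℝ,
      ∀ (F : C(Eucl n, ℝ)) (κ : ℝ), IsSuper {c} (ball 0 s) F (fun _ => κ) →
        T (F.restrict _) + κ * (s ^ 2 / (2 * ∑ i, c.2 i)) ≤ F 0 := by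
  obtain ⟨T, hT⟩ := exists_sphere_functional hc hc' hs
  refine ⟨T, fun F κ hF => ?_⟩
  set τ := 1 / (2 * ∑ i, c.2 i) with hτ
  have hτ0 : 0 < τ := by positivity
  have hτ1 : 2 * (∑ i, c.2 i) * τ = 1 := by rw [hτ]; field_simp
  have key : ∀ ε > 0, T (F.restrict _) + κ * (s ^ 2 * τ) ≤ F 0 + (2 + s ^ 2) * ε := by
    intro ε hε
    obtain ⟨H, hH, hHL, hHs, hH0⟩ := hT (F.restrict _) ε hε
    have hquad : ContDiff ℝ 2 fun x : Eucl n => ((ε - κ * τ) * ‖x - 0‖ ^ 2) :=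
      contDiff_const.mul (contDiff_norm_sub_sq 0)
    have hψ : ContDiff ℝ 2 fun x : Eucl n =>
        H x + ((ε - κ * τ) * ‖x - 0‖ ^ 2) + (- ε - (ε - κ * τ) * s ^ 2) :=
      (hH.add hquad).add contDiff_const
    have := hF.le_of_le_sphere hs F.continuous.continuousOn hψ (fun x hx => by
      have h1 := ellip_add c (hH.add hquad).contDiffAt (x := x)
        (ψ := fun _ => - ε - (ε - κ * τ) * s ^ 2) contDiffAt_const
      have h2 := ellip_add c (hH.contDiffAt (x := x)) hquad.contDiffAt
      have h3 : ellip c (fun x : Eucl n =>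
        H x + ((ε - κ * τ) * ‖x - 0‖ ^ 2) + (- ε - (ε - κ * τ) * s ^ 2)) x =
        2 * ε * ∑ i, c.2 i - κ := by
        refine h1.trans ?_
        rw [ellip_const]
        erw [h2]
        rw [hHL, ellip_const_mul, ellip_norm_sub_sq]
        linear_combination -κ * hτ1
      rw [h3]
      have : 0 < 2 * ε * ∑ i, c.2 i := by positivity
      linarith) (fun x hx => by
      have h4 := (abs_le.1 (hHs ⟨x, hx⟩)).2
      rw [mem_sphere_zero_iff_norm] at hx
      simp only [ContinuousMap.restrict_apply] at h4
      rw [sub_zero, hx]; linarith) 0 (mem_closedBall_self hs.le)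
    have h5 := (abs_le.1 hH0).1
    simp at this
    nlinarith
  have hlim : T (F.restrict _) + κ * (s ^ 2 * τ) ≤ F 0 := by
    refine le_of_forall_pos_le_add fun ε hε => ?_
    have := key (ε / (2 + s ^ 2)) (by positivity)
    rwa [mul_div_cancel₀ _ (by positivity)] at this
  calc _ = T (F.restrict _) + κ * (s ^ 2 * τ) := by rw [hτ]; ring
    _ ≤ _ := hlim

end Dirichlet

section Affine

variable {n : ℕ}

/-- Transport of a constant-coefficient operator by a linear isometry. -/
noncomputable def Coeff.map (R : Eucl n ≃ₗᵢ[ℝ] Eucl n) (c : Coeff n) : Coeff n := (c.1.map R, c.2)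

lemma Coeff.map_mem_admissible {lam Lam : ℝ} (R : Eucl n ≃ₗᵢ[ℝ] Eucl n) {c : Coeff n}
    (hc : c ∈ admissible n lam Lam) : c.map R ∈ admissible n lam Lam := hc

lemma Coeff.map_refl (c : Coeff n) : c.map (LinearIsometryEquiv.refl ℝ (Eucl n)) = c := by
  refine Prod.ext ?_ rfl
  apply DFunLike.ext
  intro i
  simp [Coeff.map]

lemma Coeff.map_symm_map (R : Eucl n ≃ₗᵢ[ℝ] Eucl n) (c : Coeff n) : (c.map R.symm).map R = c := by
  refine Prod.ext ?_ rfl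
  apply DFunLike.ext
  intro i
  simp [Coeff.map]

lemma ellip_comp_affine (c : Coeff n) (φ : Eucl n → ℝ) (k s : ℝ) (y : Eucl n)
    (R : Eucl n ≃ₗᵢ[ℝ] Eucl n) (z : Eucl n) :
    ellip c (fun z => k * φ (y + s • R z)) z = k * s ^ 2 * ellip (c.map R) φ (y + s • R z) := by
  rw [ellip_const_mul]
  have := fun v => lineDeriv₂_comp_affine φ y s (R.toLinearEquiv : Eucl n →ₗ[ℝ] Eucl n) z v
  simp only [LinearEquiv.coe_coe, LinearIsometryEquiv.coe_toLinearEquiv] at this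
  simp only [ellip, this, Finset.mul_sum, Coeff.map, OrthonormalBasis.map_apply]
  exact Finset.sum_congr rfl fun i _ => by ring

lemma affine_symm_apply {k s : ℝ} (hs : 0 < s) (hk : 0 < k) (φ : Eucl n → ℝ) (y : Eucl n)
    (R : Eucl n ≃ₗᵢ[ℝ] Eucl n) :
    (fun z => k * (k⁻¹ * φ (s⁻¹ • R.symm ((y + s • R z) - y)))) = φ := by
  ext z
  rw [add_sub_cancel_left, map_smul, R.symm_apply_apply, smul_smul, inv_mul_cancel₀ hs.ne',
    one_smul, mul_inv_cancel_left₀ hk.ne']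

lemma IsSub.comp_affine {𝒜 𝒜' : Set (Coeff n)} {Ω Ω' : Set (Eucl n)} {v f : Eucl n → ℝ}
    (h : IsSub 𝒜 Ω v f) {k s : ℝ} (hk : 0 < k) (hs : 0 < s) (y : Eucl n)
    (R : Eucl n ≃ₗᵢ[ℝ] Eucl n) (hR : ∀ c ∈ 𝒜, c.map R.symm ∈ 𝒜')
    (hΩ : ∀ z ∈ Ω', y + s • R z ∈ Ω) :
    IsSub 𝒜' Ω' (fun z => k * v (y + s • R z)) (fun z => k * s ^ 2 * f (y + s • R z)) := by
  intro z₀ hz₀ φ hφ hm ε hε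
  set φ' : Eucl n → ℝ := fun x => k⁻¹ * φ (s⁻¹ • R.symm (x - y)) with hφ'
  have hback : s⁻¹ • R.symm ((y + s • R z₀) - y) = z₀ := by
    rw [add_sub_cancel_left, map_smul, R.symm_apply_apply, smul_smul, inv_mul_cancel₀ hs.ne',
      one_smul]
  have hsm : ContDiffAt ℝ 2 (fun x => s⁻¹ • R.symm (x - y)) (y + s • R z₀) := by
    have : ContDiff ℝ 2 (fun x => s⁻¹ • R.symm (x - y)) :=
      (R.symm.contDiff.comp (contDiff_id.sub contDiff_const)).const_smul _
    exact this.contDiffAt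
  have hφ2 : ContDiffAt ℝ 2 φ' (y + s • R z₀) := by
    have : ContDiffAt ℝ 2 (φ ∘ fun x => s⁻¹ • R.symm (x - y)) (y + s • R z₀) :=
      ContDiffAt.comp _ (by rw [hback]; exact hφ) hsm
    exact contDiffAt_const.mul this
  have hm2 : IsLocalMax (fun x => v x - φ' x) (y + s • R z₀) := by
    have h1 : IsLocalMax (fun z => k * v (y + s • R z) - φ z)
      ((fun x => s⁻¹ • R.symm (x - y)) (y + s • R z₀)) := by simpa only [hback] using hm
    have h2 := IsLocalMax.comp_continuous (g := fun x => s⁻¹ • R.symm (x - y))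
      (b := y + s • R z₀) h1 hsm.continuousAt
    refine h2.mono fun x hx => ?_
    have hx' : ∀ x, y + s • R (s⁻¹ • R.symm (x - y)) = x := fun x => by
      rw [map_smul, R.apply_symm_apply, smul_smul, mul_inv_cancel₀ hs.ne', one_smul]; abel
    simp only [Function.comp_apply, hx', hφ'] at hx ⊢
    have h3 := mul_le_mul_of_nonneg_left hx (inv_pos.2 hk).le
    rw [mul_sub, mul_sub, inv_mul_cancel_left₀ hk.ne', inv_mul_cancel_left₀ hk.ne'] at h3
    exact h3
  obtain ⟨c, hc, hc'⟩ := h _ (hΩ z₀ hz₀) φ' hφ2 hm2 (ε / (k * s ^ 2)) (by positivity)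
  refine ⟨_, hR c hc, ?_⟩
  have h4 := ellip_comp_affine (c.map R.symm) φ' k s y R z₀
  rw [Coeff.map_symm_map, hφ', affine_symm_apply hs hk] at h4
  rw [h4, ← mul_add]
  have := mul_le_mul_of_nonneg_left hc' (show 0 ≤ k * s ^ 2 by positivity)
  rwa [mul_neg, mul_div_cancel₀ _ (by positivity)] at this

lemma IsSuper.comp_affine {𝒜 𝒜' : Set (Coeff n)} {Ω Ω' : Set (Eucl n)} {v f : Eucl n → ℝ}
    (h : IsSuper 𝒜 Ω v f) {k s : ℝ} (hk : 0 < k) (hs : 0 < s) (y : Eucl n)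
    (R : Eucl n ≃ₗᵢ[ℝ] Eucl n) (hR : ∀ c ∈ 𝒜', c.map R ∈ 𝒜)
    (hΩ : ∀ z ∈ Ω', y + s • R z ∈ Ω) :
    IsSuper 𝒜' Ω' (fun z => k * v (y + s • R z)) (fun z => k * s ^ 2 * f (y + s • R z)) := by
  rw [isSuper_iff_forall_isSub] at h ⊢
  intro c hc
  have := (h _ (hR c hc)).comp_affine (𝒜' := {c}) hk hs y R (by
    rintro _ rfl
    have := Coeff.map_symm_map R.symm c
    rw [LinearIsometryEquiv.symm_symm] at this
    exact this) hΩ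
  simpa only [mul_neg] using this

lemma IsSuper.comp_add {𝒜 : Set (Coeff n)} {Ω Ω' : Set (Eucl n)} {v f : Eucl n → ℝ}
    (h : IsSuper 𝒜 Ω v f) (y : Eucl n) (hΩ : ∀ z ∈ Ω', y + z ∈ Ω) :
    IsSuper 𝒜 Ω' (fun z => v (y + z)) (fun z => f (y + z)) := by
  simpa using h.comp_affine one_pos one_pos y (LinearIsometryEquiv.refl ℝ _) (𝒜' := 𝒜)
    (fun c hc => by rwa [Coeff.map_refl]) (by simpa using hΩ)

end Affine

section Mollification

variable {n : ℕ}

lemma continuous_ellip (c : Coeff n) {φ : Eucl n → ℝ} (h : ContDiff ℝ 2 φ) :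
    Continuous (ellip c φ) := by
  have h1 : ellip c φ = fun x => ∑ i, c.2 i * fderiv ℝ (fderiv ℝ φ) x (c.1 i) (c.1 i) := by
    ext x
    simp only [ellip, lineDeriv₂_eq_fderiv h.contDiffAt]
  rw [h1]
  have := continuous_fderiv_fderiv h
  fun_prop

lemma IsSuper.mollify {c : Coeff n} (hc : ∀ i, 0 ≤ c.2 i) (hc' : 0 < ∑ i, c.2 i)
    {δ s κ : ℝ} (hs : 0 < s) {η : Eucl n → ℝ} (hη : Continuous η) (hηc : HasCompactSupport η)
    (hη0 : ∀ z, 0 ≤ η z) (hη1 : ∫ z, η z = 1) (hηδ : ∀ z, δ ≤ ‖z‖ → η z = 0)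
    {w w' : Eucl n → ℝ} (hw : Continuous w) (hw' : ContDiff ℝ 2 w')
    (hww' : ∀ x, w' x = ∫ z, η z * w (x - z)) {x : Eucl n}
    (hS : IsSuper {c} (ball x (δ + s)) w (fun _ => κ)) : ellip c w' x + κ ≤ 0 := by
  by_contra! hpos
  obtain ⟨r, hr, hball⟩ : ∃ r > 0, ∀ y ∈ ball x r, (ellip c w' x + κ) / 2 < ellip c w' y + κ := by
    have : ∀ᶠ y in 𝓝 x, (ellip c w' x + κ) / 2 < ellip c w' y + κ :=
      ((continuous_ellip c hw').add_const κ).continuousAt.eventually_const_lt (by linarith)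
    exact Metric.eventually_nhds_iff_ball.1 this
  set m := (ellip c w' x + κ) / 2 with hm
  set σ := min r s with hσ
  have hσ0 : 0 < σ := lt_min hr hs
  obtain ⟨T, hT⟩ := exists_sphere_functional_le hc hc' hσ0
  set τ := σ ^ 2 / (2 * ∑ i, c.2 i) with hτ
  have hτ0 : 0 < τ := by positivity
  let W : Eucl n → C(Eucl n, ℝ) := fun z => ⟨fun y => w (x - z + y), by fun_prop⟩
  let V : Eucl n → C(sphere (0 : Eucl n) σ, ℝ) := fun z => (W z).restrict _
  have hV : Continuous V := by
    refine ContinuousMap.continuous_of_continuous_uncurry _ ?_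
    change Continuous fun p : Eucl n × sphere (0 : Eucl n) σ => w (x - p.1 + p.2)
    fun_prop
  let G : C(Eucl n, ℝ) := ⟨fun y => - w' (x + y), by have := hw'.continuous; fun_prop⟩
  have hint : MeasureTheory.Integrable fun z => η z • V z :=
    (hη.smul hV).integrable_of_hasCompactSupport hηc.smul_right
  have hG : G.restrict _ = - ∫ z, η z • V z := by
    ext y
    rw [ContinuousMap.neg_apply, ContinuousMap.integral_apply hint]
    simp only [ContinuousMap.restrict_apply, G, ContinuousMap.coe_mk, hww',
      ContinuousMap.smul_apply, V, W, smul_eq_mul]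
    congr 1
    refine MeasureTheory.integral_congr_ae (Eventually.of_forall fun z => ?_)
    simp only
    congr 2
    abel
  have h1 : T (G.restrict _) + (m - κ) * τ ≤ G 0 := by
    refine hT G (m - κ) (isSuper_of_contDiff hc ?_ fun y hy => ?_)
    · exact (hw'.comp (contDiff_const.add contDiff_id)).neg
    · have h2 := ellip_comp_affine c w' (-1) 1 x (LinearIsometryEquiv.refl ℝ _) y
      simp only [Coeff.map_refl, LinearIsometryEquiv.coe_refl, id, one_smul, one_pow, mul_one,
        neg_one_mul] at h2
      change ellip c (fun y => - w' (x + y)) y + _ ≤ 0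
      rw [h2]
      have := hball (x + y) (by
        rw [mem_ball, dist_eq_norm, add_sub_cancel_left]
        exact (mem_ball_zero_iff.1 hy).trans_le (min_le_left _ _))
      linarith
  have h2 : ∀ z, η z * (T (V z) + κ * τ) ≤ η z * w (x - z) := by
    intro z
    rcases le_or_gt δ ‖z‖ with hz | hz
    · simp [hηδ z hz]
    · refine mul_le_mul_of_nonneg_left ?_ (hη0 z)
      have := hT (W z) κ (hS.comp_add (x - z) fun y hy => by
        rw [mem_ball, dist_eq_norm, show x - z + y - x = y - z by abel]
        have hy' := (mem_ball_zero_iff.1 hy).trans_le (min_le_right r s)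
        linarith [norm_sub_le y z])
      simpa [W] using this
  have hTV : Continuous fun z => T (V z) := T.continuous.comp hV
  have h3 := MeasureTheory.integral_mono (μ := MeasureTheory.volume)
    ((hη.mul (hTV.add_const (κ * τ))).integrable_of_hasCompactSupport hηc.mul_right)
    ((hη.mul (hw.comp (continuous_const.sub continuous_id))).integrable_of_hasCompactSupport
      hηc.mul_right) h2
  have h4 : ∫ z, η z * (T (V z) + κ * τ) = T (∫ z, η z • V z) + κ * τ := by
    rw [← ContinuousLinearMap.integral_comp_comm T hint]
    simp only [mul_add, map_smul, smul_eq_mul]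
    rw [MeasureTheory.integral_add, MeasureTheory.integral_mul_const, hη1, one_mul]
    · exact (hη.mul hTV).integrable_of_hasCompactSupport hηc.mul_right
    · exact (hη.integrable_of_hasCompactSupport hηc).mul_const _
  have h5 : G 0 = - ∫ z, η z * w (x - z) := by
    simp [G, hww']
  change ∫ z, η z * (T (V z) + κ * τ) ≤ ∫ z, η z * w (x - z) at h3
  rw [h4] at h3
  rw [hG, map_neg, h5] at h1
  have : 0 < m * τ := mul_pos (by rw [hm]; linarith) hτ0
  linarith

/-- Smooth approximation of a supersolution by supersolutions. -/
lemma IsSuper.exists_contDiff {lam Lam : ℝ} (hlam : 0 < lam) (hn : 0 < n) {x₀ : Eucl n} {r κ : ℝ}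
    (hr : 0 < r) {w : Eucl n → ℝ} (hw : Continuous w)
    (hS : IsSuper (admissible n lam Lam) (ball x₀ r) w (fun _ => κ)) {ε : ℝ} (hε : 0 < ε) :
    ∃ w' : Eucl n → ℝ, ContDiff ℝ 2 w' ∧ (∀ x ∈ closedBall x₀ (r / 2), |w' x - w x| ≤ ε) ∧
      ∀ x ∈ ball x₀ (r / 2), ∀ c ∈ admissible n lam Lam, ellip c w' x + κ ≤ 0 := by
  obtain ⟨δ, hδ, hδ'⟩ := Metric.uniformContinuousOn_iff.1
    ((isCompact_closedBall x₀ r).uniformContinuousOn_of_continuous hw.continuousOn) ε hε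
  have hm : 0 < min (δ / 2) (r / 4) := by positivity
  let φ : ContDiffBump (0 : Eucl n) := ⟨min (δ / 2) (r / 4) / 2, min (δ / 2) (r / 4),
    by positivity, by linarith⟩
  let w' : Eucl n → ℝ := MeasureTheory.convolution (φ.normed MeasureTheory.volume) w
    (ContinuousLinearMap.lsmul ℝ ℝ) MeasureTheory.volume
  have hw' : ContDiff ℝ 2 w' :=
    φ.hasCompactSupport_normed.contDiff_convolution_left _ φ.contDiff_normed
      hw.locallyIntegrable
  refine ⟨w', hw', fun x hx => ?_, fun x hx c hc => ?_⟩
  · rw [← Real.dist_eq]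
    refine φ.dist_normed_convolution_le hw.aestronglyMeasurable fun y hy => ?_
    have hy' : dist y x < min (δ / 2) (r / 4) := hy
    have hy1 := hy'.trans_le (min_le_left _ _)
    have hy2 := hy'.trans_le (min_le_right _ _)
    rw [mem_closedBall] at hx
    have := dist_triangle y x x₀
    exact (hδ' y (by rw [mem_closedBall]; linarith) x (by rw [mem_closedBall]; linarith)
      (by linarith)).le
  · have hc0 : ∀ i, 0 < c.2 i := fun i => hlam.trans_le (hc i).1
    have : Nonempty (Fin n) := ⟨⟨0, hn⟩⟩
    refine IsSuper.mollify (δ := r / 4) (s := r / 4) (fun i => (hc0 i).le)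
      (Finset.sum_pos (fun i _ => hc0 i) Finset.univ_nonempty) (by positivity)
      (φ.continuous_normed (μ := MeasureTheory.volume)) φ.hasCompactSupport_normed
      φ.nonneg_normed φ.integral_normed ?_ hw hw' (fun x => rfl) ?_
    · intro z hz
      have : z ∉ Function.support (φ.normed MeasureTheory.volume) := by
        rw [φ.support_normed_eq, mem_ball_zero_iff, not_lt]
        exact (min_le_right _ _).trans hz
      simpa using this
    · intro y hy ψ hψ hmin c' hc'
      obtain rfl : c' = c := hc'
      refine hS y ?_ ψ hψ hmin _ hc
      rw [mem_ball] at hx hy ⊢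
      linarith [dist_triangle y x x₀]

end Mollification

section Stability

variable {n : ℕ} {lam Lam : ℝ}

lemma IsSub.congr {𝒜 : Set (Coeff n)} {Ω : Set (Eucl n)} {v v' f f' : Eucl n → ℝ}
    (h : IsSub 𝒜 Ω v f) (hΩ : IsOpen Ω) (hv : ∀ x ∈ Ω, v x = v' x) (hf : ∀ x ∈ Ω, f x ≤ f' x) :
    IsSub 𝒜 Ω v' f' := by
  intro x hx φ hφ hm ε hε
  obtain ⟨c, hc, hc'⟩ := h x hx φ hφ (hm.congr (by
    filter_upwards [hΩ.mem_nhds hx] with y hy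
    rw [hv y hy])) ε hε
  exact ⟨c, hc, hc'.trans (by linarith [hf x hx])⟩

lemma IsSuper.congr {𝒜 : Set (Coeff n)} {Ω : Set (Eucl n)} {v v' f f' : Eucl n → ℝ}
    (h : IsSuper 𝒜 Ω v f) (hΩ : IsOpen Ω) (hv : ∀ x ∈ Ω, v x = v' x)
    (hf : ∀ x ∈ Ω, f' x ≤ f x) : IsSuper 𝒜 Ω v' f' := by
  intro x hx φ hφ hm c hc
  have := h x hx φ hφ (hm.congr (by
    filter_upwards [hΩ.mem_nhds hx] with y hy
    rw [hv y hy])) c hc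
  linarith [hf x hx]

lemma sum_le_of_admissible {c : Coeff n} (hc : c ∈ admissible n lam Lam) :
    ∑ i, c.2 i ≤ n * Lam := by
  calc ∑ i, c.2 i ≤ ∑ _i : Fin n, Lam := Finset.sum_le_sum fun i _ => (hc i).2
    _ = n * Lam := by simp

lemma ellip_sub_le (hlam : 0 ≤ lam) {c : Coeff n} (hc : c ∈ admissible n lam Lam)
    {φ : Eucl n → ℝ} (h : ContDiff ℝ 2 φ) (x y : Eucl n) :
    ellip c φ x - ellip c φ y ≤
      n * Lam * ‖fderiv ℝ (fderiv ℝ φ) x - fderiv ℝ (fderiv ℝ φ) y‖ := by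
  have hi : ∀ i, fderiv ℝ (fderiv ℝ φ) x (c.1 i) (c.1 i) -
      fderiv ℝ (fderiv ℝ φ) y (c.1 i) (c.1 i) ≤
      ‖fderiv ℝ (fderiv ℝ φ) x - fderiv ℝ (fderiv ℝ φ) y‖ := by
    intro i
    have := (fderiv ℝ (fderiv ℝ φ) x - fderiv ℝ (fderiv ℝ φ) y).le_opNorm₂ (c.1 i) (c.1 i)
    rw [c.1.norm_eq_one, mul_one, mul_one] at this
    exact (le_abs_self _).trans this
  simp only [ellip, lineDeriv₂_eq_fderiv h.contDiffAt, ← Finset.sum_sub_distrib, ← mul_sub]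
  calc _ ≤ ∑ i, c.2 i * ‖fderiv ℝ (fderiv ℝ φ) x - fderiv ℝ (fderiv ℝ φ) y‖ :=
        Finset.sum_le_sum fun i _ => mul_le_mul_of_nonneg_left (hi i) (hlam.trans (hc i).1)
    _ ≤ _ := by
      rw [← Finset.sum_mul]
      exact mul_le_mul_of_nonneg_right (sum_le_of_admissible hc) (by positivity)

/-- Local uniform limits of subsolutions are subsolutions. -/
lemma isSub_of_approx (hlam : 0 ≤ lam) (hLam : 0 < Lam) {𝒜 : Set (Coeff n)}
    (h𝒜 : 𝒜 ⊆ admissible n lam Lam)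
    {Ω : Set (Eucl n)} {v f : Eucl n → ℝ}
    (h : ∀ x₀ ∈ Ω, ∀ ε > 0, ∃ r > 0, ∀ ε' > 0, ∃ v' f' : Eucl n → ℝ,
      ContinuousOn v' (closedBall x₀ r) ∧ IsSub 𝒜 (ball x₀ r) v' f' ∧
      (∀ x ∈ closedBall x₀ r, |v' x - v x| ≤ ε') ∧ ∀ x ∈ ball x₀ r, f' x ≤ f x₀ + ε) :
    IsSub 𝒜 Ω v f := by
  intro x₀ hx₀ φ hφ hm ε hε
  obtain ⟨ψ, hψ, he⟩ := hφ.exists_contDiff_eventuallyEq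
  obtain ⟨r, hr, happ⟩ := h x₀ hx₀ (ε / 4) (by positivity)
  set N : ℝ := n * Lam + 1 with hN
  have hN0 : 0 < N := by positivity
  have hev : ∀ᶠ x in 𝓝 x₀, v x - ψ x ≤ v x₀ - ψ x₀ ∧
      ‖fderiv ℝ (fderiv ℝ ψ) x - fderiv ℝ (fderiv ℝ ψ) x₀‖ < ε / (4 * N) := by
    have h1 : ∀ᶠ x in 𝓝 x₀, v x - ψ x ≤ v x₀ - ψ x₀ := by
      filter_upwards [hm, he] with x hx hx'
      rw [hx', he.self_of_nhds]; exact hx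
    have h2 : ∀ᶠ x in 𝓝 x₀,
        ‖fderiv ℝ (fderiv ℝ ψ) x - fderiv ℝ (fderiv ℝ ψ) x₀‖ < ε / (4 * N) := by
      have hc : ContinuousAt (fderiv ℝ (fderiv ℝ ψ)) x₀ := (continuous_fderiv_fderiv hψ).continuousAt
      have := (Metric.continuousAt_iff' (α := Eucl n →L[ℝ] Eucl n →L[ℝ] ℝ)
        (f := fderiv ℝ (fderiv ℝ ψ))).1 hc (ε / (4 * N)) (by positivity)
      filter_upwards [this] with x hx
      exact lt_of_eq_of_lt (dist_eq_norm (E := Eucl n →L[ℝ] Eucl n →L[ℝ] ℝ) _ _).symm hx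
    filter_upwards [h1, h2] with x hx hx'
    exact ⟨hx, hx'⟩
  obtain ⟨ρ', hρ', hball⟩ := Metric.eventually_nhds_iff_ball.1 hev
  set ρ := min (ρ' / 2) r with hρ
  have hρ0 : 0 < ρ := by positivity
  have hρr : ρ ≤ r := min_le_right _ _
  have hρρ' : ρ < ρ' := (min_le_left _ _).trans_lt (by linarith)
  set κ := ε / (8 * N) with hκ
  have hκ0 : 0 < κ := by positivity
  obtain ⟨v', f', hv', hS, hvv', hff'⟩ := happ (κ * ρ ^ 2 / 4) (by positivity)
  set Φ : Eucl n → ℝ := fun x => ψ x + κ * ‖x - x₀‖ ^ 2 with hΦ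
  have hquad : ContDiff ℝ 2 fun x : Eucl n => κ * ‖x - x₀‖ ^ 2 :=
    contDiff_const.mul (contDiff_norm_sub_sq x₀)
  have hΦ2 : ContDiff ℝ 2 Φ := hψ.add hquad
  obtain ⟨q, hq, hmax⟩ := (isCompact_closedBall x₀ ρ).exists_isMaxOn
    ⟨x₀, mem_closedBall_self hρ0.le⟩
    ((hv'.mono (closedBall_subset_closedBall hρr)).sub hΦ2.continuous.continuousOn)
  have hqr : q ∈ closedBall x₀ r := closedBall_subset_closedBall hρr hq
  have hqρ' : q ∈ ball x₀ ρ' := (mem_closedBall.1 hq).trans_lt hρρ'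
  have hq' : q ∈ ball x₀ ρ := by
    by_contra hcon
    have hdist : ‖q - x₀‖ = ρ := by
      rw [← dist_eq_norm]
      exact le_antisymm hq (by simpa using hcon)
    have h1 := isMaxOn_iff.1 hmax x₀ (mem_closedBall_self hρ0.le)
    simp only [Pi.sub_apply, hΦ, hdist, sub_self, norm_zero] at h1
    have h2 := (abs_le.1 (hvv' q hqr)).2
    have h3 := (abs_le.1 (hvv' x₀ (mem_closedBall_self hr.le))).1
    have h4 := (hball q hqρ').1
    have : 0 < κ * ρ ^ 2 := by positivity
    linarith
  obtain ⟨c, hc, hc'⟩ := hS q (ball_subset_ball hρr hq') Φ hΦ2.contDiffAt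
    (hmax.isLocalMax (mem_of_superset (isOpen_ball.mem_nhds hq') ball_subset_closedBall))
    (ε / 4) (by positivity)
  refine ⟨c, hc, ?_⟩
  have hadd : ellip c Φ q = ellip c ψ q + κ * (2 * ∑ i, c.2 i) := by
    rw [hΦ, ellip_add c hψ.contDiffAt hquad.contDiffAt, ellip_const_mul, ellip_norm_sub_sq]
  have h1 := ellip_sub_le hlam (h𝒜 hc) hψ q x₀
  have h2 : (n : ℝ) * Lam * ‖fderiv ℝ (fderiv ℝ ψ) q - fderiv ℝ (fderiv ℝ ψ) x₀‖ ≤ ε / 4 := by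
    calc _ ≤ N * (ε / (4 * N)) := mul_le_mul (by linarith) (hball q hqρ').2.le
          (by positivity) hN0.le
      _ = ε / 4 := by field_simp
  have h3 : κ * (2 * ∑ i, c.2 i) ≤ ε / 4 := by
    have := sum_le_of_admissible (h𝒜 hc)
    calc _ ≤ κ * (2 * N) := by gcongr; linarith
      _ = ε / 4 := by rw [hκ]; field_simp; norm_num
  have h4 := hff' q (ball_subset_ball hρr hq')
  rw [← ellip_congr c he]
  rw [hadd] at hc'
  linarith

/-- The difference of a subsolution and a supersolution is a subsolution. -/
lemma IsSub.sub_isSuper (hlam : 0 < lam) (hLam : lam ≤ Lam) (hn : 0 < n) {Ω : Set (Eucl n)}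
    (hΩ : IsOpen Ω) {u w f g : Eucl n → ℝ} (hu : ContinuousOn u Ω) (hw : ContinuousOn w Ω)
    (hf : ContinuousOn f Ω) (hg : ContinuousOn g Ω)
    (hus : IsSub (admissible n lam Lam) Ω u f) (hws : IsSuper (admissible n lam Lam) Ω w g) :
    IsSub (admissible n lam Lam) Ω (fun x => u x - w x) (fun x => f x - g x) := by
  refine isSub_of_approx hlam.le (hlam.trans_le hLam) subset_rfl fun x₀ hx₀ ε hε => ?_
  have hev : ∀ᶠ x in 𝓝 x₀, x ∈ Ω ∧ f x < f x₀ + ε / 2 ∧ g x₀ - ε / 2 < g x := by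
    have hnh := hΩ.mem_nhds hx₀
    filter_upwards [hnh, (hf.continuousAt hnh).eventually_lt_const
      (show f x₀ < f x₀ + ε / 2 by linarith), (hg.continuousAt hnh).eventually_const_lt
      (show g x₀ - ε / 2 < g x₀ by linarith)] with x h1 h2 h3 using ⟨h1, h2, h3⟩
  obtain ⟨R, hR, hball⟩ := Metric.eventually_nhds_iff_ball.1 hev
  set r := R / 2 with hr
  have hr0 : 0 < r := by positivity
  have hsub : closedBall x₀ r ⊆ ball x₀ R := closedBall_subset_ball (by linarith)
  have hrΩ : closedBall x₀ r ⊆ Ω := fun x hx => (hball x (hsub hx)).1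
  obtain ⟨W, hW⟩ := ContinuousMap.exists_restrict_eq isClosed_closedBall
    (⟨(closedBall x₀ r).domRestrict w, (hw.mono hrΩ).domRestrict⟩ : C(closedBall x₀ r, ℝ))
  have hWw : ∀ x ∈ closedBall x₀ r, W x = w x := fun x hx => DFunLike.congr_fun hW ⟨x, hx⟩
  have hWS : IsSuper (admissible n lam Lam) (ball x₀ r) W (fun _ => g x₀ - ε / 2) :=
    (hws.mono (ball_subset_closedBall.trans hrΩ)).congr isOpen_ball
      (fun x hx => (hWw x (ball_subset_closedBall hx)).symm)
      (fun x hx => (hball x (hsub (ball_subset_closedBall hx))).2.2.le)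
  refine ⟨r / 2, by positivity, fun ε' hε' => ?_⟩
  obtain ⟨w', hw', hww', hL⟩ := hWS.exists_contDiff hlam hn hr0 W.continuous hε'
  have hsub2 : closedBall x₀ (r / 2) ⊆ closedBall x₀ r := closedBall_subset_closedBall (by linarith)
  refine ⟨fun x => u x - w' x, fun x => f x - (g x₀ - ε / 2),
    (hu.mono (hsub2.trans hrΩ)).sub hw'.continuous.continuousOn, ?_, fun x hx => ?_,
    fun x hx => ?_⟩
  · intro x hx φ hφ hm ε₁ hε₁
    have hxr : x ∈ closedBall x₀ r := hsub2 (ball_subset_closedBall hx)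
    obtain ⟨c, hc, hc'⟩ := hus x (hrΩ hxr) (fun z => φ z + w' z) (hφ.add hw'.contDiffAt)
      (hm.congr (Eventually.of_forall fun y => by ring)) ε₁ hε₁
    refine ⟨c, hc, ?_⟩
    rw [ellip_add c hφ hw'.contDiffAt] at hc'
    linarith [hL x hx c hc]
  · have := hww' x hx
    rw [hWw x (hsub2 hx), abs_sub_comm] at this
    rwa [show u x - w' x - (u x - w x) = w x - w' x by ring]
  · have := (hball x (hsub (hsub2 (ball_subset_closedBall hx)))).2.1
    linarith

end Stability

section Comparison

variable {n : ℕ} {lam Lam : ℝ}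

lemma IsSub.le_of_strict {𝒜 : Set (Coeff n)} {K D : Set (Eucl n)} {W F ψ : Eucl n → ℝ}
    (hS : IsSub 𝒜 D W F) (hK : IsCompact K) (hD : IsOpen D) (hDK : D ⊆ K)
    (hW : ContinuousOn W K) (hψ : ContinuousOn ψ K) (hψ2 : ∀ x ∈ D, ContDiffAt ℝ 2 ψ x)
    (hb : ∀ x ∈ K, x ∉ D → W x ≤ ψ x)
    (hL : ∀ x ∈ D, ψ x < W x → ∃ δ > 0, ∀ c ∈ 𝒜, ellip c ψ x + F x ≤ -δ) :
    ∀ x ∈ K, W x ≤ ψ x := by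
  intro x hx
  obtain ⟨q, hq, hmax⟩ := hK.exists_isMaxOn ⟨x, hx⟩ (hW.sub hψ)
  have hxq : W x - ψ x ≤ W q - ψ q := isMaxOn_iff.1 hmax x hx
  by_contra hcon
  have hq1 : ψ q < W q := by linarith
  have hqD : q ∈ D := by
    by_contra h
    linarith [hb q hq h]
  obtain ⟨δ, hδ, hδ'⟩ := hL q hqD hq1
  obtain ⟨c, hc, hc'⟩ := hS q hqD ψ (hψ2 q hqD)
    (hmax.isLocalMax (mem_of_superset (hD.mem_nhds hqD) hDK)) (δ / 2) (by positivity)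
  linarith [hδ' c hc]

lemma le_sum_of_admissible {c : Coeff n} (hc : c ∈ admissible n lam Lam) :
    n * lam ≤ ∑ i, c.2 i := by
  calc n * lam = ∑ _i : Fin n, lam := by simp
    _ ≤ ∑ i, c.2 i := Finset.sum_le_sum fun i _ => (hc i).1

lemma IsSuper.ge_of_sub (hlam : 0 < lam) (hn : 0 < n) {K D : Set (Eucl n)}
    {w g ψ : Eucl n → ℝ} (hS : IsSuper (admissible n lam Lam) D w g)
    (hK : IsCompact K) (hD : IsOpen D) (hDK : D ⊆ K)
    (hw : ContinuousOn w K) (hψ : ContinuousOn ψ K) (hψ2 : ∀ x ∈ D, ContDiffAt ℝ 2 ψ x)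
    (hb : ∀ x ∈ K, x ∉ D → ψ x ≤ w x)
    (hL : ∀ x ∈ D, w x < ψ x → ∃ c ∈ admissible n lam Lam, 0 ≤ ellip c ψ x + g x) :
    ∀ x ∈ K, ψ x ≤ w x := by
  intro x₁ hx₁
  by_contra! hcon
  obtain ⟨R, hR, hKR⟩ := hK.isBounded.subset_closedBall_lt 0 x₁
  set ε := (ψ x₁ - w x₁) / (2 * R ^ 2) with hε
  have hε0 : 0 < ε := div_pos (by linarith) (by positivity)
  have hεR : ε * R ^ 2 = (ψ x₁ - w x₁) / 2 := by rw [hε]; field_simp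
  have hquad : ContDiff ℝ 2 fun x : Eucl n => ε * ‖x - x₁‖ ^ 2 :=
    contDiff_const.mul (contDiff_norm_sub_sq x₁)
  obtain ⟨q, hq, hmin⟩ := hK.exists_isMinOn ⟨x₁, hx₁⟩
    (hw.sub (hψ.add hquad.continuous.continuousOn))
  have h1 := isMinOn_iff.1 hmin x₁ hx₁
  simp only [Pi.sub_apply, Pi.add_apply, sub_self, norm_zero] at h1
  have h2 : ε * ‖q - x₁‖ ^ 2 ≤ ε * R ^ 2 := by
    have : ‖q - x₁‖ ≤ R := by rw [← dist_eq_norm]; exact hKR hq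
    gcongr
  have hq1 : w q < ψ q := by nlinarith
  have hqD : q ∈ D := by
    by_contra h
    linarith [hb q hq h]
  obtain ⟨c, hc, hc'⟩ := hL q hqD hq1
  have h3 := hS q hqD (fun x => ψ x + ε * ‖x - x₁‖ ^ 2) ((hψ2 q hqD).add hquad.contDiffAt)
    (hmin.isLocalMin (mem_of_superset (hD.mem_nhds hqD) hDK)) c hc
  rw [ellip_add c (hψ2 q hqD) hquad.contDiffAt, ellip_const_mul, ellip_norm_sub_sq] at h3
  have h4 := le_sum_of_admissible hc
  have h5 : 0 < (n : ℝ) * lam := by positivity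
  have : 0 < ε * (2 * ∑ i, c.2 i) := by have := h5.trans_le h4; positivity
  linarith

lemma lineDeriv₂_quad (m ν : Eucl n) (a b d : ℝ) (x v : Eucl n) :
    lineDeriv₂ (fun x => a * ‖x - m‖ ^ 2 + b * ⟪ν, x - m⟫ - d * ⟪ν, x - m⟫ ^ 2) x v =
      2 * a * ‖v‖ ^ 2 - 2 * d * ⟪ν, v⟫ ^ 2 := by
  have hs : ∀ t : ℝ, ⟪ν, x + t • v - m⟫ = ⟪ν, x - m⟫ + t * ⟪ν, v⟫ := by
    intro t
    rw [show x + t • v - m = (x - m) + t • v by abel, inner_add_right, inner_smul_right]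
  have hN : ∀ t : ℝ, ‖x + t • v - m‖ ^ 2 = ‖x - m‖ ^ 2 + 2 * (t * ⟪x - m, v⟫) + t ^ 2 * ‖v‖ ^ 2 := by
    intro t
    rw [show x + t • v - m = (x - m) + t • v by abel, norm_add_sq_real, inner_smul_right,
      norm_smul, mul_pow, Real.norm_eq_abs, sq_abs]
  refine lineDeriv₂_eq_of_hasDerivAt
    (g := fun t => a * (2 * ⟪x - m, v⟫ + 2 * t * ‖v‖ ^ 2) + b * ⟪ν, v⟫ -
      d * (2 * (⟪ν, x - m⟫ + t * ⟪ν, v⟫) * ⟪ν, v⟫)) (Eventually.of_forall fun t => ?_) ?_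
  · simp only [hs, hN]
    have ht := hasDerivAt_id' t
    have h1 := (((ht.mul_const ⟪x - m, v⟫).const_mul 2).const_add (‖x - m‖ ^ 2)).fun_add
      ((ht.fun_pow 2).mul_const (‖v‖ ^ 2))
    have h2 := (ht.mul_const ⟪ν, v⟫).const_add ⟪ν, x - m⟫
    have := ((h1.const_mul a).fun_add (h2.const_mul b)).fun_sub ((h2.fun_pow 2).const_mul d)
    exact this.congr_deriv (by simp)
  · have ht := hasDerivAt_id' (0 : ℝ)
    have h1 := (((ht.const_mul 2).mul_const (‖v‖ ^ 2)).const_add (2 * ⟪x - m, v⟫)).const_mul a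
    have h2 := ((((ht.mul_const ⟪ν, v⟫).const_add ⟪ν, x - m⟫).const_mul 2).mul_const
      ⟪ν, v⟫).const_mul d
    have := (h1.add_const (b * ⟪ν, v⟫)).fun_sub h2
    exact this.congr_deriv (by ring)

lemma contDiff_quad (m ν : Eucl n) (a b d : ℝ) : ContDiff ℝ 2 fun x : Eucl n =>
    a * ‖x - m‖ ^ 2 + b * ⟪ν, x - m⟫ - d * ⟪ν, x - m⟫ ^ 2 := by
  have h : ContDiff ℝ 2 fun x : Eucl n => ⟪ν, x - m⟫ :=
    contDiff_const.inner ℝ (contDiff_id.sub contDiff_const)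
  exact ((contDiff_const.mul (contDiff_norm_sub_sq m)).add (contDiff_const.mul h)).sub
    (contDiff_const.mul (h.pow 2))

lemma ellip_quad_le {c : Coeff n} (hc : c ∈ admissible n lam Lam) {m ν : Eucl n} (hν : ‖ν‖ = 1)
    {a d : ℝ} (ha : 0 ≤ a) (hd : 0 ≤ d) (b : ℝ) (x : Eucl n) :
    ellip c (fun x => a * ‖x - m‖ ^ 2 + b * ⟪ν, x - m⟫ - d * ⟪ν, x - m⟫ ^ 2) x ≤
      2 * a * (n * Lam) - 2 * d * lam := by
  have h1 : ∑ i, ⟪ν, c.1 i⟫ ^ 2 = 1 := by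
    have := c.1.sum_sq_norm_inner_left ν
    simpa [hν] using this
  have h2 : lam ≤ ∑ i, c.2 i * ⟪ν, c.1 i⟫ ^ 2 := by
    calc lam = ∑ i, lam * ⟪ν, c.1 i⟫ ^ 2 := by rw [← Finset.mul_sum, h1, mul_one]
      _ ≤ _ := Finset.sum_le_sum fun i _ => mul_le_mul_of_nonneg_right (hc i).1 (sq_nonneg _)
  have h3 := sum_le_of_admissible hc
  have h4 : ellip c (fun x => a * ‖x - m‖ ^ 2 + b * ⟪ν, x - m⟫ - d * ⟪ν, x - m⟫ ^ 2) x =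
      2 * a * ∑ i, c.2 i - 2 * d * ∑ i, c.2 i * ⟪ν, c.1 i⟫ ^ 2 := by
    simp only [ellip, lineDeriv₂_quad, c.1.norm_eq_one, Finset.mul_sum, ← Finset.sum_sub_distrib]
    exact Finset.sum_congr rfl fun i _ => by ring
  rw [h4]
  have h5 : 2 * a * ∑ i, c.2 i ≤ 2 * a * (n * Lam) := by gcongr
  have h6 : 2 * d * lam ≤ 2 * d * ∑ i, c.2 i * ⟪ν, c.1 i⟫ ^ 2 := by gcongr
  linarith

/-- Barrier for subsolutions in a slab of width `h` cut by a ball of radius `ℓ`. -/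
lemma IsSub.slab_barrier (hlam : 0 < lam) (hLam : lam ≤ Lam) {m ν : Eucl n} (hν : ‖ν‖ = 1)
    {ℓ h S N : ℝ} (hℓ : 0 < ℓ) (hS : 0 ≤ S) (hN : 0 ≤ N) {W F : Eucl n → ℝ}
    (hW : ContinuousOn W {x | x ∈ closedBall m ℓ ∧ 0 ≤ ⟪ν, x - m⟫ ∧ ⟪ν, x - m⟫ ≤ h})
    (hsub : IsSub (admissible n lam Lam)
      {x | x ∈ ball m ℓ ∧ 0 < ⟪ν, x - m⟫ ∧ ⟪ν, x - m⟫ < h} W F)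
    (hF : ∀ x ∈ ball m ℓ, 0 < ⟪ν, x - m⟫ → ⟪ν, x - m⟫ < h → 0 < W x → F x < N)
    (hWS : ∀ x ∈ closedBall m ℓ, 0 ≤ ⟪ν, x - m⟫ → ⟪ν, x - m⟫ ≤ h → W x ≤ S)
    (h0 : ∀ x ∈ closedBall m ℓ, ⟪ν, x - m⟫ = 0 → W x ≤ 0)
    (hh : ∀ x ∈ ball m ℓ, ⟪ν, x - m⟫ = h → W x ≤ 0) :
    ∀ x ∈ closedBall m ℓ, 0 ≤ ⟪ν, x - m⟫ → ⟪ν, x - m⟫ ≤ h →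
      W x ≤ S / ℓ ^ 2 * ‖x - m‖ ^ 2 + (2 * n * Lam * (S / ℓ ^ 2) + N) / (2 * lam) *
        (h * ⟪ν, x - m⟫ - ⟪ν, x - m⟫ ^ 2) := by
  have hLam0 : 0 < Lam := hlam.trans_le hLam
  set a := S / ℓ ^ 2 with ha
  have ha0 : 0 ≤ a := by positivity
  set B := (2 * n * Lam * a + N) / (2 * lam) with hB
  have hB0 : 0 ≤ B := by positivity
  have hcs : Continuous fun x : Eucl n => ⟪ν, x - m⟫ := by fun_prop
  have hψ := contDiff_quad m ν a (B * h) B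
  have hK : IsCompact {x | x ∈ closedBall m ℓ ∧ 0 ≤ ⟪ν, x - m⟫ ∧ ⟪ν, x - m⟫ ≤ h} :=
    (isCompact_closedBall m ℓ).inter_right
      ((isClosed_le continuous_const hcs).inter (isClosed_le hcs continuous_const))
  have hD : IsOpen {x | x ∈ ball m ℓ ∧ 0 < ⟪ν, x - m⟫ ∧ ⟪ν, x - m⟫ < h} :=
    isOpen_ball.inter ((isOpen_lt continuous_const hcs).inter (isOpen_lt hcs continuous_const))
  have hnn : ∀ x, 0 ≤ ⟪ν, x - m⟫ → ⟪ν, x - m⟫ ≤ h →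
      a * ‖x - m‖ ^ 2 ≤ a * ‖x - m‖ ^ 2 + B * h * ⟪ν, x - m⟫ - B * ⟪ν, x - m⟫ ^ 2 := by
    intro x h1 h2
    have : 0 ≤ B * (⟪ν, x - m⟫ * (h - ⟪ν, x - m⟫)) :=
      mul_nonneg hB0 (mul_nonneg h1 (by linarith))
    linarith
  have key := hsub.le_of_strict hK hD (fun x hx => ⟨ball_subset_closedBall hx.1, hx.2.1.le,
    hx.2.2.le⟩) hW hψ.continuous.continuousOn (fun x _ => hψ.contDiffAt) ?_ ?_
  · intro x hx h1 h2
    refine (key x ⟨hx, h1, h2⟩).trans (le_of_eq ?_)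
    ring
  · rintro x ⟨hx, h1, h2⟩ hxD
    refine le_trans ?_ (hnn x h1 h2)
    have hann : 0 ≤ a * ‖x - m‖ ^ 2 := by positivity
    by_cases hxb : x ∈ ball m ℓ
    · rcases h1.eq_or_lt with h1' | h1'
      · exact (h0 x hx h1'.symm).trans hann
      rcases h2.eq_or_lt with h2' | h2'
      · exact (hh x hxb h2').trans hann
      · exact absurd ⟨hxb, h1', h2'⟩ hxD
    · have hxl : ‖x - m‖ = ℓ := by
        rw [← dist_eq_norm]
        exact le_antisymm hx (by simpa using hxb)
      rw [hxl, ha, div_mul_cancel₀ _ (by positivity)]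
      exact hWS x hx h1 h2
  · rintro x ⟨hx, h1, h2⟩ hlt
    have hann : 0 ≤ a * ‖x - m‖ ^ 2 := by positivity
    have hFx := hF x hx h1 h2 (by linarith [hnn x h1.le h2.le])
    refine ⟨N - F x, by linarith, fun c hc => ?_⟩
    have := ellip_quad_le hc (m := m) hν ha0 hB0 (B * h) x
    have h2 : 2 * B * lam = 2 * n * Lam * a + N := by rw [hB]; field_simp
    linarith

end Comparison

section Radial

variable {n : ℕ} {lam Lam : ℝ}

lemma lineDeriv₂_radial {G G' : ℝ → ℝ} {G'' : ℝ} {y x : Eucl n}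
    (h₁ : ∀ᶠ s in 𝓝 (‖x - y‖ ^ 2), HasDerivAt G (G' s) s)
    (h₂ : HasDerivAt G' G'' (‖x - y‖ ^ 2)) (v : Eucl n) :
    lineDeriv₂ (fun z => G (‖z - y‖ ^ 2)) x v =
      4 * G'' * ⟪x - y, v⟫ ^ 2 + 2 * G' (‖x - y‖ ^ 2) * ‖v‖ ^ 2 := by
  have hN : ∀ t : ℝ, ‖x + t • v - y‖ ^ 2 = ‖x - y‖ ^ 2 + 2 * (t * ⟪x - y, v⟫) + t ^ 2 * ‖v‖ ^ 2 := by
    intro t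
    rw [show x + t • v - y = (x - y) + t • v by abel, norm_add_sq_real, inner_smul_right,
      norm_smul, mul_pow, Real.norm_eq_abs, sq_abs]
  set q : ℝ → ℝ := fun t => ‖x - y‖ ^ 2 + 2 * (t * ⟪x - y, v⟫) + t ^ 2 * ‖v‖ ^ 2 with hq
  have hq0 : q 0 = ‖x - y‖ ^ 2 := by simp [hq]
  have hqd : ∀ t, HasDerivAt q (2 * ⟪x - y, v⟫ + 2 * t * ‖v‖ ^ 2) t := by
    intro t
    have ht := hasDerivAt_id' t
    have h1 := (((ht.mul_const ⟪x - y, v⟫).const_mul 2).const_add (‖x - y‖ ^ 2)).fun_add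
      ((ht.fun_pow 2).mul_const (‖v‖ ^ 2))
    exact h1.congr_deriv (by simp)
  have hqc : Tendsto q (𝓝 0) (𝓝 (‖x - y‖ ^ 2)) := by
    have := (hqd 0).continuousAt.tendsto
    rwa [hq0] at this
  refine lineDeriv₂_eq_of_hasDerivAt
    (g := fun t => G' (q t) * (2 * ⟪x - y, v⟫ + 2 * t * ‖v‖ ^ 2)) ?_ ?_
  · filter_upwards [hqc.eventually h₁] with t ht
    simp only [hN]
    exact ht.comp t (hqd t)
  · have h2 : HasDerivAt G' G'' (q 0) := by rwa [hq0]
    have ht := hasDerivAt_id' (0 : ℝ)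
    have h3 := ((ht.const_mul 2).mul_const (‖v‖ ^ 2)).const_add (2 * ⟪x - y, v⟫)
    have := (h2.comp 0 (hqd 0)).fun_mul h3
    exact this.congr_deriv (by simp only [Function.comp, hq0]; ring)

lemma exists_orthonormalBasis_eq {e : Eucl n} (he : ‖e‖ = 1) :
    ∃ (b : OrthonormalBasis (Fin n) ℝ (Eucl n)) (i : Fin n), b i = e := by
  have hn : 0 < n := by
    rcases Nat.eq_zero_or_pos n with rfl | h
    · rw [Subsingleton.elim e 0, norm_zero] at he
      norm_num at he
    · exact h
  obtain ⟨b, hb⟩ := Orthonormal.exists_orthonormalBasis_extension_of_card_eq (𝕜 := ℝ)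
    (ι := Fin n) (E := Eucl n) (v := fun _ => e) (s := {⟨0, hn⟩}) (by simp) (by
      refine ⟨fun _ => he, fun i j hij => absurd (Subsingleton.elim i j) hij⟩)
  exact ⟨b, ⟨0, hn⟩, hb _ rfl⟩

lemma exists_ellip_radial (hLam : lam ≤ Lam) {G G' : ℝ → ℝ} {G'' : ℝ}
    {y x : Eucl n} (hxy : x ≠ y)
    (h₁ : ∀ᶠ s in 𝓝 (‖x - y‖ ^ 2), HasDerivAt G (G' s) s)
    (h₂ : HasDerivAt G' G'' (‖x - y‖ ^ 2)) :
    ∃ c ∈ admissible n lam Lam, ellip c (fun z => G (‖z - y‖ ^ 2)) x =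
      Lam * (4 * G'' * ‖x - y‖ ^ 2 + 2 * G' (‖x - y‖ ^ 2)) +
        2 * lam * (n - 1) * G' (‖x - y‖ ^ 2) := by
  have hr : 0 < ‖x - y‖ := norm_pos_iff.2 (sub_ne_zero.2 hxy)
  obtain ⟨b, i₀, hb⟩ := exists_orthonormalBasis_eq (n := n) (e := ‖x - y‖⁻¹ • (x - y)) (by
    rw [norm_smul, norm_inv, norm_norm, inv_mul_cancel₀ hr.ne'])
  have hxb : x - y = ‖x - y‖ • b i₀ := by rw [hb, smul_smul, mul_inv_cancel₀ hr.ne', one_smul]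
  refine ⟨(b, fun i => if i = i₀ then Lam else lam), fun i => ?_, ?_⟩
  · dsimp only; split_ifs
    exacts [⟨hLam, le_rfl⟩, ⟨le_rfl, hLam⟩]
  · have hin : ∀ i, ⟪x - y, b i⟫ = if i = i₀ then ‖x - y‖ else 0 := by
      intro i
      have : ⟪x - y, b i⟫ = ⟪‖x - y‖ • b i₀, b i⟫ := by rw [← hxb]
      rw [this, real_inner_smul_left, b.inner_eq_ite]
      simp [eq_comm]
    simp only [ellip, lineDeriv₂_radial h₁ h₂, hin, b.norm_eq_one]
    rw [← Finset.add_sum_erase _ _ (Finset.mem_univ i₀)]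
    rw [Finset.sum_congr rfl (g := fun _ => lam * (2 * G' (‖x - y‖ ^ 2))) fun i hi => by
      rw [if_neg (Finset.ne_of_mem_erase hi), if_neg (Finset.ne_of_mem_erase hi)]; ring]
    have hn : 1 ≤ n := i₀.pos
    rw [Finset.sum_const, Finset.card_erase_of_mem (Finset.mem_univ _), Finset.card_univ,
      Fintype.card_fin, nsmul_eq_mul, Nat.cast_sub hn]
    simp only [if_true]
    push_cast; ring

end Radial

section Reflect

variable {n : ℕ} {lam Lam : ℝ}

/-- The reflection across the hyperplane through `m` orthogonal to the unit vector `ν`. -/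
noncomputable def reflect (ν m z : Eucl n) : Eucl n := z - (2 * ⟪ν, z - m⟫) • ν

lemma reflect_eq {ν : Eucl n} (hν : ‖ν‖ = 1) (m z : Eucl n) :
    reflect ν m z = (m - (ℝ ∙ ν)ᗮ.reflection m) + (1 : ℝ) • (ℝ ∙ ν)ᗮ.reflection z := by
  have h : ∀ x, (ℝ ∙ ν)ᗮ.reflection x = x - (2 * ⟪ν, x⟫) • ν := by
    intro x
    rw [Submodule.reflection_orthogonal_apply, Submodule.reflection_singleton_apply, hν]
    simp [two_smul, two_mul, add_smul]
  rw [h, h, reflect, inner_sub_right]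
  module

lemma norm_reflect_sub {ν : Eucl n} (hν : ‖ν‖ = 1) (m z : Eucl n) :
    ‖reflect ν m z - m‖ = ‖z - m‖ := by
  have : reflect ν m z - m = (ℝ ∙ ν)ᗮ.reflection (z - m) := by
    rw [reflect_eq hν, map_sub]; module
  rw [this, LinearIsometryEquiv.norm_map]

lemma continuous_reflect (ν m : Eucl n) : Continuous (reflect ν m) := by
  unfold reflect; fun_prop

lemma reflect_of_inner_eq_zero {ν m z : Eucl n} (h : ⟪ν, z - m⟫ = 0) : reflect ν m z = z := by
  simp [reflect, h]

lemma IsSuper.comp_reflect {Ω Ω' : Set (Eucl n)} {v f : Eucl n → ℝ}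
    (h : IsSuper (admissible n lam Lam) Ω v f) {ν : Eucl n} (hν : ‖ν‖ = 1) (m : Eucl n)
    (hΩ : ∀ z ∈ Ω', reflect ν m z ∈ Ω) :
    IsSuper (admissible n lam Lam) Ω' (fun z => v (reflect ν m z))
      (fun z => f (reflect ν m z)) := by
  have := h.comp_affine (Ω' := Ω') one_pos one_pos (m - (ℝ ∙ ν)ᗮ.reflection m)
    (ℝ ∙ ν)ᗮ.reflection (𝒜' := admissible n lam Lam)
    (fun c hc => Coeff.map_mem_admissible _ hc) (fun z hz => by
      rw [← reflect_eq hν]; exact hΩ z hz)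
  simpa only [← reflect_eq hν, one_mul, one_pow] using this

/-- The difference between a solution and its reflection is a subsolution. -/
lemma IsSub.sub_reflect (hlam : 0 < lam) (hLam : lam ≤ Lam) (hn : 0 < n) {Ω Ω' : Set (Eucl n)}
    (hΩ' : IsOpen Ω') {v f : Eucl n → ℝ} (hv : ContinuousOn v Ω) (hf : ContinuousOn f Ω)
    (hsub : IsSub (admissible n lam Lam) Ω v f) (hsup : IsSuper (admissible n lam Lam) Ω v f)
    {ν : Eucl n} (hν : ‖ν‖ = 1) {m : Eucl n} (h1 : Ω' ⊆ Ω) (h2 : ∀ z ∈ Ω', reflect ν m z ∈ Ω) :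
    IsSub (admissible n lam Lam) Ω' (fun z => v z - v (reflect ν m z))
      (fun z => f z - f (reflect ν m z)) :=
  (hsub.mono h1).sub_isSuper hlam hLam hn hΩ' (hv.mono h1)
    (hv.comp (continuous_reflect ν m).continuousOn h2) (hf.mono h1)
    (hf.comp (continuous_reflect ν m).continuousOn h2) (hsup.comp_reflect hν m h2)

/-- Interior Lipschitz estimate at a point. -/
lemma lipschitz_estimate (hlam : 0 < lam) (hLam : lam ≤ Lam) (hn : 0 < n) {q : Eucl n}
    {r S N : ℝ} (hr : 0 < r) (hS : 0 ≤ S) (hN : 0 ≤ N) {v f : Eucl n → ℝ}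
    (hv : ContinuousOn v (ball q r)) (hf : ContinuousOn f (ball q r))
    (hsub : IsSub (admissible n lam Lam) (ball q r) v f)
    (hsup : IsSuper (admissible n lam Lam) (ball q r) v f)
    (h0 : ∀ x ∈ ball q r, 0 ≤ v x) (hvS : ∀ x ∈ ball q r, v x ≤ S)
    (hfN : ∀ x ∈ ball q r, ∀ y ∈ ball q r, f x - f y < N) {x : Eucl n} (hx : x ∈ ball q (r / 4)) :
    |v x - v q| ≤ ((1 + n * Lam / lam) * S / r + N * r / (8 * lam)) * ‖x - q‖ := by
  have hLam0 : 0 < Lam := hlam.trans_le hLam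
  have key : ∀ a ∈ ball q (r / 4), ∀ b ∈ ball q (r / 4), v a - v b ≤
      ((1 + n * Lam / lam) * S / r + N * r / (8 * lam)) * ‖a - b‖ := by
    intro a ha b hb
    rcases eq_or_ne a b with rfl | hab
    · simp
    have hd : 0 < ‖a - b‖ := norm_pos_iff.2 (sub_ne_zero.2 hab)
    set ν : Eucl n := ‖a - b‖⁻¹ • (a - b) with hν
    have hν1 : ‖ν‖ = 1 := by
      rw [hν, norm_smul, norm_inv, norm_norm, inv_mul_cancel₀ hd.ne']
    set m : Eucl n := (1 / 2 : ℝ) • (a + b) with hm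
    have ham : a - m = (‖a - b‖ / 2) • ν := by
      rw [hν, smul_smul, div_mul_eq_mul_div, mul_inv_cancel₀ hd.ne', hm]; module
    have hin : ⟪ν, a - m⟫ = ‖a - b‖ / 2 := by
      rw [ham, inner_smul_right, real_inner_self_eq_norm_sq, hν1]; ring
    have hra : reflect ν m a = b := by
      rw [reflect, hin, hν, smul_smul, show 2 * (‖a - b‖ / 2) * ‖a - b‖⁻¹ = 1 by field_simp]
      module
    have hnam : ‖a - m‖ = ‖a - b‖ / 2 := by
      rw [ham, norm_smul, hν1, Real.norm_of_nonneg (by positivity), mul_one]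
    rw [mem_ball, dist_eq_norm] at ha hb
    have hab2 : ‖a - b‖ < r / 2 := by
      calc ‖a - b‖ = ‖(a - q) - (b - q)‖ := by congr 1; abel
        _ ≤ ‖a - q‖ + ‖b - q‖ := norm_sub_le _ _
        _ < r / 2 := by linarith
    have hmq : ‖m - q‖ < r / 4 := by
      have : m - q = (1 / 2 : ℝ) • ((a - q) + (b - q)) := by rw [hm]; module
      rw [this, norm_smul, Real.norm_of_nonneg (by norm_num)]
      have := norm_add_le (a - q) (b - q)
      linarith
    set ℓ := r / 2 with hℓ
    have hℓ0 : 0 < ℓ := by positivity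
    have hballs : ∀ z, ‖z - m‖ ≤ ℓ → z ∈ ball q r := by
      intro z hz
      rw [mem_ball, dist_eq_norm]
      calc ‖z - q‖ = ‖(z - m) + (m - q)‖ := by congr 1; abel
        _ ≤ ‖z - m‖ + ‖m - q‖ := norm_add_le _ _
        _ < r := by linarith
    have hballs2 : ∀ z, ‖z - m‖ ≤ ℓ → reflect ν m z ∈ ball q r := fun z hz =>
      hballs _ (by rwa [norm_reflect_sub hν1])
    have hs : ∀ z : Eucl n, ⟪ν, z - m⟫ ≤ ‖z - m‖ := fun z => by
      simpa [hν1] using real_inner_le_norm ν (z - m)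
    have hmem : ∀ {z}, z ∈ closedBall m ℓ → ‖z - m‖ ≤ ℓ := fun {z} hz => by
      rwa [← dist_eq_norm]
    have hmem' : ∀ {z}, z ∈ ball m ℓ → ‖z - m‖ < ℓ := fun {z} hz => by
      rwa [← dist_eq_norm]
    have hW := hsub.sub_reflect hlam hLam hn (Ω' := ball m ℓ) isOpen_ball hv hf hsup hν1 (m := m)
      (fun z hz => hballs z (hmem' hz).le) (fun z hz => hballs2 z (hmem' hz).le)
    have hWc : ContinuousOn (fun z => v z - v (reflect ν m z)) (closedBall m ℓ) :=
      (hv.mono fun z hz => hballs z (hmem hz)).sub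
        (hv.comp (continuous_reflect ν m).continuousOn fun z hz => hballs2 z (hmem hz))
    have hbar := (hW.mono (Ω' := {x | x ∈ ball m ℓ ∧ 0 < ⟪ν, x - m⟫ ∧ ⟪ν, x - m⟫ < ℓ})
      fun z hz => hz.1).slab_barrier hlam hLam hν1 hℓ0 hS hN
      (hWc.mono fun z hz => hz.1) (fun z hz _ _ _ => hfN z (hballs z (hmem' hz).le) _
        (hballs2 z (hmem' hz).le))
      (fun z hz _ _ => by
        linarith [hvS z (hballs z (hmem hz)), h0 _ (hballs2 z (hmem hz))])
      (fun z _ hz0 => by rw [reflect_of_inner_eq_zero hz0, sub_self])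
      (fun z hz hzl => by linarith [hmem' hz, hs z])
      a (by rw [mem_closedBall, dist_eq_norm, hnam]; linarith) (by rw [hin]; positivity)
      (by rw [hin]; linarith)
    rw [hra, hin, hnam] at hbar
    refine hbar.trans ?_
    have h1 : S / ℓ ^ 2 * (‖a - b‖ / 2) ^ 2 ≤ S / r * ‖a - b‖ := by
      have : S / ℓ ^ 2 * (‖a - b‖ / 2) ^ 2 = S / r * ‖a - b‖ * (‖a - b‖ / r) := by
        rw [hℓ]; field_simp
      rw [this]
      refine mul_le_of_le_one_right (by positivity) ?_
      rw [div_le_one hr]; linarith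
    have h2 : (2 * n * Lam * (S / ℓ ^ 2) + N) / (2 * lam) * (ℓ * (‖a - b‖ / 2) - (‖a - b‖ / 2) ^ 2)
        ≤ (2 * n * Lam * (S / ℓ ^ 2) + N) / (2 * lam) * (ℓ * (‖a - b‖ / 2)) := by
      gcongr
      linarith [sq_nonneg (‖a - b‖ / 2)]
    have h3 : (2 * n * Lam * (S / ℓ ^ 2) + N) / (2 * lam) * (ℓ * (‖a - b‖ / 2)) =
        (n * Lam / lam * S / r + N * r / (8 * lam)) * ‖a - b‖ := by
      rw [hℓ]; field_simp; ring
    calc _ ≤ S / r * ‖a - b‖ + (n * Lam / lam * S / r + N * r / (8 * lam)) * ‖a - b‖ := by linarith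
      _ = _ := by ring
  have hq : q ∈ ball q (r / 4) := mem_ball_self (by positivity)
  rw [abs_le]
  have h1 := key x hx q hq
  have h2 := key q hq x hx
  rw [norm_sub_rev] at h2
  constructor <;> linarith

end Reflect

section Liouville

variable {n : ℕ} {lam Lam : ℝ}

lemma contDiffAt_radial {G : ℝ → ℝ} {y x : Eucl n} (hG : ContDiffAt ℝ 2 G (‖x - y‖ ^ 2)) :
    ContDiffAt ℝ 2 (fun z => G (‖z - y‖ ^ 2)) x :=
  ContDiffAt.comp x hG (contDiff_norm_sub_sq y).contDiffAt

lemma hasDerivAt_rpow_mul_log_add {s : ℝ} (hs : 0 < s) (b a d L : ℝ) :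
    HasDerivAt (fun s => s ^ b * (a * (Real.log s - L) + d))
      (s ^ (b - 1) * (b * a * (Real.log s - L) + (a + b * d))) s := by
  have h1 := Real.hasDerivAt_rpow_const (p := b) (Or.inl hs.ne')
  have h2 := (((Real.hasDerivAt_log hs.ne').sub_const L).const_mul a).add_const d
  refine (h1.fun_mul h2).congr_deriv ?_
  rw [show s ^ b = s ^ (b - 1) * s by rw [← Real.rpow_add_one hs.ne', sub_add_cancel]]
  field_simp
  ring

/-- The logarithmically perturbed fundamental solution is almost a subsolution. -/
lemma exists_ellip_log_radial (hlam : 0 < lam) (hLam : lam ≤ Lam) (hn : 1 ≤ n) {β : ℝ}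
    (hβ : 0 < β) (hγ : lam * (n - 1) ≤ Lam * (2 * β + 1)) {y x : Eucl n} (hxy : x ≠ y)
    {a d L C : ℝ} (ha : 0 ≤ a) (hd : 0 ≤ d) (hL : L ≤ Real.log (‖x - y‖ ^ 2)) :
    ContDiffAt ℝ 2 (fun z => (‖z - y‖ ^ 2) ^ (-β) * (a * (Real.log (‖z - y‖ ^ 2) - L) + d) - C) x ∧
    ∃ c ∈ admissible n lam Lam, -(a * (Lam * (8 * β + 2)) * (‖x - y‖ ^ 2) ^ (-β - 1)) ≤
      ellip c (fun z => (‖z - y‖ ^ 2) ^ (-β) * (a * (Real.log (‖z - y‖ ^ 2) - L) + d) - C) x := by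
  have hs : 0 < ‖x - y‖ ^ 2 := by
    have : 0 < ‖x - y‖ := norm_pos_iff.2 (sub_ne_zero.2 hxy)
    positivity
  constructor
  · refine contDiffAt_radial (G := fun s => s ^ (-β) * (a * (Real.log s - L) + d) - C) ?_
    have h1 : ContDiffAt ℝ 2 (fun s : ℝ => s ^ (-β)) (‖x - y‖ ^ 2) :=
      Real.contDiffAt_rpow_const_of_ne hs.ne'
    have h2 : ContDiffAt ℝ 2 Real.log (‖x - y‖ ^ 2) := Real.contDiffAt_log.2 hs.ne'
    fun_prop
  · obtain ⟨c, hc, hc'⟩ := exists_ellip_radial (lam := lam) hLam hxy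
      (G := fun s => s ^ (-β) * (a * (Real.log s - L) + d) - C)
      (by
        filter_upwards [eventually_gt_nhds hs] with s hs'
        exact (hasDerivAt_rpow_mul_log_add hs' (-β) a d L).sub_const C)
      (hasDerivAt_rpow_mul_log_add hs (-β - 1) (-β * a) (a + -β * d) L)
    refine ⟨c, hc, ?_⟩
    rw [hc']
    set s := ‖x - y‖ ^ 2 with hsdef
    set l := Real.log s - L with hl
    have hl0 : 0 ≤ l := by rw [hl]; linarith
    have hss : s ^ (-β - 1 - 1) * s = s ^ (-β - 1) := by
      rw [← Real.rpow_add_one hs.ne', sub_add_cancel]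
    set P := s ^ (-β - 1) with hP
    have hP0 : 0 < P := Real.rpow_pos_of_pos hs _
    have hn' : (0 : ℝ) ≤ n - 1 := by
      have : (1 : ℝ) ≤ n := by exact_mod_cast hn
      linarith
    have hQ : 0 ≤ Lam * (2 * β + 1) - lam * (n - 1) := by linarith
    have h1 : 0 ≤ P * (2 * β * (Lam * (2 * β + 1) - lam * (n - 1)) * (a * l + d)) := by positivity
    have h2 : 0 ≤ P * (2 * lam * (n - 1) * a) := by positivity
    linear_combination h1 + h2 + (0 : ℝ) * hss - (4 * Lam * ((-β - 1) * (-β * a) * l + (-β * a + (-β - 1) * (a + -β * d)))) * hss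

variable {β p : ℝ}

/-- A positive supersolution decays at most like the fundamental solution. -/
lemma IsSuper.lower_bound (hlam : 0 < lam) (hLam : lam ≤ Lam) (hn : 1 ≤ n) (hβ : 0 < β)
    (hγ : lam * (n - 1) ≤ Lam * (2 * β + 1)) {y : Eucl n} {ρ R m : ℝ} (hρ : 0 < ρ)
    (hm : 0 ≤ m) {w g : Eucl n → ℝ} (hw : ContinuousOn w (closedBall y R))
    (hS : IsSuper (admissible n lam Lam) (ball y R) w g) (hg : ∀ x ∈ ball y R, 0 ≤ g x)
    (hw0 : ∀ x ∈ closedBall y R, 0 ≤ w x) (hwm : ∀ x, ‖x - y‖ = ρ → m ≤ w x)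
    {x : Eucl n} (h1 : ρ ≤ ‖x - y‖) (h2 : ‖x - y‖ ≤ R / 2) :
    m * (ρ ^ 2) ^ β * (1 - 4 ^ (-β)) * (‖x - y‖ ^ 2) ^ (-β) ≤ w x := by
  have hR : 0 < R := by linarith
  have hcn : Continuous fun x : Eucl n => ‖x - y‖ := by fun_prop
  set A := m * (ρ ^ 2) ^ β with hA
  have hA0 : 0 ≤ A := by positivity
  set L := Real.log (ρ ^ 2) with hL
  have hlog : ∀ z : Eucl n, ρ ≤ ‖z - y‖ → L ≤ Real.log (‖z - y‖ ^ 2) := fun z hz =>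
    Real.log_le_log (by positivity) (by gcongr)
  have hne : ∀ z : Eucl n, ρ ≤ ‖z - y‖ → z ≠ y := by
    rintro z hz rfl
    rw [sub_self, norm_zero] at hz
    linarith
  have key := (hS.mono (Ω' := {x | ρ < ‖x - y‖ ∧ ‖x - y‖ < R}) fun z hz => by
      rw [mem_ball, dist_eq_norm]; exact hz.2).ge_of_sub hlam hn
    (K := {x | ρ ≤ ‖x - y‖ ∧ ‖x - y‖ ≤ R})
    (ψ := fun z => (‖z - y‖ ^ 2) ^ (-β) * (0 * (Real.log (‖z - y‖ ^ 2) - L) + A) -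
      (R ^ 2) ^ (-β) * A)
    ((isCompact_closedBall y R).of_isClosed_subset
      ((isClosed_le continuous_const hcn).inter (isClosed_le hcn continuous_const))
      fun z hz => by rw [mem_closedBall, dist_eq_norm]; exact hz.2)
    ((isOpen_lt continuous_const hcn).inter (isOpen_lt hcn continuous_const))
    (fun z hz => ⟨hz.1.le, hz.2.le⟩)
    (hw.mono fun z hz => by rw [mem_closedBall, dist_eq_norm]; exact hz.2)
    (fun z hz => (exists_ellip_log_radial hlam hLam hn hβ hγ (hne z hz.1) le_rfl hA0
      (hlog z hz.1)).1.continuousAt.continuousWithinAt)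
    (fun z hz => (exists_ellip_log_radial hlam hLam hn hβ hγ (hne z hz.1.le) le_rfl hA0
      (hlog z hz.1.le)).1)
    (fun z hz hzD => by
      simp only [zero_mul, zero_add]
      have hzR : z ∈ closedBall y R := by rw [mem_closedBall, dist_eq_norm]; exact hz.2
      rcases hz.1.eq_or_lt with h | h
      · refine le_trans ?_ (hwm z h.symm)
        have h3 : (ρ ^ 2) ^ (-β) * A = m := by
          rw [hA, mul_comm, mul_assoc, ← Real.rpow_add (by positivity), add_neg_cancel,
            Real.rpow_zero, mul_one]
        rw [← h, h3]
        have : 0 ≤ (R ^ 2) ^ (-β) * A := by positivity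
        linarith
      · have h4 : ‖z - y‖ = R := by
          by_contra hne
          exact hzD ⟨h, lt_of_le_of_ne hz.2 hne⟩
        rw [h4, sub_self]
        exact hw0 z hzR)
    (fun z hz _ => by
      obtain ⟨c, hc, hc'⟩ := (exists_ellip_log_radial hlam hLam hn hβ hγ (hne z hz.1.le)
        (C := (R ^ 2) ^ (-β) * A) le_rfl hA0 (hlog z hz.1.le)).2
      refine ⟨c, hc, ?_⟩
      have := hg z (by rw [mem_ball, dist_eq_norm]; exact hz.2)
      simp only [zero_mul, neg_zero] at hc' ⊢
      linarith)
    x ⟨h1, by linarith⟩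
  refine le_trans ?_ key
  have h3 : (R ^ 2) ^ (-β) ≤ 4 ^ (-β) * (‖x - y‖ ^ 2) ^ (-β) := by
    rw [← Real.mul_rpow (by norm_num) (by positivity)]
    have hx0 : 0 < ‖x - y‖ := by linarith
    refine Real.rpow_le_rpow_of_nonpos (by positivity) ?_ (by linarith)
    nlinarith
  have := mul_le_mul_of_nonneg_right h3 hA0
  simp only [zero_mul, zero_add]
  linarith

end Liouville

section LiouvilleLocal

variable {n : ℕ} {lam Lam β p : ℝ}

/-- A supersolution lies above its minimum on the sphere. -/
lemma IsSuper.ge_of_sphere (hlam : 0 < lam) (hLam : lam ≤ Lam) (hn : 1 ≤ n) {y : Eucl n} {ρ m : ℝ}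
    {w g : Eucl n → ℝ} (hw : ContinuousOn w (closedBall y ρ))
    (hS : IsSuper (admissible n lam Lam) (ball y ρ) w g) (hg : ∀ x ∈ ball y ρ, 0 ≤ g x)
    (hwm : ∀ x, ‖x - y‖ = ρ → m ≤ w x) : ∀ x ∈ closedBall y ρ, m ≤ w x := by
  obtain ⟨b⟩ : Nonempty (OrthonormalBasis (Fin n) ℝ (Eucl n)) :=
    ⟨EuclideanSpace.basisFun (Fin n) ℝ⟩
  refine hS.ge_of_sub hlam hn (ψ := fun _ => m) (isCompact_closedBall y ρ) isOpen_ball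
    ball_subset_closedBall hw continuousOn_const (fun _ _ => contDiffAt_const) (fun x hx hxb => ?_)
    (fun x hx _ => ⟨(b, fun _ => lam), fun _ => ⟨le_rfl, hLam⟩, ?_⟩)
  · refine hwm x ?_
    rw [← dist_eq_norm]
    exact le_antisymm hx (by simpa using hxb)
  · rw [ellip_const, zero_add]; exact hg x hx

lemma IsSuper.paraboloid_bound (hlam : 0 < lam) (hLam : lam ≤ Lam) (hn : 1 ≤ n) {y : Eucl n}
    {ρ k : ℝ} (hk : 0 ≤ k) {w g : Eucl n → ℝ} (hw : ContinuousOn w (closedBall y ρ))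
    (hS : IsSuper (admissible n lam Lam) (ball y ρ) w g)
    (hg : ∀ x ∈ ball y ρ, k * (2 * n * Lam) ≤ g x) (hw0 : ∀ x ∈ closedBall y ρ, 0 ≤ w x) :
    ∀ x ∈ closedBall y ρ, k * (ρ ^ 2 - ‖x - y‖ ^ 2) ≤ w x := by
  obtain ⟨b⟩ : Nonempty (OrthonormalBasis (Fin n) ℝ (Eucl n)) :=
    ⟨EuclideanSpace.basisFun (Fin n) ℝ⟩
  have hc : ((b, fun _ => lam) : Coeff n) ∈ admissible n lam Lam := fun _ => ⟨le_rfl, hLam⟩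
  have hψ : ContDiff ℝ 2 fun x : Eucl n => (-k) * ‖x - y‖ ^ 2 :=
    contDiff_const.mul (contDiff_norm_sub_sq y)
  have key := hS.ge_of_sub hlam hn (ψ := fun x => (-k) * ‖x - y‖ ^ 2 + k * ρ ^ 2)
    (isCompact_closedBall y ρ) isOpen_ball
    ball_subset_closedBall hw (hψ.add contDiff_const).continuous.continuousOn
    (fun _ _ => (hψ.add contDiff_const).contDiffAt) (fun x hx hxb => ?_)
    (fun x hx _ => ⟨(b, fun _ => lam), hc, ?_⟩)
  · intro x hx
    linarith [key x hx]
  · have : ‖x - y‖ = ρ := by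
      rw [← dist_eq_norm]
      exact le_antisymm hx (by simpa using hxb)
    rw [this]
    linarith [hw0 x hx]
  · rw [ellip_add _ hψ.contDiffAt contDiffAt_const, ellip_const, ellip_const_mul,
      ellip_norm_sub_sq]
    have h1 := sum_le_of_admissible hc
    have h2 := mul_le_mul_of_nonneg_left h1 hk
    linarith [hg x hx]

set_option maxHeartbeats 1600000 in
/-- Quantitative Liouville theorem: a nonnegative supersolution of the Lane–Emden equation with a
subcritical exponent that is not small near `y` cannot live on a large ball around `y`. -/
lemma exists_radius_not_isSuper (hlam : 0 < lam) (hLam : lam ≤ Lam) (hn : 1 ≤ n) (hβ : 0 < β)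
    (hγ : lam * (n - 1) ≤ Lam * (2 * β + 1)) (hp : 1 < p) (hβp : β * (p - 1) = 1) {δ c₀ : ℝ}
    (hδ : 0 < δ) (hc₀ : 0 < c₀) :
    ∃ R > 0, ∀ (y : Eucl n) (v : Eucl n → ℝ), ContinuousOn v (closedBall y R) →
      (∀ x ∈ closedBall y R, 0 ≤ v x) →
      IsSuper (admissible n lam Lam) (ball y R) v (fun x => v x ^ p) →
      (∀ x, ‖x - y‖ ≤ δ → c₀ ≤ v x) → False := by
  have hLam0 : 0 < Lam := hlam.trans_le hLam
  have hn0 : (0 : ℝ) < n := by exact_mod_cast hn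
  set τ : ℝ := 4 ^ (-β) with hτ
  have hτ0 : 0 < τ := by positivity
  have hτ1 : τ < 1 := Real.rpow_lt_one_of_one_lt_of_neg (by norm_num) (by linarith)
  have hτ1' : 0 < 1 - τ := by linarith
  set c₁ := c₀ * (δ ^ 2) ^ β * (1 - τ) with hc₁
  have hc₁0 : 0 < c₁ := by positivity
  set ε := c₁ ^ p / (Lam * (8 * β + 2)) with hε
  have hε0 : 0 < ε := by positivity
  set c₂ := (1 - τ) * τ with hc₂
  have hc₂0 : 0 < c₂ := by positivity
  set Q := 2 * n * Lam / (3 * c₂ ^ p) with hQ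
  have hQ0 : 0 < Q := by positivity
  obtain ⟨E, hEQ, hE1⟩ := ((tendsto_rpow_atTop (show 0 < p - 1 by linarith)).eventually_gt_atTop Q
    |>.and (eventually_gt_atTop 0)).exists
  set X := (E / ε + τ * Real.log 4) / (1 - τ) + 1 with hX
  have hlog4 : 0 < Real.log 4 := Real.log_pos (by norm_num)
  have hX0 : 0 < X := by positivity
  have hEX : E ≤ ε * ((1 - τ) * X - τ * Real.log 4) := by
    have : (1 - τ) * X = E / ε + τ * Real.log 4 + (1 - τ) := by
      rw [hX]; field_simp
    rw [this, show ε * (E / ε + τ * Real.log 4 + (1 - τ) - τ * Real.log 4) = E + ε * (1 - τ) by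
      field_simp; ring]
    have : 0 < ε * (1 - τ) := by positivity
    linarith
  set ρ := δ * Real.exp (X / 2) with hρ
  have hρδ : δ < ρ := lt_mul_of_one_lt_right hδ (Real.one_lt_exp_iff.2 (by positivity))
  have hρ0 : 0 < ρ := by positivity
  have hlogρ : Real.log (ρ ^ 2) = Real.log (δ ^ 2) + X := by
    rw [hρ, mul_pow, Real.log_mul (by positivity) (by positivity), Real.log_pow (n := 2)
      (x := Real.exp _), Real.log_exp]
    push_cast; ring
  refine ⟨4 * ρ, by positivity, fun y v hv hv0 hS hδv => ?_⟩
  have hcn : Continuous fun x : Eucl n => ‖x - y‖ := by fun_prop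
  have hcb : ∀ {x : Eucl n} {t : ℝ}, ‖x - y‖ ≤ t → x ∈ closedBall y t := fun {x t} h => by
    rwa [mem_closedBall, dist_eq_norm]
  have hb : ∀ {x : Eucl n} {t : ℝ}, ‖x - y‖ < t → x ∈ ball y t := fun {x t} h => by
    rwa [mem_ball, dist_eq_norm]
  have hvp0 : ∀ x ∈ ball y (4 * ρ), 0 ≤ v x ^ p := fun x hx =>
    Real.rpow_nonneg (hv0 x (ball_subset_closedBall hx)) _
  -- decay of `v` at most like the fundamental solution
  have step1 : ∀ x : Eucl n, δ ≤ ‖x - y‖ → ‖x - y‖ ≤ 2 * ρ → c₁ * (‖x - y‖ ^ 2) ^ (-β) ≤ v x :=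
    fun x h1 h2 => hS.lower_bound hlam hLam hn hβ hγ hδ hc₀.le hv hvp0 hv0
      (fun x hx => hδv x hx.le) h1 (by linarith)
  set L := Real.log (δ ^ 2) with hL
  have hlog : ∀ z : Eucl n, δ ≤ ‖z - y‖ → L ≤ Real.log (‖z - y‖ ^ 2) := fun z hz =>
    Real.log_le_log (by positivity) (by gcongr)
  have hne : ∀ z : Eucl n, δ ≤ ‖z - y‖ → z ≠ y := by
    rintro z hz rfl
    rw [sub_self, norm_zero] at hz
    linarith
  have hlog2ρ : Real.log ((2 * ρ) ^ 2) = L + X + Real.log 4 := by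
    rw [mul_pow, Real.log_mul (by norm_num) (by positivity), hlogρ]; norm_num; ring
  set C := ((2 * ρ) ^ 2) ^ (-β) * (ε * (X + Real.log 4)) with hC
  have hC0 : 0 ≤ C := by positivity
  have step2 := (hS.mono (Ω' := {x | δ < ‖x - y‖ ∧ ‖x - y‖ < 2 * ρ}) fun z hz =>
      hb (by linarith [hz.2])).ge_of_sub hlam hn
    (K := {x | δ ≤ ‖x - y‖ ∧ ‖x - y‖ ≤ 2 * ρ})
    (ψ := fun z => (‖z - y‖ ^ 2) ^ (-β) * (ε * (Real.log (‖z - y‖ ^ 2) - L) + 0) - C)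
    ((isCompact_closedBall y (2 * ρ)).of_isClosed_subset
      ((isClosed_le continuous_const hcn).inter (isClosed_le hcn continuous_const))
      fun z hz => hcb hz.2)
    ((isOpen_lt continuous_const hcn).inter (isOpen_lt hcn continuous_const))
    (fun z hz => ⟨hz.1.le, hz.2.le⟩)
    (hv.mono fun z hz => hcb (by linarith [hz.2]))
    (fun z hz => (exists_ellip_log_radial hlam hLam hn hβ hγ (hne z hz.1) hε0.le le_rfl
      (hlog z hz.1)).1.continuousAt.continuousWithinAt)
    (fun z hz => (exists_ellip_log_radial hlam hLam hn hβ hγ (hne z hz.1.le) hε0.le le_rfl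
      (hlog z hz.1.le)).1)
    (fun z hz hzD => by
      have hzR := hv0 z (hcb (by linarith [hz.2]))
      rcases hz.1.eq_or_lt with h | h
      · simp only [← h, hL, sub_self, mul_zero, add_zero, zero_sub]
        linarith
      · have h4 : ‖z - y‖ = 2 * ρ := by
          by_contra hne
          exact hzD ⟨h, lt_of_le_of_ne hz.2 hne⟩
        simp only [h4, hlog2ρ, hC]
        refine le_trans (le_of_eq ?_) hzR
        ring)
    (fun z hz _ => by
      obtain ⟨c, hc, hc'⟩ := (exists_ellip_log_radial hlam hLam hn hβ hγ (hne z hz.1.le)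
        (C := C) hε0.le le_rfl (hlog z hz.1.le)).2
      refine ⟨c, hc, ?_⟩
      have hz0 : 0 < ‖z - y‖ := hδ.trans hz.1
      have h1 := Real.rpow_le_rpow (by positivity) (step1 z hz.1.le hz.2.le)
        (show 0 ≤ p by linarith)
      rw [Real.mul_rpow hc₁0.le (by positivity), ← Real.rpow_mul (by positivity),
        show -β * p = -β - 1 by linear_combination -hβp] at h1
      rw [show ε * (Lam * (8 * β + 2)) = c₁ ^ p by rw [hε]; field_simp] at hc'
      linarith)
  have step3 : ∀ x ∈ closedBall y ρ, E * (ρ ^ 2) ^ (-β) ≤ v x := by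
    refine (hS.mono (ball_subset_ball (by linarith))).ge_of_sphere hlam hLam hn
      (hv.mono (closedBall_subset_closedBall (by linarith)))
      (fun x hx => hvp0 x (ball_subset_ball (by linarith) hx)) (fun x hx => ?_)
    refine le_trans ?_ (step2 x ⟨by linarith, by linarith⟩)
    simp only [hx, hlogρ, hC, mul_pow]
    rw [Real.mul_rpow (by positivity) (by positivity), show (2 : ℝ) ^ 2 = 4 by norm_num]
    have h1 := mul_le_mul_of_nonneg_right hEX (show 0 ≤ (ρ ^ 2) ^ (-β) by positivity)
    linarith
  obtain ⟨q, hq, hmin⟩ := (isCompact_closedBall y ρ).exists_isMinOn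
    ⟨y, mem_closedBall_self hρ0.le⟩ (hv.mono (closedBall_subset_closedBall (by linarith)))
  set m := v q with hm
  have hmE : E * (ρ ^ 2) ^ (-β) ≤ m := step3 q hq
  have hm0 : 0 < m := lt_of_lt_of_le (by positivity) hmE
  have hmv : ∀ x ∈ closedBall y ρ, m ≤ v x := isMinOn_iff.1 hmin
  have step4 : ∀ x ∈ closedBall y (2 * ρ), c₂ * m ≤ v x := by
    intro x hx
    have hx' : ‖x - y‖ ≤ 2 * ρ := by rwa [← dist_eq_norm]
    rcases le_total ‖x - y‖ ρ with h | h
    · refine le_trans ?_ (hmv x (hcb h))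
      refine mul_le_of_le_one_left hm0.le ?_
      exact mul_le_one₀ (by linarith) hτ0.le hτ1.le
    · refine le_trans ?_ (hS.lower_bound hlam hLam hn hβ hγ hρ0 hm0.le hv hvp0 hv0
        (fun x hx => hmv x (hcb hx.le)) h (by linarith))
      have hx0 : 0 < ‖x - y‖ := by linarith
      have h1 : τ * (ρ ^ 2) ^ (-β) ≤ (‖x - y‖ ^ 2) ^ (-β) := by
        rw [hτ, ← Real.mul_rpow (by norm_num) (by positivity)]
        exact Real.rpow_le_rpow_of_nonpos (by positivity) (by nlinarith) (by linarith)
      have h2 : (ρ ^ 2) ^ β * (ρ ^ 2) ^ (-β) = 1 := by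
        rw [← Real.rpow_add (by positivity), add_neg_cancel, Real.rpow_zero]
      calc c₂ * m = m * (ρ ^ 2) ^ β * (1 - τ) * (τ * (ρ ^ 2) ^ (-β)) := by
            rw [hc₂]; linear_combination -(1 - τ) * τ * m * h2
        _ ≤ _ := by gcongr
  have step5 := (hS.mono (ball_subset_ball (by linarith))).paraboloid_bound hlam hLam hn
    (ρ := 2 * ρ) (k := (c₂ * m) ^ p / (2 * n * Lam)) (by positivity)
    (hv.mono (closedBall_subset_closedBall (by linarith))) (fun x hx => by
      rw [div_mul_cancel₀ _ (by positivity)]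
      exact Real.rpow_le_rpow (by positivity) (step4 x (ball_subset_closedBall hx)) (by linarith))
    (fun x hx => hv0 x (closedBall_subset_closedBall (by linarith) hx))
    q (closedBall_subset_closedBall (by linarith) hq)
  have hq' : ‖q - y‖ ≤ ρ := by rwa [← dist_eq_norm]
  have h6 : (c₂ * m) ^ p / (2 * n * Lam) * (3 * ρ ^ 2) ≤ m := by
    refine le_trans ?_ step5
    have : ‖q - y‖ ^ 2 ≤ ρ ^ 2 := by gcongr
    gcongr
    linarith
  have h7 : m ^ p = m ^ (p - 1) * m := by
    rw [← Real.rpow_add_one hm0.ne', sub_add_cancel]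
  have h8 : m ^ (p - 1) * ρ ^ 2 ≤ Q := by
    rw [Real.mul_rpow hc₂0.le hm0.le, h7] at h6
    rw [hQ, le_div_iff₀ (by positivity)]
    have : c₂ ^ p * (m ^ (p - 1) * m) / (2 * n * Lam) * (3 * ρ ^ 2) =
      (m ^ (p - 1) * ρ ^ 2 * (3 * c₂ ^ p) / (2 * n * Lam)) * m := by ring
    rw [this] at h6
    have := (mul_le_iff_le_one_left hm0).1 h6
    rwa [div_le_one (by positivity)] at this
  have h9 : E ^ (p - 1) ≤ m ^ (p - 1) * ρ ^ 2 := by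
    have h := Real.rpow_le_rpow (by positivity) hmE (show 0 ≤ p - 1 by linarith)
    rw [Real.mul_rpow hE1.le (by positivity), ← Real.rpow_mul (by positivity),
      show -β * (p - 1) = -1 by linear_combination -hβp, Real.rpow_neg_one] at h
    have := mul_le_mul_of_nonneg_right h (show 0 ≤ ρ ^ 2 by positivity)
    rwa [mul_assoc, inv_mul_cancel₀ (by positivity), mul_one] at this
  linarith

end LiouvilleLocal

section Harnack

variable {n : ℕ} {lam Lam β p : ℝ}

/-- Nonnegative continuous viscosity solutions of `sup_c ellip c v + v ^ p = 0`. -/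
structure IsSol {n : ℕ} (lam Lam p : ℝ) (Ω : Set (Eucl n)) (v : Eucl n → ℝ) : Prop where
  cont : ContinuousOn v Ω
  nonneg : ∀ x ∈ Ω, 0 ≤ v x
  sub : IsSub (admissible n lam Lam) Ω v (fun x => v x ^ p)
  sup : IsSuper (admissible n lam Lam) Ω v (fun x => v x ^ p)

lemma IsSol.mono {Ω Ω' : Set (Eucl n)} {v : Eucl n → ℝ} (h : IsSol lam Lam p Ω v)
    (hs : Ω' ⊆ Ω) : IsSol lam Lam p Ω' v :=
  ⟨h.cont.mono hs, fun x hx => h.nonneg x (hs hx), h.sub.mono hs, h.sup.mono hs⟩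

lemma IsSol.cont_rpow {Ω : Set (Eucl n)} {v : Eucl n → ℝ} (h : IsSol lam Lam p Ω v)
    (hp : 1 < p) : ContinuousOn (fun x => v x ^ p) Ω :=
  h.cont.rpow_const fun _ _ => Or.inr (by linarith)

/-- Lipschitz bound for a solution bounded by a multiple of its value at the centre. -/
lemma IsSol.lipschitz (hlam : 0 < lam) (hLam : lam ≤ Lam) (hn : 1 ≤ n) (hp : 1 < p)
    {q : Eucl n} {r S M : ℝ} (hr : 0 < r) (hM : 0 ≤ M) (hS : 0 < S) {v : Eucl n → ℝ}
    (hv : IsSol lam Lam p (ball q r) v) (hvM : ∀ x ∈ ball q r, v x ≤ M)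
    (hvS : ∀ x ∈ ball q r, v x ≤ S) {x : Eucl n} (hx : x ∈ ball q (r / 4)) :
    |v x - v q| ≤ S * ((1 + n * Lam / lam) / r + (M ^ (p - 1) + 1) * r / (8 * lam)) *
      ‖x - q‖ := by
  have hM1 : 0 ≤ M ^ (p - 1) := Real.rpow_nonneg hM _
  refine (lipschitz_estimate hlam hLam hn hr hS.le (N := (M ^ (p - 1) + 1) * S) (by positivity)
    hv.cont (hv.cont_rpow hp) hv.sub hv.sup hv.nonneg hvS (fun a ha b hb => ?_) hx).trans
    (le_of_eq (by ring))
  have h1 : v a ^ p ≤ M ^ (p - 1) * S := by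
    have hva := hv.nonneg a ha
    rw [show v a ^ p = v a ^ (p - 1) * v a by
      rw [← Real.rpow_add_one' hva (by linarith), sub_add_cancel]]
    have h3 := Real.rpow_le_rpow hva (hvM a ha) (show 0 ≤ p - 1 by linarith)
    exact mul_le_mul h3 (hvS a ha) hva hM1
  have h2 := Real.rpow_nonneg (hv.nonneg b hb) p
  linarith

/-- Local Harnack inequality for bounded solutions. -/
lemma exists_harnack (hlam : 0 < lam) (hLam : lam ≤ Lam) (hn : 1 ≤ n) (hβ : 0 < β)
    (hγ : lam * (n - 1) ≤ Lam * (2 * β + 1)) (hp : 1 < p) {r M : ℝ} (hr : 0 < r) (hM : 0 ≤ M) :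
    ∃ C > 0, ∀ (x₀ : Eucl n) (v : Eucl n → ℝ), IsSol lam Lam p (ball x₀ r) v →
      (∀ x ∈ ball x₀ r, v x ≤ M) → ∀ x ∈ closedBall x₀ (r / 16), ∀ y ∈ closedBall x₀ (r / 16),
      v y ≤ C * v x := by
  have hLam0 : 0 < Lam := hlam.trans_le hLam
  have hM1 : 0 ≤ M ^ (p - 1) := Real.rpow_nonneg hM _
  set τ : ℝ := 4 ^ (-β) with hτ
  have hτ1 : τ < 1 := Real.rpow_lt_one_of_one_lt_of_neg (by norm_num) (by linarith)
  have hτ0 : 0 < τ := by positivity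
  have hτ1' : 0 < 1 - τ := by linarith
  set C' := (4 : ℝ) ^ β * ((1 + n * Lam / lam) * 2 + (M ^ (p - 1) + 1) * r ^ 2 / (16 * lam)) with hC'
  have hC'0 : 0 < C' := by positivity
  set θ := min (1 / 16) (1 / (2 * C')) with hθ
  have hθ0 : 0 < θ := by positivity
  have hθ1 : θ ≤ 1 / 16 := min_le_left _ _
  have hθC : θ * C' ≤ 1 / 2 := by
    calc θ * C' ≤ 1 / (2 * C') * C' := by gcongr; exact min_le_right _ _
      _ = 1 / 2 := by field_simp
  refine ⟨2 / ((θ ^ 2) ^ β * (1 - τ) * (1 / 16) ^ β), by positivity, fun x₀ v hv hvM x hx y hy => ?_⟩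
  rw [mem_closedBall, dist_eq_norm] at hx hy
  set ρ := r / 8 with hρ
  have hρ0 : 0 < ρ := by positivity
  have hsub : closedBall x₀ ρ ⊆ ball x₀ r := closedBall_subset_ball (by linarith)
  have hΦc : ContinuousOn (fun z => ((ρ - ‖z - x₀‖) ^ 2) ^ β * v z) (closedBall x₀ ρ) := by
    refine ContinuousOn.mul (Continuous.continuousOn ?_) (hv.cont.mono hsub)
    exact Continuous.rpow_const (by fun_prop) fun _ => Or.inr hβ.le
  obtain ⟨q, hq, hmax⟩ := (isCompact_closedBall x₀ ρ).exists_isMaxOn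
    ⟨x₀, mem_closedBall_self hρ0.le⟩ hΦc
  have hmax' := isMaxOn_iff.1 hmax
  have hq' : ‖q - x₀‖ ≤ ρ := by rwa [← dist_eq_norm]
  have hvq0 := hv.nonneg q (hsub hq)
  set d := ρ - ‖q - x₀‖ with hd
  have hd0 : 0 ≤ d := by linarith
  have hdρ : d ≤ ρ := by linarith [norm_nonneg (q - x₀)]
  have hvx := hv.nonneg x (by rw [mem_ball, dist_eq_norm]; linarith)
  have hvy := hv.nonneg y (by rw [mem_ball, dist_eq_norm]; linarith)
  -- comparison of `v y` with the maximum
  have hy1 : (1 / 16 : ℝ) ^ β * ((r ^ 2) ^ β * (1 / 16) ^ β) * v y ≤ (d ^ 2) ^ β * v q := by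
    refine le_trans ?_ (hmax' y (by rw [mem_closedBall, dist_eq_norm]; linarith))
    rw [← Real.mul_rpow (by positivity) (by positivity),
      ← Real.mul_rpow (by positivity) (by positivity)]
    refine mul_le_mul_of_nonneg_right (Real.rpow_le_rpow (by positivity) ?_ hβ.le) hvy
    have : r / 16 ≤ ρ - ‖y - x₀‖ := by linarith
    calc 1 / 16 * (r ^ 2 * (1 / 16)) = (r / 16) ^ 2 := by ring
      _ ≤ _ := by gcongr
  rcases (mul_nonneg (Real.rpow_nonneg (sq_nonneg d) β) hvq0).eq_or_lt with h0 | hpos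
  · rw [← h0] at hy1
    have h1 : 0 < (1 / 16 : ℝ) ^ β * ((r ^ 2) ^ β * (1 / 16) ^ β) := by positivity
    have h2 : v y ≤ 0 := by
      by_contra! h
      exact absurd hy1 (not_le.2 (mul_pos h1 h))
    refine h2.trans ?_
    positivity
  have hd0' : 0 < d := by
    refine hd0.lt_of_ne fun h => ?_
    rw [← h, zero_pow two_ne_zero, Real.zero_rpow hβ.ne', zero_mul] at hpos
    exact lt_irrefl _ hpos
  have hvq : 0 < v q := pos_of_mul_pos_right hpos (by positivity)
  have hbq : ball q (d / 2) ⊆ ball x₀ r := by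
    refine ball_subset_ball' ?_
    rw [dist_eq_norm]; linarith
  have hS : ∀ z ∈ ball q (d / 2), v z ≤ 4 ^ β * v q := by
    intro z hz
    rw [mem_ball, dist_eq_norm] at hz
    have hz1 : ‖z - x₀‖ ≤ ‖z - q‖ + ‖q - x₀‖ := norm_sub_le_norm_sub_add_norm_sub _ _ _
    have h1 := hmax' z (by rw [mem_closedBall, dist_eq_norm]; linarith)
    have h2 : (d / 2) ^ 2 ≤ (ρ - ‖z - x₀‖) ^ 2 := by
      have : d / 2 ≤ ρ - ‖z - x₀‖ := by linarith
      gcongr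
    have h3 := Real.rpow_le_rpow (by positivity) h2 hβ.le
    have h4 : (d ^ 2) ^ β = 4 ^ β * ((d / 2) ^ 2) ^ β := by
      rw [← Real.mul_rpow (by positivity) (by positivity)]; congr 1; ring
    have h5 : 0 < ((d / 2) ^ 2) ^ β := by positivity
    have hvz := hv.nonneg z (hbq (by rwa [mem_ball, dist_eq_norm]))
    rw [h4] at h1
    have h6 : ((d / 2) ^ 2) ^ β * v z ≤ ((d / 2) ^ 2) ^ β * (4 ^ β * v q) := by
      calc _ ≤ ((ρ - ‖z - x₀‖) ^ 2) ^ β * v z := by gcongr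
        _ ≤ _ := h1
        _ = _ := by ring
    exact le_of_mul_le_mul_left h6 h5
  have hhalf : ∀ z, ‖z - q‖ ≤ θ * d → v q / 2 ≤ v z := by
    intro z hz
    have h1 := (hv.mono hbq).lipschitz hlam hLam hn hp (half_pos hd0') hM (by positivity)
      (fun a ha => hvM a (hbq ha)) hS (x := z) (by
        rw [mem_ball, dist_eq_norm]
        have : θ * d ≤ 1 / 16 * d := by gcongr
        linarith)
    have h2 : 4 ^ β * v q * ((1 + n * Lam / lam) / (d / 2) +
        (M ^ (p - 1) + 1) * (d / 2) / (8 * lam)) * ‖z - q‖ ≤ v q / 2 := by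
      have hdr : d ≤ r := by linarith
      calc _ ≤ 4 ^ β * v q * ((1 + n * Lam / lam) / (d / 2) +
            (M ^ (p - 1) + 1) * (d / 2) / (8 * lam)) * (θ * d) := by gcongr
        _ = v q * θ * (4 ^ β * ((1 + n * Lam / lam) * 2 +
            (M ^ (p - 1) + 1) * d ^ 2 / (16 * lam))) := by field_simp; ring
        _ ≤ v q * θ * C' := by rw [hC']; gcongr
        _ = v q * (θ * C') := by ring
        _ ≤ v q * (1 / 2) := by gcongr
        _ = v q / 2 := by ring
    have h3 := (abs_le.1 (h1.trans h2)).1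
    linarith
  have hlow : (v q / 2) * ((θ ^ 2) ^ β * (d ^ 2) ^ β) * (1 - τ) * ((r ^ 2) ^ β * (1 / 16) ^ β)⁻¹
      ≤ v x := by
    have hxq : ‖x - q‖ ≤ r / 4 := by
      have := norm_sub_le_norm_sub_add_norm_sub x x₀ q
      rw [norm_sub_rev x₀ q] at this
      linarith
    have hθd : θ * d ≤ r / 4 := by nlinarith
    rw [← Real.mul_rpow (by positivity) (by positivity), ← mul_pow,
      ← Real.mul_rpow (by positivity) (by positivity), ← Real.rpow_neg (by positivity),
      show r ^ 2 * (1 / 16) = (r / 4) ^ 2 by ring]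
    rcases le_total ‖x - q‖ (θ * d) with h | h
    · refine le_trans ?_ (hhalf x h)
      have h1 : ((θ * d) ^ 2) ^ β * ((r / 4) ^ 2) ^ (-β) ≤ 1 := by
        rw [Real.rpow_neg (by positivity), ← div_eq_mul_inv, div_le_one (by positivity)]
        exact Real.rpow_le_rpow (by positivity) (by gcongr) hβ.le
      calc _ = v q / 2 * ((1 - τ) * (((θ * d) ^ 2) ^ β * ((r / 4) ^ 2) ^ (-β))) := by ring
        _ ≤ v q / 2 * 1 := by
          gcongr
          exact mul_le_one₀ (by linarith) (by positivity) h1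
        _ = v q / 2 := mul_one _
    · have hbr : closedBall q (r / 2) ⊆ ball x₀ r := by
        intro z hz
        rw [mem_closedBall, dist_eq_norm] at hz
        rw [mem_ball, dist_eq_norm]
        have := norm_sub_le_norm_sub_add_norm_sub z q x₀
        linarith
      refine le_trans ?_ ((hv.sup.mono (ball_subset_closedBall.trans hbr)).lower_bound hlam hLam hn hβ hγ
        (y := q) (ρ := θ * d) (R := r / 2) (m := v q / 2) (by positivity) (by positivity)
        (hv.cont.mono hbr)
        (fun z hz => Real.rpow_nonneg (hv.nonneg z (hbr (ball_subset_closedBall hz))) _)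
        (fun z hz => hv.nonneg z (hbr hz)) (fun z hz => hhalf z hz.le) h (by linarith))
      have hx0 : 0 < ‖x - q‖ := lt_of_lt_of_le (by positivity) h
      have : ((r / 4) ^ 2) ^ (-β) ≤ (‖x - q‖ ^ 2) ^ (-β) :=
        Real.rpow_le_rpow_of_nonpos (by positivity) (by gcongr) (by linarith)
      gcongr
  rw [div_mul_eq_mul_div, le_div_iff₀ (by positivity)]
  have hA : 0 < (r ^ 2) ^ β * (1 / 16 : ℝ) ^ β := by positivity
  set A := (r ^ 2) ^ β * (1 / 16 : ℝ) ^ β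
  have hτθ : 0 < (θ ^ 2) ^ β * (1 - τ) := by positivity
  set κ := (θ ^ 2) ^ β * (1 - τ)
  have h1 : κ / 2 * ((d ^ 2) ^ β * v q) ≤ v x * A := by
    rw [show v q / 2 * ((θ ^ 2) ^ β * (d ^ 2) ^ β) * (1 - τ) * A⁻¹ =
      κ / 2 * ((d ^ 2) ^ β * v q) / A by simp only [κ]; ring, div_le_iff₀ hA] at hlow
    exact hlow
  have h2 := mul_le_mul_of_nonneg_left hy1 (show 0 ≤ κ / 2 by positivity)
  have h3 : (κ / 2 * ((1 / 16) ^ β * v y)) * A ≤ v x * A := by linarith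
  have := le_of_mul_le_mul_right h3 hA
  linarith

end Harnack

section Chain

variable {n : ℕ} {lam Lam β p : ℝ}

/-- The open half space with inner normal `e`. -/
def halfSpace {n : ℕ} (e : Eucl n) : Set (Eucl n) := {x | 0 < ⟪e, x⟫}

lemma isOpen_halfSpace (e : Eucl n) : IsOpen (halfSpace e) :=
  isOpen_lt continuous_const (by fun_prop)

lemma inner_sub_le_dist {e : Eucl n} (he : ‖e‖ = 1) (x y : Eucl n) : ⟪e, x⟫ - ⟪e, y⟫ ≤ ‖x - y‖ := by
  rw [← inner_sub_right]
  simpa [he] using real_inner_le_norm e (x - y)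

lemma ball_subset_halfSpace {e : Eucl n} (he : ‖e‖ = 1) {x : Eucl n} {T : ℝ} (hx : T ≤ ⟪e, x⟫) :
    ball x T ⊆ halfSpace e := by
  intro y hy
  rw [mem_ball, dist_eq_norm, norm_sub_rev] at hy
  have := inner_sub_le_dist he x y
  change 0 < ⟪e, y⟫
  linarith

/-- Harnack inequality along chains of balls in the half space. -/
lemma exists_chain_harnack (hlam : 0 < lam) (hLam : lam ≤ Lam) (hn : 1 ≤ n) (hβ : 0 < β)
    (hγ : lam * (n - 1) ≤ Lam * (2 * β + 1)) (hp : 1 < p) {T M : ℝ} (hT : 0 < T) (hM : 0 ≤ M)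
    (L : ℝ) {e : Eucl n} (he : ‖e‖ = 1) :
    ∃ C > 0, ∀ v : Eucl n → ℝ, IsSol lam Lam p (halfSpace e) v → (∀ x ∈ halfSpace e, v x ≤ M) →
      ∀ x y, T ≤ ⟪e, x⟫ → T ≤ ⟪e, y⟫ → ‖x - y‖ ≤ L → v y ≤ C * v x := by
  obtain ⟨C, hC, h⟩ := exists_harnack (n := n) hlam hLam hn hβ hγ hp hT hM
  obtain ⟨k, hk⟩ := exists_nat_ge (L / (T / 16))
  rw [div_le_iff₀ (by positivity)] at hk
  refine ⟨C ^ k, by positivity, fun v hv hvM x y hx hy hxy => ?_⟩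
  replace hxy := hxy.trans hk
  clear hk
  induction k generalizing y with
  | zero =>
    have : x - y = 0 := by simpa using hxy
    rw [sub_eq_zero.1 this]; simp
  | succ k ih =>
    push_cast at hxy
    have hk1 : (0 : ℝ) < k + 1 := by positivity
    set s : ℝ := 1 / (k + 1) with hs
    have hs0 : 0 < s := by positivity
    have hsk : s * (k + 1) = 1 := by rw [hs]; field_simp
    have hs1 : s ≤ 1 := by rw [hs, div_le_one hk1]; linarith [Nat.cast_nonneg (α := ℝ) k]
    set z := y + s • (x - y) with hz
    have hzT : T ≤ ⟪e, z⟫ := by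
      rw [hz, inner_add_right, inner_smul_right, inner_sub_right]
      nlinarith
    have hzy : ‖z - y‖ ≤ T / 16 := by
      rw [hz, add_sub_cancel_left, norm_smul, Real.norm_of_nonneg hs0.le]
      calc s * ‖x - y‖ ≤ s * ((k + 1) * (T / 16)) := by gcongr
        _ = T / 16 := by rw [← mul_assoc, hsk, one_mul]
    have hxz : ‖x - z‖ ≤ k * (T / 16) := by
      have e1 : x - z = (1 - s) • (x - y) := by rw [hz]; module
      rw [e1, norm_smul, Real.norm_of_nonneg (by linarith)]
      calc (1 - s) * ‖x - y‖ ≤ (1 - s) * ((k + 1) * (T / 16)) := by gcongr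
        _ = (k + 1 - s * (k + 1)) * (T / 16) := by ring
        _ = k * (T / 16) := by rw [hsk]; ring
    have h1 := ih z hzT hxz
    have hb := ball_subset_halfSpace he hzT
    have h2 := h z v (hv.mono hb) (fun a ha => hvM a (hb ha)) z
      (mem_closedBall_self (by positivity)) y (by rwa [mem_closedBall, dist_eq_norm, norm_sub_rev])
    calc v y ≤ C * v z := h2
      _ ≤ C * (C ^ k * v x) := by gcongr
      _ = C ^ (k + 1) * v x := by ring

/-- Lipschitz bound relative to the value of the solution. -/
lemma exists_relative_lipschitz (hlam : 0 < lam) (hLam : lam ≤ Lam) (hn : 1 ≤ n) (hβ : 0 < β)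
    (hγ : lam * (n - 1) ≤ Lam * (2 * β + 1)) (hp : 1 < p) {T M : ℝ} (hT : 0 < T) (hM : 0 ≤ M)
    {e : Eucl n} (he : ‖e‖ = 1) :
    ∃ C > 0, ∀ v : Eucl n → ℝ, IsSol lam Lam p (halfSpace e) v → (∀ x ∈ halfSpace e, v x ≤ M) →
      ∀ a x, T ≤ ⟪e, a⟫ → ‖x - a‖ < T / 64 → |v x - v a| ≤ C * ‖x - a‖ * v a := by
  obtain ⟨C, hC, h⟩ := exists_harnack (n := n) hlam hLam hn hβ hγ hp hT hM
  have hM1 : 0 ≤ M ^ (p - 1) := Real.rpow_nonneg hM _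
  have hLam0 : 0 < Lam := hlam.trans_le hLam
  refine ⟨C * ((1 + n * Lam / lam) / (T / 16) + (M ^ (p - 1) + 1) * (T / 16) / (8 * lam)),
    by positivity, fun v hv hvM a x ha hx => ?_⟩
  have hb := ball_subset_halfSpace he ha
  have hb' : ball a (T / 16) ⊆ ball a T := ball_subset_ball (by linarith)
  have hS : ∀ y ∈ ball a (T / 16), v y ≤ C * v a := fun y hy =>
    h a v (hv.mono hb) (fun z hz => hvM z (hb hz)) a (mem_closedBall_self (by positivity)) y
      (ball_subset_closedBall hy)
  have hva := hv.nonneg a (hb (mem_ball_self hT))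
  have hxb : x ∈ ball a (T / 16) := by rw [mem_ball, dist_eq_norm]; linarith
  rcases hva.eq_or_lt with h0 | h0
  · have h1 := hS x hxb
    have h2 := hv.nonneg x (hb (hb' hxb))
    rw [← h0, mul_zero] at h1
    rw [← h0, le_antisymm h1 h2]; simp
  · refine ((hv.mono (hb'.trans hb)).lipschitz hlam hLam hn hp (by positivity) hM
      (mul_pos hC h0) (fun z hz => hvM z (hb (hb' hz))) hS (x := x) ?_).trans (le_of_eq (by ring))
    rw [mem_ball, dist_eq_norm]; linarith

end Chain

section Mirror

variable {n : ℕ} {lam Lam β p M : ℝ}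

/-- The reflection across the hyperplane `⟪e, z⟫ = t`. -/
noncomputable def mirror (e : Eucl n) (t : ℝ) (z : Eucl n) : Eucl n := z + (2 * (t - ⟪e, z⟫)) • e

lemma inner_mirror {e : Eucl n} (he : ‖e‖ = 1) (t : ℝ) (z : Eucl n) :
    ⟪e, mirror e t z⟫ = 2 * t - ⟪e, z⟫ := by
  rw [mirror, inner_add_right, inner_smul_right, real_inner_self_eq_norm_sq, he]; ring

lemma mirror_eq_reflect {e m : Eucl n} {t : ℝ} (hm : ⟪e, m⟫ = t) :
    mirror e t = reflect e m := by
  funext z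
  rw [mirror, reflect, inner_sub_right, hm]
  module

lemma mirror_of_inner_eq {e z : Eucl n} {t : ℝ} (h : ⟪e, z⟫ = t) : mirror e t z = z := by
  simp [mirror, h]

lemma continuous_mirror (e : Eucl n) (t : ℝ) : Continuous (mirror e t) := by
  unfold mirror; fun_prop

lemma rpow_sub_rpow_le (hp : 1 < p) {a b : ℝ} (hb : 0 ≤ b) (hab : b < a) (haM : a ≤ M) :
    a ^ p - b ^ p ≤ p * M ^ (p - 1) * (a - b) := by
  have ha : 0 < a := hb.trans_lt hab
  have h1 := one_add_mul_self_le_rpow_one_add (s := b / a - 1)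
    (by linarith [show 0 ≤ b / a by positivity]) hp.le
  rw [add_sub_cancel, Real.div_rpow hb ha.le, le_div_iff₀ (by positivity)] at h1
  have h2 : a ^ p = a ^ (p - 1) * a := by
    rw [← Real.rpow_add_one' ha.le (by linarith), sub_add_cancel]
  have h3 : (1 + p * (b / a - 1)) * a ^ p = a ^ p - p * a ^ (p - 1) * (a - b) := by
    rw [h2]; field_simp; ring
  have h4 : a ^ (p - 1) ≤ M ^ (p - 1) := Real.rpow_le_rpow ha.le haM (by linarith)
  have h5 : p * a ^ (p - 1) * (a - b) ≤ p * M ^ (p - 1) * (a - b) := by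
    have : 0 ≤ a - b := by linarith
    gcongr
  linarith

/-- Bounded nonnegative solutions in a half space vanishing on the boundary. -/
structure IsBddSol {n : ℕ} (lam Lam p M : ℝ) (e : Eucl n) (v : Eucl n → ℝ) : Prop where
  sol : IsSol lam Lam p (halfSpace e) v
  cont : ContinuousOn v {x | 0 ≤ ⟪e, x⟫}
  zero : ∀ x, ⟪e, x⟫ = 0 → v x = 0
  le : ∀ x ∈ halfSpace e, v x ≤ M

lemma IsBddSol.nonneg {e : Eucl n} {v : Eucl n → ℝ} (h : IsBddSol lam Lam p M e v) {x : Eucl n}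
    (hx : 0 ≤ ⟪e, x⟫) : 0 ≤ v x := by
  rcases hx.eq_or_lt with h0 | h0
  · exact (h.zero x h0.symm).ge
  · exact h.sol.nonneg x h0

lemma IsBddSol.le' {e : Eucl n} {v : Eucl n → ℝ} (h : IsBddSol lam Lam p M e v) (hM : 0 ≤ M)
    {x : Eucl n} (hx : 0 ≤ ⟪e, x⟫) : v x ≤ M := by
  rcases hx.eq_or_lt with h0 | h0
  · rw [h.zero x h0.symm]; exact hM
  · exact h.le x h0

lemma IsBddSol.continuousOn_sub_mirror {e : Eucl n} (he : ‖e‖ = 1) {v : Eucl n → ℝ}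
    (h : IsBddSol lam Lam p M e v) (t : ℝ) :
    ContinuousOn (fun z => v z - v (mirror e t z)) {x | 0 ≤ ⟪e, x⟫ ∧ ⟪e, x⟫ ≤ 2 * t} := by
  refine (h.cont.mono fun x hx => hx.1).sub
    (h.cont.comp (continuous_mirror e t).continuousOn fun x hx => ?_)
  have := hx.2
  change 0 ≤ ⟪e, mirror e t x⟫
  rw [inner_mirror he]; linarith

lemma IsBddSol.isSub_sub_mirror (hlam : 0 < lam) (hLam : lam ≤ Lam) (hn : 1 ≤ n) (hp : 1 < p)
    {e : Eucl n} (he : ‖e‖ = 1) {v : Eucl n → ℝ} (h : IsBddSol lam Lam p M e v) {t : ℝ}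
    {Ω : Set (Eucl n)} (hΩ : IsOpen Ω) (h1 : ∀ x ∈ Ω, 0 < ⟪e, x⟫) (h2 : ∀ x ∈ Ω, ⟪e, x⟫ < 2 * t) :
    IsSub (admissible n lam Lam) Ω (fun z => v z - v (mirror e t z))
      (fun z => v z ^ p - v (mirror e t z) ^ p) := by
  have hm : ⟪e, t • e⟫ = t := by simp [inner_smul_right, he]
  rw [mirror_eq_reflect hm]
  refine IsSub.sub_reflect hlam hLam hn hΩ h.sol.cont (h.sol.cont_rpow hp) h.sol.sub h.sol.sup he
    h1 fun z hz => ?_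
  change 0 < ⟪e, reflect e (t • e) z⟫
  rw [← mirror_eq_reflect hm, inner_mirror he]
  linarith [h2 z hz]

/-- Maximum principle in narrow strips. -/
lemma exists_narrow (hlam : 0 < lam) (hLam : lam ≤ Lam) (hn : 1 ≤ n) (hp : 1 < p) (hM : 0 ≤ M) :
    ∃ h₀ > 0, ∀ (e : Eucl n) (v : Eucl n → ℝ), ‖e‖ = 1 → IsBddSol lam Lam p M e v →
      ∀ t a b : ℝ, 0 ≤ a → b ≤ t → b - a ≤ h₀ →
      (∀ x, ⟪e, x⟫ = a → v x ≤ v (mirror e t x)) → (∀ x, ⟪e, x⟫ = b → v x ≤ v (mirror e t x)) →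
      ∀ x, a ≤ ⟪e, x⟫ → ⟪e, x⟫ ≤ b → v x ≤ v (mirror e t x) := by
  have hM1 : 0 ≤ M ^ (p - 1) := Real.rpow_nonneg hM _
  have hLam0 : 0 < Lam := hlam.trans_le hLam
  set B := (2 * n * Lam + p * M ^ (p - 1) + 1) / (2 * lam) with hB
  have hB0 : 0 ≤ B := by positivity
  refine ⟨min 1 (1 / (2 * (1 + B))), by positivity, fun e v he hv t a b ha hbt hab h1 h2 x₁ h3 h4 => ?_⟩
  have hab1 : b - a ≤ 1 := hab.trans (min_le_left _ _)
  have hab2 : (b - a) * (1 + B) ≤ 1 / 2 := by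
    calc (b - a) * (1 + B) ≤ 1 / (2 * (1 + B)) * (1 + B) := by
          gcongr; exact hab.trans (min_le_right _ _)
      _ = 1 / 2 := by field_simp
  set W : Eucl n → ℝ := fun z => v z - v (mirror e t z) with hW
  by_contra! hcon
  set A : Set (Eucl n) := {x | a ≤ ⟪e, x⟫ ∧ ⟪e, x⟫ ≤ b} with hA
  have hAn : ∀ x ∈ A, 0 ≤ ⟪e, x⟫ ∧ 0 ≤ ⟪e, mirror e t x⟫ := by
    rintro x ⟨ha', hb'⟩
    rw [inner_mirror he]
    constructor <;> linarith
  have hbdd : BddAbove (W '' A) := by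
    refine ⟨M, ?_⟩
    rintro _ ⟨x, hx, rfl⟩
    have := hv.le' hM (hAn x hx).1
    have := hv.nonneg (hAn x hx).2
    simp only [hW]; linarith
  set S := sSup (W '' A) with hS
  have hWS : ∀ x ∈ A, W x ≤ S := fun x hx => le_csSup hbdd (mem_image_of_mem _ hx)
  have hS0 : 0 < S := lt_of_lt_of_le (by simp only [hW]; linarith) (hWS x₁ ⟨h3, h4⟩)
  obtain ⟨_, ⟨x₀, hx₀, rfl⟩, hx₀S⟩ := exists_lt_of_lt_csSup ((nonempty_of_mem (show x₁ ∈ A from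
    ⟨h3, h4⟩)).image W) (show S / 2 < S by linarith)
  set m := x₀ - (⟪e, x₀⟫ - a) • e with hm
  have hin : ∀ z, ⟪e, z - m⟫ = ⟪e, z⟫ - a := by
    intro z
    rw [hm, inner_sub_right, inner_sub_right, inner_smul_right, real_inner_self_eq_norm_sq, he]
    ring
  have hx₀m : ‖x₀ - m‖ = ⟪e, x₀⟫ - a := by
    rw [hm, sub_sub_cancel, norm_smul, he, mul_one, Real.norm_of_nonneg (by linarith [hx₀.1])]
  have hmem : ∀ {x}, 0 ≤ ⟪e, x - m⟫ → ⟪e, x - m⟫ ≤ b - a → x ∈ A := by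
    intro x hx hx'
    rw [hin] at hx hx'
    constructor <;> linarith
  have hcs : Continuous fun x : Eucl n => ⟪e, x - m⟫ := by fun_prop
  have hopen : IsOpen {x | x ∈ ball m 1 ∧ 0 < ⟪e, x - m⟫ ∧ ⟪e, x - m⟫ < b - a} :=
    isOpen_ball.inter ((isOpen_lt continuous_const hcs).inter
      (isOpen_lt hcs continuous_const))
  have key := IsSub.slab_barrier hlam hLam (m := m) (ν := e) he one_pos (h := b - a) hS0.le
    (N := p * M ^ (p - 1) * S + S) (by positivity) (W := W)
    (F := fun z => v z ^ p - v (mirror e t z) ^ p)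
    ((hv.continuousOn_sub_mirror he t).mono fun x hx => by
      have h5 := hmem hx.2.1 hx.2.2
      exact ⟨by linarith [h5.1], by linarith [h5.2, h5.1]⟩)
    (hv.isSub_sub_mirror hlam hLam hn hp he hopen (fun x hx => by
      have := hx.2.1; rw [hin] at this; linarith) (fun x hx => by
      have := hx.2.2; have := hx.2.1; simp only [hin] at *; linarith))
    (fun x hx h5 h6 h7 => by
      have hxA := hmem h5.le h6.le
      have h8 := rpow_sub_rpow_le (M := M) hp (hv.nonneg (hAn x hxA).2) (show v (mirror e t x) < v x by
        simp only [hW] at h7; linarith) (hv.le' hM (hAn x hxA).1)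
      have h9 : p * M ^ (p - 1) * (v x - v (mirror e t x)) ≤ p * M ^ (p - 1) * S := by
        gcongr; exact hWS x hxA
      linarith)
    (fun x _ h5 h6 => hWS x (hmem h5 h6))
    (fun x _ h5 => by
      have := h1 x (by rw [hin] at h5; linarith)
      simp only [hW]; linarith)
    (fun x _ h5 => by
      have := h2 x (by rw [hin] at h5; linarith)
      simp only [hW]; linarith)
    x₀ (by rw [mem_closedBall, dist_eq_norm, hx₀m]; linarith [hx₀.2])
    (by rw [hin]; linarith [hx₀.1]) (by rw [hin]; linarith [hx₀.2])
  rw [hx₀m, hin] at key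
  set s := ⟪e, x₀⟫ - a
  set h := b - a
  have hs0 : 0 ≤ s := by simp only [s]; linarith [hx₀.1]
  have hsh : s ≤ h := by simp only [s, h]; linarith [hx₀.2]
  have h10 : (2 * n * Lam * (S / 1 ^ 2) + (p * M ^ (p - 1) * S + S)) / (2 * lam) = S * B := by
    rw [hB]; ring
  rw [h10] at key
  have h11 : h * s - s ^ 2 ≤ h := by nlinarith
  have h12 : s ^ 2 ≤ h := by nlinarith
  have h13 : S * B * (h * s - s ^ 2) ≤ S * B * h := by gcongr
  have h14 : S / 1 ^ 2 * s ^ 2 ≤ S * h := by rw [one_pow, div_one]; gcongr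
  have h15 : S * (h * (1 + B)) ≤ S * (1 / 2) := by gcongr
  linarith

end Mirror

section MovingPlane

variable {n : ℕ} {lam Lam β p M : ℝ}

/-- The quantitative Hopf lemma on the reflection hyperplane. -/
lemma IsBddSol.exists_hopf (hlam : 0 < lam) (hLam : lam ≤ Lam) (hn : 1 ≤ n) (hβ : 0 < β)
    (hγ : lam * (n - 1) ≤ Lam * (2 * β + 1)) (hp : 1 < p) (hM : 0 ≤ M) {e : Eucl n}
    (he : ‖e‖ = 1) {v : Eucl n → ℝ} (hv : IsBddSol lam Lam p M e v) {T : ℝ} (hT : 0 < T)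
    (hP : ∀ x, 0 ≤ ⟪e, x⟫ → ⟪e, x⟫ ≤ T → v x ≤ v (mirror e T x)) :
    ∃ c > 0, ∀ x, 0 ≤ ⟪e, x⟫ → ⟪e, x⟫ ≤ T →
      c * (T - ⟪e, x⟫) * v (x + (T - ⟪e, x⟫) • e) ≤ v (mirror e T x) - v x := by
  have hLam0 : 0 < Lam := hlam.trans_le hLam
  have hn0 : (1 : ℝ) ≤ n := by exact_mod_cast hn
  set d := 1 / (2 * T ^ 2) with hd
  set a := d * lam / (2 * n * Lam) with ha
  set b := 1 / (2 * T) with hb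
  have hd0 : 0 < d := by positivity
  have ha0 : 0 < a := by positivity
  have hb0 : 0 < b := by positivity
  have hadl : 2 * a * (n * Lam) = d * lam := by rw [ha]; field_simp
  have had : a ≤ d := by
    have h1 : lam ≤ 2 * n * Lam := by nlinarith
    rw [ha, div_le_iff₀ (by positivity)]; gcongr
  have hbdT : b * T + d * T ^ 2 = 1 := by rw [hb, hd]; field_simp; norm_num
  have hdT : d * T ^ 2 = 1 / 2 := by rw [hd]; field_simp
  set ℓ := √(1 / a) with hℓ
  have hℓ0 : 0 < ℓ := by positivity
  have hℓ2 : a * ℓ ^ 2 = 1 := by rw [hℓ, Real.sq_sqrt (by positivity)]; field_simp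
  have hTℓ : T ≤ ℓ := by
    have h1 : a * T ^ 2 ≤ a * ℓ ^ 2 := by
      have : a * T ^ 2 ≤ d * T ^ 2 := by gcongr
      linarith
    exact le_of_sq_le_sq (le_of_mul_le_mul_left h1 ha0) hℓ0.le
  obtain ⟨C, hC, hchain⟩ := exists_chain_harnack (n := n) hlam hLam hn hβ hγ hp hT hM ℓ he
  refine ⟨b / C, by positivity, fun x hx0 hxT => ?_⟩
  set s := T - ⟪e, x⟫ with hs
  set m := x + s • e with hm
  have hmT : ⟪e, m⟫ = T := by
    rw [hm, inner_add_right, inner_smul_right, real_inner_self_eq_norm_sq, he, hs]; ring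
  have hxm : ‖x - m‖ = s := by
    rw [hm, sub_add_cancel_left, norm_neg, norm_smul, he, mul_one,
      Real.norm_of_nonneg (by linarith)]
  have hPx := hP x hx0 hxT
  rcases (hv.nonneg (x := m) (by rw [hmT]; exact hT.le)).eq_or_lt with h0 | hvm
  · rw [← h0]; simpa using hPx
  set κ := v m / C with hκ
  have hκ0 : 0 < κ := by positivity
  have hν : ‖-e‖ = 1 := by rw [norm_neg, he]
  have hin : ∀ y, ⟪-e, y - m⟫ = T - ⟪e, y⟫ := by
    intro y; rw [inner_neg_left, inner_sub_right, hmT]; ring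
  have hcs : Continuous fun x : Eucl n => ⟪e, x⟫ := by fun_prop
  have hKc : IsCompact {y | y ∈ closedBall m ℓ ∧ 0 ≤ ⟪e, y⟫ ∧ ⟪e, y⟫ ≤ T} :=
    (isCompact_closedBall m ℓ).inter_right
      ((isClosed_le continuous_const hcs).inter (isClosed_le hcs continuous_const))
  have hD : IsOpen {y | y ∈ ball m ℓ ∧ 0 < ⟪e, y⟫ ∧ ⟪e, y⟫ < T} :=
    isOpen_ball.inter ((isOpen_lt continuous_const hcs).inter (isOpen_lt hcs continuous_const))
  have hψ := contDiff_quad m (-e) (κ * a) (-(κ * b)) (κ * d)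
  have hsub := hv.isSub_sub_mirror hlam hLam hn hp he (t := T) hD (fun y hy => hy.2.1)
    (fun y hy => by linarith [hy.2.2])
  have key := hsub.le_of_strict hKc hD
    (fun y hy => ⟨ball_subset_closedBall hy.1, hy.2.1.le, hy.2.2.le⟩)
    ((hv.continuousOn_sub_mirror he T).mono fun y hy => ⟨hy.2.1, by linarith [hy.2.2]⟩)
    hψ.continuous.continuousOn (fun y _ => hψ.contDiffAt) ?_ ?_ x
    ⟨by rw [mem_closedBall, dist_eq_norm, hxm]; linarith, hx0, hxT⟩
  · simp only [hin, hxm] at key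
    rw [← hs] at key
    have h1 : κ * a * s ^ 2 ≤ κ * d * s ^ 2 := by gcongr
    have h2 : b / C * s * v m = κ * b * s := by rw [hκ]; ring
    linarith
  · rintro y ⟨hy, hy0, hyT⟩ hyD
    rw [hin]
    have hy' : ‖y - m‖ ≤ ℓ := by rwa [← dist_eq_norm]
    set σ := T - ⟪e, y⟫ with hσ
    have hσ0 : 0 ≤ σ := by linarith
    have hσT : σ ≤ T := by linarith
    have hann : 0 ≤ κ * a * ‖y - m‖ ^ 2 := by positivity
    have hW := hP y hy0 hyT
    have hbds : κ * b * σ + κ * d * σ ^ 2 ≤ κ := by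
      calc κ * b * σ + κ * d * σ ^ 2 ≤ κ * b * T + κ * d * T ^ 2 := by gcongr
        _ = κ * (b * T + d * T ^ 2) := by ring
        _ = κ := by rw [hbdT, mul_one]
    by_cases hyb : y ∈ ball m ℓ
    · rcases hy0.eq_or_lt with h1 | h1
      · have h2 : ⟪e, mirror e T y⟫ = 2 * T := by rw [inner_mirror he, ← h1]; ring
        have h3 := hchain v hv.sol hv.le (mirror e T y) m (by rw [h2]; linarith) hmT.ge
          (by rw [mirror_eq_reflect hmT, norm_reflect_sub he]; exact hy')
        have h4 : κ ≤ v (mirror e T y) := by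
          rw [hκ, div_le_iff₀ hC]; linarith
        rw [hv.zero y h1.symm]
        linarith
      · rcases hyT.eq_or_lt with h2 | h2
        · have : σ = 0 := by rw [hσ, h2]; ring
          rw [this]; nlinarith
        · exact absurd ⟨hyb, h1, h2⟩ hyD
    · have h1 : ‖y - m‖ = ℓ := by
        refine le_antisymm hy' ?_
        rw [mem_ball, dist_eq_norm, not_lt] at hyb
        exact hyb
      have h2 : κ * a * ‖y - m‖ ^ 2 = κ := by rw [h1, mul_assoc, hℓ2, mul_one]
      linarith
  · rintro y ⟨hy, hy0, hyT⟩ -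
    refine ⟨κ * (d * lam), by positivity, fun c hc => ?_⟩
    have h1 := ellip_quad_le hc (m := m) hν (show 0 ≤ κ * a by positivity)
      (show 0 ≤ κ * d by positivity) (-(κ * b)) y
    have h2 : v y ^ p ≤ v (mirror e T y) ^ p :=
      Real.rpow_le_rpow (hv.nonneg hy0.le) (hP y hy0.le hyT.le) (by linarith)
    have h3 : 2 * (κ * a) * (n * Lam) = κ * (d * lam) := by rw [← hadl]; ring
    linarith

/-- Moving the plane a little further. -/
lemma IsBddSol.exists_mirror_le_add (hlam : 0 < lam) (hLam : lam ≤ Lam) (hn : 1 ≤ n) (hβ : 0 < β)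
    (hγ : lam * (n - 1) ≤ Lam * (2 * β + 1)) (hp : 1 < p) (hM : 0 ≤ M) {e : Eucl n}
    (he : ‖e‖ = 1) {v : Eucl n → ℝ} (hv : IsBddSol lam Lam p M e v) {T : ℝ} (hT : 0 < T)
    (hP : ∀ x, 0 ≤ ⟪e, x⟫ → ⟪e, x⟫ ≤ T → v x ≤ v (mirror e T x)) :
    ∃ ε₀ > 0, ∀ ε, 0 ≤ ε → ε ≤ ε₀ → ∀ x, 0 ≤ ⟪e, x⟫ → ⟪e, x⟫ ≤ T + ε →
      v x ≤ v (mirror e (T + ε) x) := by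
  obtain ⟨c, hc, hhopf⟩ := hv.exists_hopf hlam hLam hn hβ hγ hp hM he hT hP
  obtain ⟨C₁, hC₁, hchain⟩ := exists_chain_harnack (n := n) hlam hLam hn hβ hγ hp hT hM T he
  obtain ⟨C₂, hC₂, hlip⟩ := exists_relative_lipschitz (n := n) hlam hLam hn hβ hγ hp hT hM he
  obtain ⟨h₀, hh₀, hnarrow⟩ := exists_narrow (n := n) hlam hLam hn hp hM
  set C := 2 * C₁ * C₂ / c with hC
  have hC0 : 0 < C := by positivity
  refine ⟨min (T / 256) (min (T / C) (h₀ / (C + 1))), by positivity, fun ε hε hε₀ => ?_⟩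
  have h1 : ε ≤ T / 256 := hε₀.trans (min_le_left _ _)
  have h2 : C * ε ≤ T := by
    rw [← le_div_iff₀' hC0]; exact hε₀.trans ((min_le_right _ _).trans (min_le_left _ _))
  have h3 : (C + 1) * ε ≤ h₀ := by
    rw [← le_div_iff₀' (by positivity)]
    exact hε₀.trans ((min_le_right _ _).trans (min_le_right _ _))
  have hfar : ∀ x, 0 ≤ ⟪e, x⟫ → ⟪e, x⟫ ≤ T - C * ε → v x ≤ v (mirror e (T + ε) x) := by
    intro x hx0 hx
    have hxT : ⟪e, x⟫ ≤ T := by have : 0 ≤ C * ε := by positivity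
                                linarith
    have h4 := hhopf x hx0 hxT
    set m := x + (T - ⟪e, x⟫) • e with hm
    have hmT : ⟪e, m⟫ = T := by
      rw [hm, inner_add_right, inner_smul_right, real_inner_self_eq_norm_sq, he]; ring
    have hxm : ‖x - m‖ = T - ⟪e, x⟫ := by
      rw [hm, sub_add_cancel_left, norm_neg, norm_smul, he, mul_one,
        Real.norm_of_nonneg (by linarith)]
    have h5 : T ≤ ⟪e, mirror e T x⟫ := by rw [inner_mirror he]; linarith
    have h6 : v (mirror e T x) ≤ C₁ * v m := hchain v hv.sol hv.le m (mirror e T x) hmT.ge h5 (by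
      rw [norm_sub_rev, mirror_eq_reflect hmT, norm_reflect_sub he, hxm]; linarith)
    have h7 : ‖mirror e (T + ε) x - mirror e T x‖ = 2 * ε := by
      rw [show mirror e (T + ε) x - mirror e T x = (2 * ε) • e by unfold mirror; module,
        norm_smul, he, mul_one, Real.norm_of_nonneg (by positivity)]
    have h8 := hlip v hv.sol hv.le (mirror e T x) (mirror e (T + ε) x) h5 (by rw [h7]; linarith)
    rw [h7] at h8
    have h9 := (abs_le.1 h8).1
    have hvm : 0 ≤ v m := hv.nonneg (by rw [hmT]; exact hT.le)
    have h10 : C₂ * (2 * ε) * v (mirror e T x) ≤ C₂ * (2 * ε) * (C₁ * v m) := by gcongr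
    have h11 : c * (C * ε) * v m ≤ c * (T - ⟪e, x⟫) * v m := by
      gcongr; linarith
    have h12 : c * (C * ε) * v m = C₂ * (2 * ε) * (C₁ * v m) := by rw [hC]; field_simp
    linarith
  intro x hx0 hx
  rcases le_total ⟪e, x⟫ (T - C * ε) with h | h
  · exact hfar x hx0 h
  · refine hnarrow e v he hv (T + ε) (T - C * ε) (T + ε) (by linarith) le_rfl (by linarith)
      (fun y hy => hfar y (by linarith) hy.le) (fun y hy => by rw [mirror_of_inner_eq hy]) x h hx

lemma IsBddSol.le_mirror (hlam : 0 < lam) (hLam : lam ≤ Lam) (hn : 1 ≤ n) (hβ : 0 < β)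
    (hγ : lam * (n - 1) ≤ Lam * (2 * β + 1)) (hp : 1 < p) (hM : 0 ≤ M) {e : Eucl n}
    (he : ‖e‖ = 1) {v : Eucl n → ℝ} (hv : IsBddSol lam Lam p M e v) {t : ℝ} :
    ∀ x, 0 ≤ ⟪e, x⟫ → ⟪e, x⟫ ≤ t → v x ≤ v (mirror e t x) := by
  obtain ⟨h₀, hh₀, hnarrow⟩ := exists_narrow (n := n) hlam hLam hn hp hM
  have hstart : ∀ t ≤ h₀, ∀ x, 0 ≤ ⟪e, x⟫ → ⟪e, x⟫ ≤ t → v x ≤ v (mirror e t x) := by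
    intro t ht x hx0 hxt
    refine hnarrow e v he hv t 0 t le_rfl le_rfl (by linarith) (fun y hy => ?_)
      (fun y hy => by rw [mirror_of_inner_eq hy]) x hx0 hxt
    rw [hv.zero y hy]
    exact hv.nonneg (by rw [inner_mirror he, hy]; linarith)
  rcases le_or_gt t h₀ with ht | ht
  · exact hstart t ht
  set s : Set ℝ := {t | ∀ x, 0 ≤ ⟪e, x⟫ → ⟪e, x⟫ ≤ t → v x ≤ v (mirror e t x)} with hs
  have hsub : Icc h₀ t ⊆ s := by
    refine IsClosed.Icc_subset_of_forall_exists_gt ?_ (hstart h₀ le_rfl) ?_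
    · refine IsSeqClosed.isClosed fun τ τ₀ hτ hlim => ?_
      have hIcc : τ₀ ∈ Icc h₀ t := isClosed_Icc.mem_of_tendsto hlim
        (Eventually.of_forall fun k => (hτ k).2)
      refine ⟨fun x hx0 hx => ?_, hIcc⟩
      rcases hx.eq_or_lt with h | h
      · rw [mirror_of_inner_eq h]
      have hpos : mirror e τ₀ x ∈ halfSpace e := by
        change 0 < ⟪e, mirror e τ₀ x⟫
        rw [inner_mirror he]; linarith
      have hc : ContinuousAt v (mirror e τ₀ x) :=
        hv.sol.cont.continuousAt ((isOpen_halfSpace e).mem_nhds hpos)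
      have hc2 : Tendsto (fun k => mirror e (τ k) x) atTop (𝓝 (mirror e τ₀ x)) := by
        have : Continuous fun t : ℝ => mirror e t x := by unfold mirror; fun_prop
        exact (this.tendsto τ₀).comp hlim
      refine ge_of_tendsto (hc.tendsto.comp hc2) ?_
      filter_upwards [hlim.eventually (lt_mem_nhds h)] with k hk
      exact (hτ k).1 x hx0 hk.le
    · rintro T ⟨hT, hT1, hT2⟩ y hy
      obtain ⟨ε₀, hε₀, h⟩ := hv.exists_mirror_le_add hlam hLam hn hβ hγ hp hM he
        (hh₀.trans_le hT1) hT
      have hy' : 0 < y - T := sub_pos.2 hy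
      refine ⟨T + min ε₀ (y - T), h _ (by positivity) (min_le_left _ _), ?_, ?_⟩
      · have : 0 < min ε₀ (y - T) := by positivity
        linarith
      · have := min_le_right ε₀ (y - T)
        linarith
  exact hsub ⟨ht.le, le_rfl⟩

/-- Bounded nonnegative solutions in a half space vanishing on the boundary are trivial. -/
lemma IsBddSol.eq_zero (hlam : 0 < lam) (hLam : lam ≤ Lam) (hn : 1 ≤ n) (hβ : 0 < β)
    (hγ : lam * (n - 1) ≤ Lam * (2 * β + 1)) (hp : 1 < p) (hβp : β * (p - 1) = 1) (hM : 0 ≤ M)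
    {e : Eucl n} (he : ‖e‖ = 1) {v : Eucl n → ℝ} (hv : IsBddSol lam Lam p M e v) {x : Eucl n}
    (hx : 0 < ⟪e, x⟫) : v x = 0 := by
  by_contra hne
  have hvx : 0 < v x := (hv.nonneg hx.le).lt_of_ne' hne
  have hmono : ∀ (y : Eucl n) (σ : ℝ), 0 ≤ ⟪e, y⟫ → 0 ≤ σ → v y ≤ v (y + σ • e) := by
    intro y σ hy hσ
    have := hv.le_mirror hlam hLam hn hβ hγ hp hM he (t := ⟪e, y⟫ + σ / 2) y hy (by linarith)
    rwa [mirror, add_sub_cancel_left, mul_div_cancel₀ σ two_ne_zero] at this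
  have hc : ContinuousAt v x := hv.sol.cont.continuousAt ((isOpen_halfSpace e).mem_nhds hx)
  obtain ⟨δ, hδ, hball⟩ := Metric.nhds_basis_closedBall.mem_iff.1
    (inter_mem (hc.eventually (lt_mem_nhds (show v x / 2 < v x by linarith)))
      ((isOpen_halfSpace e).mem_nhds hx))
  obtain ⟨R, hR, hfalse⟩ := exists_radius_not_isSuper (n := n) hlam hLam hn hβ hγ hp hβp hδ
    (half_pos hvx)
  set y := x + R • e with hy
  have hyin : ⟪e, y⟫ = ⟪e, x⟫ + R := by
    rw [hy, inner_add_right, inner_smul_right, real_inner_self_eq_norm_sq, he]; ring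
  have hsub : closedBall y R ⊆ halfSpace e := (closedBall_subset_ball (by linarith)).trans
    (ball_subset_halfSpace he hyin.ge)
  refine hfalse y v (hv.sol.cont.mono hsub) (fun z hz => hv.sol.nonneg z (hsub hz))
    (hv.sol.sup.mono (ball_subset_closedBall.trans hsub)) fun z hz => ?_
  have hz' : z - R • e ∈ closedBall x δ := by
    rw [mem_closedBall, dist_eq_norm]
    rwa [show z - R • e - x = z - y by rw [hy]; abel]
  have h1 := hball hz'
  have h2 := hmono (z - R • e) R (le_of_lt h1.2) hR.le
  rw [sub_add_cancel] at h2
  exact (le_of_lt h1.1).trans h2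

end MovingPlane

section Rescaling

variable {n : ℕ} {lam Lam β p : ℝ}

lemma rpow_scaling (hβp : β * (p - 1) = 1) {s t : ℝ} (hs : 0 < s) (ht : 0 ≤ t) :
    s ^ (2 * β) * s ^ 2 * t ^ p = (s ^ (2 * β) * t) ^ p := by
  rw [Real.mul_rpow (by positivity) ht, ← Real.rpow_mul hs.le, ← Real.rpow_natCast s 2,
    ← Real.rpow_add hs]
  congr 2
  push_cast
  linarith

/-- Scaling invariance of the equation. -/
lemma IsSol.scale (hβp : β * (p - 1) = 1) {Ω Ω' : Set (Eucl n)} (hΩ' : IsOpen Ω')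
    {v : Eucl n → ℝ} (hv : IsSol lam Lam p Ω v) (y : Eucl n) {s : ℝ} (hs : 0 < s)
    (hΩ : ∀ z ∈ Ω', y + s • z ∈ Ω) :
    IsSol lam Lam p Ω' (fun z => s ^ (2 * β) * v (y + s • z)) := by
  have hk : 0 < s ^ (2 * β) := by positivity
  have h1 := hv.sub.comp_affine hk hs y (LinearIsometryEquiv.refl ℝ (Eucl n))
    (𝒜' := admissible n lam Lam) (fun c hc => Coeff.map_mem_admissible _ hc) hΩ
  have h2 := hv.sup.comp_affine hk hs y (LinearIsometryEquiv.refl ℝ (Eucl n))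
    (𝒜' := admissible n lam Lam) (fun c hc => Coeff.map_mem_admissible _ hc) hΩ
  have heq : ∀ z ∈ Ω', s ^ (2 * β) * s ^ 2 * v (y + s • z) ^ p =
      (s ^ (2 * β) * v (y + s • z)) ^ p := fun z hz =>
    rpow_scaling hβp hs (hv.nonneg _ (hΩ z hz))
  refine ⟨?_, fun z hz => mul_nonneg hk.le (hv.nonneg _ (hΩ z hz)), ?_, ?_⟩
  · exact continuousOn_const.mul (hv.cont.comp (by fun_prop) hΩ)
  · exact h1.congr hΩ' (fun z _ => rfl) fun z hz => (heq z hz).le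
  · exact h2.congr hΩ' (fun z _ => rfl) fun z hz => (heq z hz).ge

/-- Nonnegative solutions in a half space vanishing on the boundary. -/
structure IsHalfSol {n : ℕ} (lam Lam p : ℝ) (e : Eucl n) (v : Eucl n → ℝ) : Prop where
  sol : IsSol lam Lam p (halfSpace e) v
  cont : ContinuousOn v {x | 0 ≤ ⟪e, x⟫}
  zero : ∀ x, ⟪e, x⟫ = 0 → v x = 0

lemma IsHalfSol.nonneg {e : Eucl n} {v : Eucl n → ℝ} (h : IsHalfSol lam Lam p e v) {x : Eucl n}
    (hx : 0 ≤ ⟪e, x⟫) : 0 ≤ v x := by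
  rcases hx.eq_or_lt with h0 | h0
  · exact (h.zero x h0.symm).ge
  · exact h.sol.nonneg x h0

lemma IsHalfSol.scale (hβp : β * (p - 1) = 1) {e : Eucl n} {v : Eucl n → ℝ}
    (hv : IsHalfSol lam Lam p e v) {y : Eucl n} (hy : ⟪e, y⟫ = 0) {s : ℝ} (hs : 0 < s) :
    IsHalfSol lam Lam p e (fun z => s ^ (2 * β) * v (y + s • z)) := by
  have hin : ∀ z, ⟪e, y + s • z⟫ = s * ⟪e, z⟫ := fun z => by
    rw [inner_add_right, hy, inner_smul_right, zero_add]
  refine ⟨hv.sol.scale hβp (isOpen_halfSpace e) y hs fun z hz => ?_, ?_, fun x hx => ?_⟩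
  · change 0 < ⟪e, y + s • z⟫
    rw [hin]; exact mul_pos hs hz
  · refine continuousOn_const.mul (hv.cont.comp (by fun_prop) fun z hz => ?_)
    change 0 ≤ ⟪e, y + s • z⟫
    rw [hin]; exact mul_nonneg hs.le hz
  · rw [hv.zero _ (by rw [hin, hx, mul_zero]), mul_zero]

/-- Selection of a rescaled solution which is controlled on a large ball. -/
lemma IsHalfSol.exists_doubling (hβ : 0 < β) (hβp : β * (p - 1) = 1) {e : Eucl n}
    (he : ‖e‖ = 1) {u : Eucl n → ℝ} (hu : IsHalfSol lam Lam p e u) {a : Eucl n} (ha : 0 < ⟪e, a⟫)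
    (hua : 0 < u a) (L : ℝ) :
    ∃ v D, IsHalfSol lam Lam p e v ∧ 0 < D ∧ 0 < v e ∧ L ≤ D ^ (2 * β) * v e ∧
      ∀ z, 0 ≤ ⟪e, z⟫ → ‖z - e‖ ≤ D → v z ≤ 2 ^ (2 * β) * v e := by
  have hγ0 : 0 < 2 * β := by positivity
  obtain ⟨k, hk1, hk2⟩ : ∃ k : ℝ, ‖a‖ < k ∧ L ≤ (k - ‖a‖) ^ (2 * β) / 2 ^ (2 * β) * u a := by
    have h1 : Tendsto (fun k : ℝ => (k - ‖a‖) ^ (2 * β) / 2 ^ (2 * β) * u a) atTop atTop :=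
      (((tendsto_rpow_atTop hγ0).comp (tendsto_atTop_add_const_right _ (-‖a‖) tendsto_id)
        ).atTop_div_const (by positivity)).atTop_mul_const hua
    exact ((eventually_gt_atTop _).and (h1.eventually_ge_atTop L)).exists
  have hcs : Continuous fun x : Eucl n => ⟪e, x⟫ := by fun_prop
  have hK : IsCompact (closedBall (0 : Eucl n) k ∩ {x | 0 ≤ ⟪e, x⟫}) :=
    (isCompact_closedBall _ _).inter_right (isClosed_le continuous_const hcs)
  have hΦ : ContinuousOn (fun x => (k - ‖x‖) ^ (2 * β) * u x)
      (closedBall (0 : Eucl n) k ∩ {x | 0 ≤ ⟪e, x⟫}) := by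
    refine ContinuousOn.mul (Continuous.continuousOn ?_) (hu.cont.mono inter_subset_right)
    exact Continuous.rpow_const (by fun_prop) fun _ => Or.inr hγ0.le
  have haK : a ∈ closedBall (0 : Eucl n) k ∩ {x | 0 ≤ ⟪e, x⟫} :=
    ⟨by rw [mem_closedBall_zero_iff]; exact hk1.le, ha.le⟩
  obtain ⟨y, ⟨hyk, hy0⟩, hmax⟩ := hK.exists_isMaxOn ⟨a, haK⟩ hΦ
  have hmax' := isMaxOn_iff.1 hmax
  have hka : 0 < k - ‖a‖ := sub_pos.2 hk1
  have hpos : 0 < (k - ‖y‖) ^ (2 * β) * u y :=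
    lt_of_lt_of_le (by positivity) (hmax' a haK)
  rw [mem_closedBall_zero_iff] at hyk
  have huy0 : 0 ≤ u y := hu.nonneg hy0
  have hd0 : 0 ≤ k - ‖y‖ := sub_nonneg.2 hyk
  have huy : 0 < u y := pos_of_mul_pos_right hpos (by positivity)
  have hmaxa := hmax' a haK
  set d := k - ‖y‖ with hd
  have hd1 : 0 < d := by
    refine hd0.lt_of_ne fun h => ?_
    rw [← h, Real.zero_rpow hγ0.ne', zero_mul] at hpos
    exact lt_irrefl _ hpos
  have hy1 : 0 < ⟪e, y⟫ := by
    refine lt_of_le_of_ne hy0 fun h => ?_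
    rw [hu.zero y h.symm] at huy
    exact lt_irrefl _ huy
  set h := ⟪e, y⟫ with hh
  set b := y - h • e with hb
  have hbe : ⟪e, b⟫ = 0 := by
    rw [hb, inner_sub_right, inner_smul_right, real_inner_self_eq_norm_sq, he]; ring
  have hbh : b + h • e = y := by rw [hb, sub_add_cancel]
  refine ⟨_, d / (2 * h), hu.scale hβp hbe hy1, by positivity, ?_, ?_, fun z hz hzD => ?_⟩
  · simp only [hbh]; positivity
  · simp only [hbh]
    refine hk2.trans ?_
    have h1 : (d / (2 * h)) ^ (2 * β) * (h ^ (2 * β) * u y) =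
        d ^ (2 * β) * u y / 2 ^ (2 * β) := by
      rw [Real.div_rpow hd1.le (by positivity), Real.mul_rpow (by norm_num) hy1.le]
      field_simp
    rw [h1, le_div_iff₀ (by positivity)]
    refine le_trans (le_of_eq ?_) hmaxa
    field_simp
  · simp only [hbh]
    have hzy : ‖b + h • z - y‖ ≤ d / 2 := by
      rw [← hbh, add_sub_add_left_eq_sub, ← smul_sub, norm_smul, Real.norm_of_nonneg hy1.le]
      calc h * ‖z - e‖ ≤ h * (d / (2 * h)) := by gcongr
        _ = d / 2 := by field_simp
    have hin : 0 ≤ ⟪e, b + h • z⟫ := by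
      rw [inner_add_right, hbe, inner_smul_right, zero_add]; positivity
    set x := b + h • z with hx
    have hxn : ‖x‖ ≤ ‖y‖ + d / 2 := by
      have := norm_sub_norm_le x y
      linarith
    have h1 := hmax' x ⟨by rw [mem_closedBall_zero_iff]; linarith, hin⟩
    have hux : 0 ≤ u x := hu.nonneg hin
    have h2 : (d / 2) ^ (2 * β) * u x ≤ d ^ (2 * β) * u y := by
      refine le_trans ?_ h1
      gcongr
      linarith
    rw [Real.div_rpow hd1.le (by norm_num), div_mul_eq_mul_div, div_le_iff₀ (by positivity)] at h2
    have h3 : 0 < d ^ (2 * β) := by positivity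
    have h4 : d ^ (2 * β) * u x ≤ d ^ (2 * β) * (2 ^ (2 * β) * u y) := by linarith
    have h5 := le_of_mul_le_mul_left h4 h3
    calc h ^ (2 * β) * u x ≤ h ^ (2 * β) * (2 ^ (2 * β) * u y) := by gcongr
      _ = _ := by ring

end Rescaling

section Normalization

variable {n : ℕ} {lam Lam β p : ℝ}

/-- A controlled solution cannot be too large at `e`. -/
lemma exists_le_of_doubling (hlam : 0 < lam) (hLam : lam ≤ Lam) (hn : 1 ≤ n) (hβ : 0 < β)
    (hγ : lam * (n - 1) ≤ Lam * (2 * β + 1)) (hp : 1 < p) (hβp : β * (p - 1) = 1) :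
    ∃ Θ > 0, ∀ (e : Eucl n) (v : Eucl n → ℝ) (D : ℝ), ‖e‖ = 1 → IsHalfSol lam Lam p e v →
      0 < D → 0 < v e → Θ ≤ D ^ (2 * β) * v e →
      (∀ z, 0 ≤ ⟪e, z⟫ → ‖z - e‖ ≤ D → v z ≤ 2 ^ (2 * β) * v e) → v e ≤ Θ := by
  have hLam0 : 0 < Lam := hlam.trans_le hLam
  have hγ0 : 0 < 2 * β := by positivity
  set S : ℝ := 2 ^ (2 * β) with hS
  have hS0 : 0 < S := by positivity
  have hS1 : 0 ≤ S ^ (p - 1) := Real.rpow_nonneg hS0.le _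
  set K := S * ((1 + n * Lam / lam) / 1 + (S ^ (p - 1) + 1) * 1 / (8 * lam)) with hK
  have hK0 : 0 < K := by positivity
  set δ := min (1 / 8) (1 / (2 * K)) with hδ
  have hδ0 : 0 < δ := by positivity
  obtain ⟨R, hR, hfalse⟩ := exists_radius_not_isSuper (n := n) hlam hLam hn hβ hγ hp hβp hδ0
    (show (0 : ℝ) < 1 / 2 by norm_num)
  refine ⟨(R + 1) ^ (2 * β), by positivity, fun e v D he hv hD hve hDv hz => ?_⟩
  by_contra! hcon
  have hee : ⟪e, e⟫ = 1 := by rw [real_inner_self_eq_norm_sq, he, one_pow]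
  set s := (v e) ^ (-(1 / (2 * β))) with hs
  have hs0 : 0 < s := by positivity
  have hsγ : s ^ (2 * β) * v e = 1 := by
    rw [hs, ← Real.rpow_mul hve.le, neg_mul, one_div_mul_cancel hγ0.ne', Real.rpow_neg_one,
      inv_mul_cancel₀ hve.ne']
  have hs1 : s * (R + 1) ≤ 1 := by
    by_contra! h
    have h1 := Real.rpow_lt_rpow zero_le_one h hγ0
    rw [Real.one_rpow, Real.mul_rpow hs0.le (by positivity)] at h1
    have h2 : s ^ (2 * β) * (R + 1) ^ (2 * β) ≤ s ^ (2 * β) * v e := by gcongr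
    linarith
  have hsD : s * (R + 1) ≤ D := by
    by_contra! h
    have h1 := Real.rpow_lt_rpow hD.le h hγ0
    rw [Real.mul_rpow hs0.le (by positivity)] at h1
    have h2 : D ^ (2 * β) * v e < s ^ (2 * β) * (R + 1) ^ (2 * β) * v e := by gcongr
    have h3 : s ^ (2 * β) * (R + 1) ^ (2 * β) * v e = (s ^ (2 * β) * v e) * (R + 1) ^ (2 * β) := by
      ring
    rw [h3, hsγ, one_mul] at h2
    linarith
  have hpos : ∀ z ∈ ball (0 : Eucl n) (R + 1), e + s • z ∈ halfSpace e := by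
    intro z hz
    rw [mem_ball_zero_iff] at hz
    refine ball_subset_halfSpace he hee.ge ?_
    rw [mem_ball, dist_eq_norm, add_sub_cancel_left, norm_smul, Real.norm_of_nonneg hs0.le]
    calc s * ‖z‖ < s * (R + 1) := by gcongr
      _ ≤ 1 := hs1
  have hw := hv.sol.scale hβp isOpen_ball e hs0 hpos
  set w : Eucl n → ℝ := fun z => s ^ (2 * β) * v (e + s • z) with hwdef
  have hw0 : w 0 = 1 := by simp only [hwdef, smul_zero, add_zero, hsγ]
  have hwS : ∀ z ∈ ball (0 : Eucl n) (R + 1), w z ≤ S := by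
    intro z hzb
    have hin : 0 < ⟪e, e + s • z⟫ := hpos z hzb
    rw [mem_ball_zero_iff] at hzb
    have h1 := hz (e + s • z) hin.le (by
      rw [add_sub_cancel_left, norm_smul, Real.norm_of_nonneg hs0.le]
      calc s * ‖z‖ ≤ s * (R + 1) := by gcongr
        _ ≤ D := hsD)
    calc w z ≤ s ^ (2 * β) * (S * v e) := by simp only [hwdef]; gcongr
      _ = S * (s ^ (2 * β) * v e) := by ring
      _ = S := by rw [hsγ, mul_one]
  have hb1 : ball (0 : Eucl n) 1 ⊆ ball 0 (R + 1) := ball_subset_ball (by linarith)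
  have hbR : closedBall (0 : Eucl n) R ⊆ ball 0 (R + 1) := closedBall_subset_ball (by linarith)
  refine hfalse 0 w (hw.cont.mono hbR) (fun z hz => hw.nonneg z (hbR hz))
    (hw.sup.mono (ball_subset_closedBall.trans hbR)) fun z hz => ?_
  have h1 := (hw.mono hb1).lipschitz hlam hLam hn hp one_pos hS0.le hS0
    (fun a ha => hwS a (hb1 ha)) (fun a ha => hwS a (hb1 ha)) (x := z) (by
      rw [mem_ball, dist_eq_norm]
      have : δ ≤ 1 / 8 := min_le_left _ _
      linarith)
  rw [hw0, ← hK] at h1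
  have h2 : K * ‖z - 0‖ ≤ 1 / 2 := by
    calc K * ‖z - 0‖ ≤ K * (1 / (2 * K)) := by gcongr; exact hz.trans (min_le_right _ _)
      _ = 1 / 2 := by field_simp
  have h3 := (abs_le.1 (h1.trans h2)).1
  linarith

/-- A controlled solution cannot be too small at `e`. -/
lemma exists_ge_of_doubling (hlam : 0 < lam) (hLam : lam ≤ Lam) (hβ : 0 < β)
    (hp : 1 < p) (hβp : β * (p - 1) = 1) :
    ∃ θ > 0, ∃ L > 0, ∀ (e : Eucl n) (v : Eucl n → ℝ) (D : ℝ), ‖e‖ = 1 →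
      IsHalfSol lam Lam p e v → 0 < D → 0 < v e → L ≤ D ^ (2 * β) * v e →
      (∀ z, 0 ≤ ⟪e, z⟫ → ‖z - e‖ ≤ D → v z ≤ 2 ^ (2 * β) * v e) → θ ≤ v e := by
  have hLam0 : 0 < Lam := hlam.trans_le hLam
  have hγ0 : 0 < 2 * β := by positivity
  set G : ℝ := 2 ^ (2 * β) with hG
  have hG0 : 0 < G := by positivity
  have hG1 : 1 ≤ G := Real.one_le_rpow (by norm_num) hγ0.le
  set A := 1 + n * Lam / lam with hA
  have hA1 : 1 ≤ A := by rw [hA]; linarith [show 0 ≤ n * Lam / lam by positivity]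
  set ℓ := 4 * G * A with hℓ
  have hℓ1 : 1 ≤ ℓ := by nlinarith
  have hℓ0 : 0 < ℓ := by linarith
  set η := lam / (2 * ℓ * G) with hη
  have hη0 : 0 < η := by positivity
  refine ⟨min 1 (η ^ β / G), by positivity, (ℓ + 1) ^ (2 * β), by positivity,
    fun e v D he hv hD hve hDv hz => ?_⟩
  by_contra! hcon
  have hθ1 : v e < 1 := hcon.trans_le (min_le_left _ _)
  have hθ2 : v e < η ^ β / G := hcon.trans_le (min_le_right _ _)
  have hee : ⟪e, e⟫ = 1 := by rw [real_inner_self_eq_norm_sq, he, one_pow]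
  have hDℓ : ℓ + 1 ≤ D := by
    by_contra! h
    have h1 := Real.rpow_lt_rpow hD.le h hγ0
    have h2 : D ^ (2 * β) * v e ≤ D ^ (2 * β) * 1 := by gcongr
    linarith
  set S := G * v e with hS
  have hS0 : 0 < S := by positivity
  have hSp : S ^ (p - 1) ≤ η := by
    have h1 : S ≤ η ^ β := by
      rw [hS, mul_comm]; exact ((lt_div_iff₀ hG0).1 hθ2).le
    calc S ^ (p - 1) ≤ (η ^ β) ^ (p - 1) := Real.rpow_le_rpow hS0.le h1 (by linarith)
      _ = η := by rw [← Real.rpow_mul hη0.le, hβp, Real.rpow_one]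
  have hvS : ∀ x ∈ closedBall (0 : Eucl n) ℓ, 0 ≤ ⟪e, x⟫ → v x ≤ S := by
    intro x hx h0
    rw [mem_closedBall_zero_iff] at hx
    refine hz x h0 ((norm_sub_le x e).trans ?_)
    rw [he]; linarith
  have hcs : Continuous fun x : Eucl n => ⟪e, x⟫ := by fun_prop
  have key := (hv.sol.sub.mono (fun x hx => by
    have := hx.2.1; rw [sub_zero] at this; exact this)).slab_barrier hlam hLam
    (m := 0) he (h := ℓ) hℓ0 hS0.le (N := 2 * η * S) (by positivity)
    (hv.cont.mono fun x hx => by simpa using hx.2.1)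
    (fun x hx h0 _ hvx => by
      rw [sub_zero] at h0
      have h1 := hvS x (ball_subset_closedBall hx) h0.le
      have h2 : v x ^ (p - 1) ≤ η :=
        (Real.rpow_le_rpow hvx.le h1 (by linarith)).trans hSp
      have h3 : v x ^ p = v x ^ (p - 1) * v x := by
        rw [← Real.rpow_add_one' hvx.le (by linarith), sub_add_cancel]
      have h4 : v x ^ (p - 1) * v x ≤ η * S := by gcongr
      have h5 : 0 < η * S := by positivity
      rw [h3]; linarith)
    (fun x hx h0 _ => by rw [sub_zero] at h0; exact hvS x hx h0)
    (fun x _ h0 => by rw [sub_zero] at h0; exact (hv.zero x h0).le)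
    (fun x hx h0 => by
      rw [sub_zero] at h0
      rw [mem_ball_zero_iff] at hx
      have := real_inner_le_norm e x
      rw [he, one_mul, h0] at this
      exact absurd hx (not_lt.2 this))
    e (by rw [mem_closedBall_zero_iff, he]; exact hℓ1) (by rw [sub_zero, hee]; norm_num)
    (by rw [sub_zero, hee]; exact hℓ1)
  rw [sub_zero, hee, he] at key
  have h1 : (2 * n * Lam * (S / ℓ ^ 2) + 2 * η * S) / (2 * lam) * (ℓ * 1 - 1 ^ 2) ≤
      (2 * n * Lam * (S / ℓ ^ 2) + 2 * η * S) / (2 * lam) * ℓ := by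
    gcongr; linarith
  have h2 : (2 * n * Lam * (S / ℓ ^ 2) + 2 * η * S) / (2 * lam) * ℓ =
      S * (n * Lam / lam) / ℓ + S * η * ℓ / lam := by field_simp
  have h3 : S / ℓ ^ 2 * 1 ^ 2 ≤ S / ℓ := by
    rw [one_pow, mul_one]
    gcongr
    nlinarith
  have h4 : S / ℓ + S * (n * Lam / lam) / ℓ = v e / 4 := by
    rw [← add_div, show S + S * (n * Lam / lam) = S * A by rw [hA]; ring, hS, hℓ]
    field_simp
  have h5 : S * η * ℓ / lam = v e / 2 := by rw [hS, hη]; field_simp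
  linarith

/-- Existence of normalized solutions controlled on arbitrarily large balls. -/
lemma IsHalfSol.exists_normalized (hlam : 0 < lam) (hLam : lam ≤ Lam) (hn : 1 ≤ n) (hβ : 0 < β)
    (hγ : lam * (n - 1) ≤ Lam * (2 * β + 1)) (hp : 1 < p) (hβp : β * (p - 1) = 1) {e : Eucl n}
    (he : ‖e‖ = 1) {u : Eucl n → ℝ} (hu : IsHalfSol lam Lam p e u) {a : Eucl n} (ha : 0 < ⟪e, a⟫)
    (hua : 0 < u a) :
    ∃ θ > 0, ∃ M > 0, ∀ ρ : ℝ, ∃ v, IsHalfSol lam Lam p e v ∧ θ ≤ v e ∧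
      ∀ z, 0 ≤ ⟪e, z⟫ → ‖z - e‖ ≤ ρ → v z ≤ M := by
  have hγ0 : 0 < 2 * β := by positivity
  obtain ⟨Θ, hΘ, hle⟩ := exists_le_of_doubling (n := n) hlam hLam hn hβ hγ hp hβp
  obtain ⟨θ, hθ, L, hL, hge⟩ := exists_ge_of_doubling (n := n) hlam hLam hβ hp hβp
  refine ⟨θ, hθ, 2 ^ (2 * β) * Θ, by positivity, fun ρ => ?_⟩
  obtain ⟨v, D, hv, hD, hve, hDv, hz⟩ := hu.exists_doubling hβ hβp he ha hua
    (max (max Θ L) (|ρ| ^ (2 * β) * Θ))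
  have h1 := hle e v D he hv hD hve
    (((le_max_left _ _).trans (le_max_left _ _)).trans hDv) hz
  have h2 := hge e v D he hv hD hve
    (((le_max_right _ _).trans (le_max_left _ _)).trans hDv) hz
  have h3 : ρ ≤ D := by
    by_contra! h
    have h4 := Real.rpow_lt_rpow hD.le (h.trans_le (le_abs_self ρ)) hγ0
    have h5 : D ^ (2 * β) * v e < |ρ| ^ (2 * β) * Θ := by
      calc D ^ (2 * β) * v e < |ρ| ^ (2 * β) * v e := by gcongr
        _ ≤ _ := by gcongr
    linarith [(le_max_right _ _).trans hDv]
  refine ⟨v, hv, h2, fun z hz0 hzρ => (hz z hz0 (hzρ.trans h3)).trans ?_⟩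
  gcongr

end Normalization

section Limit

variable {n : ℕ} {lam Lam β p : ℝ}

/-- Solutions are stable under locally uniform limits. -/
lemma isSol_of_approx (hlam : 0 < lam) (hLam : lam ≤ Lam) (hp : 1 < p) {Ω : Set (Eucl n)}
    (hΩ : IsOpen Ω) {v : Eucl n → ℝ} (hv : ContinuousOn v Ω) (hv0 : ∀ x ∈ Ω, 0 ≤ v x)
    (h : ∀ x₀ ∈ Ω, ∃ r > 0, ∀ ε > 0, ∃ v', IsSol lam Lam p (ball x₀ r) v' ∧
      ∀ x ∈ ball x₀ r, |v' x - v x| ≤ ε) : IsSol lam Lam p Ω v := by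
  have hLam0 : 0 < Lam := hlam.trans_le hLam
  have key : ∀ x₀ ∈ Ω, ∀ ε > 0, ∃ r > 0, ∀ ε' > 0, ∃ v',
      IsSol lam Lam p (ball x₀ r) v' ∧ ContinuousOn v' (closedBall x₀ r) ∧
      (∀ x ∈ closedBall x₀ r, |v' x - v x| ≤ ε') ∧
      ∀ x ∈ ball x₀ r, |v' x ^ p - v x₀ ^ p| ≤ ε := by
    intro x₀ hx₀ ε hε
    obtain ⟨r₀, hr₀, happ⟩ := h x₀ hx₀
    have hG : ContinuousAt (fun t : ℝ => t ^ p) (v x₀) :=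
      Real.continuousAt_rpow_const _ _ (Or.inr (by linarith))
    obtain ⟨η, hη, hGη⟩ := Metric.continuousAt_iff.1 hG ε hε
    have hc : ContinuousAt v x₀ := hv.continuousAt (hΩ.mem_nhds hx₀)
    obtain ⟨δ, hδ, hvδ⟩ := Metric.continuousAt_iff.1 hc (η / 2) (half_pos hη)
    refine ⟨min (r₀ / 2) (δ / 2), by positivity, fun ε' hε' => ?_⟩
    set r := min (r₀ / 2) (δ / 2)
    have hr1 : r ≤ r₀ / 2 := min_le_left _ _
    have hr2 : r ≤ δ / 2 := min_le_right _ _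
    have hsub : closedBall x₀ r ⊆ ball x₀ r₀ := closedBall_subset_ball (by linarith)
    obtain ⟨v', hv', hvv'⟩ := happ (min ε' (η / 4)) (by positivity)
    refine ⟨v', hv'.mono (ball_subset_closedBall.trans hsub), hv'.cont.mono hsub,
      fun x hx => (hvv' x (hsub hx)).trans (min_le_left _ _), fun x hx => ?_⟩
    have h1 := (hvv' x (hsub (ball_subset_closedBall hx))).trans (min_le_right _ _)
    have h2 := hvδ (x := x) (by rw [mem_ball] at hx; linarith)
    rw [Real.dist_eq] at h2
    have h3 : |v' x - v x₀| < η := by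
      have := abs_sub_le (v' x) (v x) (v x₀)
      linarith
    have h4 := hGη (x := v' x) (by rwa [Real.dist_eq])
    rw [Real.dist_eq] at h4
    exact h4.le
  refine ⟨hv, hv0, ?_, ?_⟩
  · refine isSub_of_approx hlam.le hLam0 subset_rfl fun x₀ hx₀ ε hε => ?_
    obtain ⟨r, hr, hr'⟩ := key x₀ hx₀ ε hε
    refine ⟨r, hr, fun ε' hε' => ?_⟩
    obtain ⟨v', h1, h2, h3, h4⟩ := hr' ε' hε'
    exact ⟨v', _, h2, h1.sub, h3, fun x hx => by linarith [(abs_le.1 (h4 x hx)).2]⟩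
  · rw [isSuper_iff_forall_isSub]
    intro c hc
    refine isSub_of_approx hlam.le hLam0 (singleton_subset_iff.2 hc) fun x₀ hx₀ ε hε => ?_
    obtain ⟨r, hr, hr'⟩ := key x₀ hx₀ ε hε
    refine ⟨r, hr, fun ε' hε' => ?_⟩
    obtain ⟨v', h1, h2, h3, h4⟩ := hr' ε' hε'
    refine ⟨_, _, h2.neg, isSuper_iff_forall_isSub.1 h1.sup c hc, fun x hx => ?_, fun x hx => ?_⟩
    · have h5 := h3 x hx
      rwa [Pi.neg_apply, neg_sub_neg, abs_sub_comm]
    · linarith [(abs_le.1 (h4 x hx)).1]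

/-- Linear bound near the boundary. -/
lemma IsHalfSol.boundary_le (hlam : 0 < lam) (hLam : lam ≤ Lam) (hp : 1 < p) {M : ℝ} (hM : 0 < M)
    {e : Eucl n} (he : ‖e‖ = 1) {v : Eucl n → ℝ} (hv : IsHalfSol lam Lam p e v) {z : Eucl n}
    (hz0 : 0 ≤ ⟪e, z⟫) (hz1 : ⟪e, z⟫ ≤ 1) (hM' : ∀ x, 0 ≤ ⟪e, x⟫ → ‖x - z‖ ≤ 2 → v x ≤ M) :
    v z ≤ (M + (2 * n * Lam * M + (M ^ p + 1)) / (2 * lam)) * ⟪e, z⟫ := by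
  have hLam0 : 0 < Lam := hlam.trans_le hLam
  set m := z - ⟪e, z⟫ • e with hm
  have hin : ∀ x, ⟪e, x - m⟫ = ⟪e, x⟫ := by
    intro x
    rw [hm, inner_sub_right, inner_sub_right, inner_smul_right, real_inner_self_eq_norm_sq, he]
    ring
  have hzm : ‖z - m‖ = ⟪e, z⟫ := by
    rw [hm, sub_sub_cancel, norm_smul, he, mul_one, Real.norm_of_nonneg hz0]
  have hMx : ∀ x ∈ closedBall m 1, 0 ≤ ⟪e, x⟫ → v x ≤ M := by
    intro x hx h0
    rw [mem_closedBall, dist_eq_norm] at hx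
    refine hM' x h0 ((norm_sub_le_norm_sub_add_norm_sub x m z).trans ?_)
    rw [norm_sub_rev m z, hzm]; linarith
  have key := (hv.sol.sub.mono (fun x hx => by
      have := hx.2.1; rw [hin] at this; exact this)).slab_barrier hlam hLam
    (m := m) he (h := 1) one_pos hM.le (N := M ^ p + 1) (by positivity)
    (hv.cont.mono fun x hx => by have := hx.2.1; rw [hin] at this; exact this)
    (fun x hx h0 _ hvx => by
      rw [hin] at h0
      have := Real.rpow_le_rpow hvx.le (hMx x (ball_subset_closedBall hx) h0.le)
        (show 0 ≤ p by linarith)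
      linarith)
    (fun x hx h0 _ => by rw [hin] at h0; exact hMx x hx h0)
    (fun x _ h0 => by rw [hin] at h0; exact (hv.zero x h0).le)
    (fun x hx h0 => by
      rw [mem_ball, dist_eq_norm] at hx
      have := real_inner_le_norm e (x - m)
      rw [he, one_mul, h0] at this
      exact absurd hx (not_lt.2 this))
    z (by rw [mem_closedBall, dist_eq_norm, hzm]; exact hz1) (by rw [hin]; exact hz0)
    (by rw [hin]; exact hz1)
  rw [hin, hzm, one_pow, div_one, one_mul] at key
  set s := ⟪e, z⟫
  set B := (2 * n * Lam * M + (M ^ p + 1)) / (2 * lam)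
  have hB0 : 0 ≤ B := by positivity
  have h1 : s ^ 2 ≤ s := by nlinarith
  have h2 : M * s ^ 2 ≤ M * s := by gcongr
  have h3 : B * (s - s ^ 2) ≤ B * s := by gcongr; nlinarith
  linarith

/-- A family of normalized solutions controlled on larger and larger balls has a bounded limit. -/
lemma exists_isBddSol_of_normalized (hlam : 0 < lam) (hLam : lam ≤ Lam) (hn : 1 ≤ n)
    (hp : 1 < p) {e : Eucl n} (he : ‖e‖ = 1) {θ M : ℝ} (hM : 0 < M)
    (h : ∀ ρ : ℝ, ∃ v, IsHalfSol lam Lam p e v ∧ θ ≤ v e ∧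
      ∀ z, 0 ≤ ⟪e, z⟫ → ‖z - e‖ ≤ ρ → v z ≤ M) :
    ∃ v, IsBddSol lam Lam p M e v ∧ θ ≤ v e := by
  have hLam0 : 0 < Lam := hlam.trans_le hLam
  choose! V hV hθ hVM using fun k : ℕ => h k
  set 𝒰 := hyperfilter ℕ with h𝒰
  have hle : (𝒰 : Filter ℕ) ≤ atTop := by
    rw [← Nat.cofinite_eq_atTop]; exact hyperfilter_le_cofinite
  have hlarge : ∀ R : ℝ, ∀ᶠ k : ℕ in (𝒰 : Filter ℕ), R ≤ k := fun R =>
    hle (tendsto_natCast_atTop_atTop.eventually_ge_atTop R)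
  have hbound : ∀ (a : Eucl n) (R : ℝ), ∀ᶠ k : ℕ in (𝒰 : Filter ℕ),
      ∀ z, 0 ≤ ⟪e, z⟫ → ‖z - a‖ ≤ R → V k z ≤ M := by
    intro a R
    filter_upwards [hlarge (R + ‖a - e‖)] with k hk z hz hza
    refine hVM k z hz ((norm_sub_le_norm_sub_add_norm_sub z a e).trans ?_)
    linarith
  have hlim : ∀ z, ∃ l, 0 ≤ ⟪e, z⟫ → l ∈ Icc 0 M ∧ Tendsto (fun k => V k z) 𝒰 (𝓝 l) := by
    intro z
    by_cases hz : 0 ≤ ⟪e, z⟫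
    · have hmem : ((𝒰.map fun k => V k z : Ultrafilter ℝ) : Filter ℝ) ≤ 𝓟 (Icc 0 M) := by
        rw [le_principal_iff]
        change ∀ᶠ k in (𝒰 : Filter ℕ), V k z ∈ Icc 0 M
        filter_upwards [hbound z 0] with k hk
        exact ⟨(hV k).nonneg hz, hk z hz (by simp)⟩
      obtain ⟨l, hl, hl'⟩ := isCompact_Icc.ultrafilter_le_nhds _ hmem
      exact ⟨l, fun _ => ⟨hl, hl'⟩⟩
    · exact ⟨0, fun h => absurd h hz⟩
  choose v hv using hlim
  have hvt : ∀ {z}, 0 ≤ ⟪e, z⟫ → Tendsto (fun k => V k z) 𝒰 (𝓝 (v z)) := fun hz => (hv _ hz).2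
  -- equi-Lipschitz bounds
  have hequi : ∀ x₀ ∈ halfSpace e, ∃ r > 0, ball x₀ r ⊆ halfSpace e ∧ ∃ K > 0,
      ∀ᶠ k in (𝒰 : Filter ℕ), ∀ x ∈ ball x₀ r, ∀ y ∈ ball x₀ r,
        |V k x - V k y| ≤ K * ‖x - y‖ := by
    intro x₀ hx₀
    have ht : 0 < ⟪e, x₀⟫ := hx₀
    set t := ⟪e, x₀⟫ with htdef
    refine ⟨t / 16, by positivity, (ball_subset_ball (by linarith)).trans
      (ball_subset_halfSpace he htdef.ge), M * ((1 + n * Lam / lam) / (t / 2) +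
      (M ^ (p - 1) + 1) * (t / 2) / (8 * lam)), by positivity, ?_⟩
    filter_upwards [hbound x₀ t] with k hk x hx y hy
    rw [mem_ball, dist_eq_norm] at hx hy
    have hsub : ball y (t / 2) ⊆ ball x₀ t := by
      refine ball_subset_ball' ?_
      rw [dist_eq_norm]; linarith
    have hsub' := hsub.trans (ball_subset_halfSpace he htdef.ge)
    have hMb : ∀ z ∈ ball y (t / 2), V k z ≤ M := fun z hz =>
      hk z (le_of_lt (hsub' hz)) (by
        have := hsub hz
        rw [mem_ball, dist_eq_norm] at this
        exact this.le)
    refine ((hV k).sol.mono hsub').lipschitz hlam hLam hn hp (by positivity) hM.le hM hMb hMb ?_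
    rw [mem_ball, dist_eq_norm]
    have := norm_sub_le_norm_sub_add_norm_sub x x₀ y
    rw [norm_sub_rev x₀ y] at this
    linarith
  have hvlip : ∀ x₀ ∈ halfSpace e, ∃ r > 0, ball x₀ r ⊆ halfSpace e ∧ ∃ K > 0,
      (∀ x ∈ ball x₀ r, ∀ y ∈ ball x₀ r, |v x - v y| ≤ K * ‖x - y‖) ∧
      ∀ᶠ k in (𝒰 : Filter ℕ), ∀ x ∈ ball x₀ r, ∀ y ∈ ball x₀ r,
        |V k x - V k y| ≤ K * ‖x - y‖ := by
    intro x₀ hx₀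
    obtain ⟨r, hr, hsub, K, hK, hev⟩ := hequi x₀ hx₀
    refine ⟨r, hr, hsub, K, hK, fun x hx y hy => ?_, hev⟩
    refine le_of_tendsto (((hvt (le_of_lt (hsub hx))).sub (hvt (le_of_lt (hsub hy)))).abs) ?_
    filter_upwards [hev] with k hk
    exact hk x hx y hy
  have hcont : ∀ x ∈ halfSpace e, ContinuousAt v x := by
    intro x hx
    obtain ⟨r, hr, -, K, hK, hK', -⟩ := hvlip x hx
    rw [Metric.continuousAt_iff]
    intro ε hε
    refine ⟨min r (ε / K), by positivity, fun {y} hy => ?_⟩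
    have h1 := hK' y (mem_ball.2 (hy.trans_le (min_le_left _ _))) x (mem_ball_self hr)
    have h2 : dist y x < ε / K := hy.trans_le (min_le_right _ _)
    rw [lt_div_iff₀ hK, dist_eq_norm] at h2
    rw [Real.dist_eq]
    linarith
  have hzero : ∀ x, ⟪e, x⟫ = 0 → v x = 0 := by
    intro x hx
    refine tendsto_nhds_unique (hvt hx.ge) ?_
    simp only [fun k => (hV k).zero x hx]
    exact tendsto_const_nhds
  set B := M + (2 * n * Lam * M + (M ^ p + 1)) / (2 * lam) with hB
  have hB0 : 0 < B := by positivity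
  have hbdry : ∀ z, 0 ≤ ⟪e, z⟫ → ⟪e, z⟫ ≤ 1 → v z ≤ B * ⟪e, z⟫ := by
    intro z hz0 hz1
    refine le_of_tendsto (hvt hz0) ?_
    filter_upwards [hbound z 2] with k hk
    exact (hV k).boundary_le hlam hLam hp hM he hz0 hz1 hk
  refine ⟨v, ⟨?_, ?_, hzero, fun x hx => (hv x (le_of_lt hx)).1.2⟩, ?_⟩
  · refine isSol_of_approx hlam hLam hp (isOpen_halfSpace e)
      (fun x hx => (hcont x hx).continuousWithinAt) (fun x hx => (hv x (le_of_lt hx)).1.1) ?_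
    intro x₀ hx₀
    obtain ⟨r, hr, hsub, K, hK, hK', hev⟩ := hvlip x₀ hx₀
    refine ⟨r, hr, fun ε hε => ?_⟩
    obtain ⟨t, htball, htfin, htcov⟩ := (totallyBounded_iff_subset.1
      ((isCompact_closedBall x₀ r).totallyBounded.subset ball_subset_closedBall))
      _ (dist_mem_uniformity (show 0 < ε / (4 * K) by positivity))
    have hall : ∀ᶠ k in (𝒰 : Filter ℕ), ∀ y ∈ t, |V k y - v y| < ε / 2 := by
      rw [eventually_all_finite htfin]
      intro y hy
      have h1 : Tendsto (fun k => |V k y - v y|) 𝒰 (𝓝 |v y - v y|) :=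
        ((hvt (le_of_lt (hsub (htball hy)))).sub tendsto_const_nhds).abs
      rw [sub_self, abs_zero] at h1
      exact h1.eventually (gt_mem_nhds (half_pos hε))
    obtain ⟨k, hk1, hk2⟩ := (hev.and hall).exists
    refine ⟨V k, (hV k).sol.mono hsub, fun x hx => ?_⟩
    obtain ⟨y, hy, hxy⟩ := mem_iUnion₂.1 (htcov hx)
    have hxy' : K * ‖x - y‖ ≤ ε / 4 := by
      have h2 : dist x y < ε / (4 * K) := hxy
      rw [dist_eq_norm] at h2
      calc K * ‖x - y‖ ≤ K * (ε / (4 * K)) := by gcongr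
        _ = ε / 4 := by field_simp
    have h3 := hk1 x hx y (htball hy)
    have h4 := hK' x hx y (htball hy)
    have h5 := hk2 y hy
    rw [abs_le] at h3 h4 ⊢
    rw [abs_lt] at h5
    constructor <;> linarith
  · intro x hx
    rcases (show 0 ≤ ⟪e, x⟫ from hx).eq_or_lt with h0 | h0
    · rw [Metric.continuousWithinAt_iff]
      intro ε hε
      refine ⟨min 1 (ε / B), by positivity, fun {y} hy hyx => ?_⟩
      have hy0 : 0 ≤ ⟪e, y⟫ := hy
      have h1 : ⟪e, y⟫ ≤ dist y x := by
        have := inner_sub_le_dist he y x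
        rwa [← h0, sub_zero, ← dist_eq_norm] at this
      have h2 := hbdry y hy0 (h1.trans (hyx.le.trans (min_le_left _ _)))
      have h3 : dist y x < ε / B := hyx.trans_le (min_le_right _ _)
      rw [hzero x h0.symm, Real.dist_eq, sub_zero, abs_of_nonneg (hv y hy0).1.1]
      rw [lt_div_iff₀ hB0] at h3
      have h4 : B * ⟪e, y⟫ ≤ B * dist y x := by gcongr
      linarith
    · exact (hcont x h0).continuousWithinAt
  · exact ge_of_tendsto (hvt (by rw [real_inner_self_eq_norm_sq]; positivity))
      (Eventually.of_forall hθ)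

/-- Liouville theorem in the half space. -/
lemma IsHalfSol.eq_zero (hlam : 0 < lam) (hLam : lam ≤ Lam) (hn : 1 ≤ n) (hβ : 0 < β)
    (hγ : lam * (n - 1) ≤ Lam * (2 * β + 1)) (hp : 1 < p) (hβp : β * (p - 1) = 1) {e : Eucl n}
    (he : ‖e‖ = 1) {u : Eucl n → ℝ} (hu : IsHalfSol lam Lam p e u) {a : Eucl n} (ha : 0 < ⟪e, a⟫) :
    u a = 0 := by
  by_contra hne
  obtain ⟨θ, hθ, M, hM, h⟩ := hu.exists_normalized hlam hLam hn hβ hγ hp hβp he ha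
    ((hu.nonneg ha.le).lt_of_ne' hne)
  obtain ⟨v, hv, hve⟩ := exists_isBddSol_of_normalized hlam hLam hn hp he hM h
  have := hv.eq_zero hlam hLam hn hβ hγ hp hβp hM.le he (x := e)
    (by rw [real_inner_self_eq_norm_sq, he]; norm_num)
  linarith

end Limit

end

theorem stmt2 (n : ℕ) (hn : 3 ≤ n) (lam Lam : ℝ) (hlam : 0 < lam) (hLam : lam ≤ Lam)
    (nt : ℝ) (hnt : nt = lam / Lam * ((n : ℝ) - 1) + 1)
    (p : ℝ) (hp : 1 < p)
    (hcrit : (2 < nt ∧ p ≤ nt / (nt - 2)) ∨ nt ≤ 2)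
    (u : EuclideanSpace ℝ (Fin n) → ℝ)
    (hu : ContinuousOn u {x | 0 ≤ x ⟨n - 1, by omega⟩})
    (hnonneg : ∀ x : EuclideanSpace ℝ (Fin n), 0 < x ⟨n - 1, by omega⟩ → 0 ≤ u x)
    (hbdry : ∀ x : EuclideanSpace ℝ (Fin n), x ⟨n - 1, by omega⟩ = 0 → u x = 0)
    (hsuper : PucciSupersol lam Lam {x | 0 < x ⟨n - 1, by omega⟩} u (fun x => u x ^ p))
    (hsub : PucciSubsol lam Lam {x | 0 < x ⟨n - 1, by omega⟩} u (fun x => u x ^ p)) :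
    ∀ x : EuclideanSpace ℝ (Fin n), 0 ≤ x ⟨n - 1, by omega⟩ → u x = 0 := by
  intro x hx
  rcases hx.eq_or_lt with h0 | h0
  · exact hbdry x h0.symm
  have hLam0 : 0 < Lam := hlam.trans_le hLam
  set e : Eucl n := EuclideanSpace.single ⟨n - 1, by omega⟩ 1 with he
  have hin : ∀ y : Eucl n, inner ℝ e y = y ⟨n - 1, by omega⟩ := fun y => by
    rw [he, EuclideanSpace.inner_single_left]; simp
  have hnorm : ‖e‖ = 1 := by rw [he, PiLp.norm_single, norm_one]
  have hH : halfSpace e = {x | 0 < x ⟨n - 1, by omega⟩} := by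
    ext y; simp only [halfSpace, hin]
  have hp1 : 0 < p - 1 := sub_pos.2 hp
  have hγ : lam * (n - 1) ≤ Lam * (2 * (1 / (p - 1)) + 1) := by
    have h1 : nt ≤ 2 * (1 / (p - 1)) + 2 := by
      rcases hcrit with ⟨h2, h3⟩ | h2
      · have h4 : 0 < nt - 2 := by linarith
        rw [le_div_iff₀ h4] at h3
        have h5 : (nt - 2) * (p - 1) ≤ 2 := by linarith
        rw [← le_div_iff₀ hp1] at h5
        have : 2 * (1 / (p - 1)) = 2 / (p - 1) := by ring
        linarith
      · have : 0 < 2 * (1 / (p - 1)) := by positivity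
        linarith
    have h6 : lam * (n - 1) = Lam * (nt - 1) := by rw [hnt]; field_simp; ring
    rw [h6]
    gcongr
    linarith
  have hsol : IsHalfSol lam Lam p e u := by
    refine ⟨?_, ?_, fun y hy => hbdry y (by rwa [hin] at hy)⟩
    · rw [hH]
      exact ⟨hu.mono fun y (hy : 0 < y _) => show 0 ≤ y _ from hy.le, hnonneg, hsub.isSub hLam, hsuper.isSuper⟩
    · simpa only [hin] using hu
  exact hsol.eq_zero hlam hLam (by omega) (one_div_pos.2 hp1) hγ hp (by field_simp) hnorm
    (by rw [hin]; exact h0)
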